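/- There exists a constant C > 0, depending only on T, α, β, K and δ, such that for every classical solution (v,u,θ,w,b) of the planar compressible MHD system on ℝ × [0,T] with (K,δ)-admissible initial data, one has sup_{0≤t≤T} ∫_ℝ θ_x(x,t)² dx + ∫₀^T ∫_ℝ ( θ_t² + θ_xx² ) dx dt ≤ C. -/

import Mathlib

open MeasureTheory Set Filter

noncomputable section

/-- Viscosity function `μ(z) = 1 + α z^(−α)` (here `μ̃₁ = 1`, `μ̃₂ = α`). -/
def visc (α z : ℝ) : ℝ := 1 + α * z ^ (-α)

/-- Squared Euclidean norm on `ℝ × ℝ` (used for the transverse fields `w, b ∈ ℝ²`). -/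
def sq2 (p : ℝ × ℝ) : ℝ := p.1 ^ 2 + p.2 ^ 2

/-- Partial derivative with respect to the first (spatial) variable. -/
def pdx {E : Type*} [NormedAddCommGroup E] [NormedSpace ℝ E]
    (f : ℝ → ℝ → E) (x t : ℝ) : E := deriv (fun y => f y t) x

/-- Partial derivative with respect to the second (time) variable, taken within `[0, T]`
(so it is one-sided at the endpoints). -/
def pdt (T : ℝ) {E : Type*} [NormedAddCommGroup E] [NormedSpace ℝ E]
    (f : ℝ → ℝ → E) (x t : ℝ) : E := derivWithin (fun s => f x s) (Icc 0 T) t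

/-- A classical solution of the planar compressible MHD system (in Lagrangian coordinates,
with all physical constants normalized to `1` and `μ̃₂ = α`) on `ℝ × [0,T]`:
all the derivatives appearing in the equations exist and are continuous, `v, θ > 0`,
the five equations hold pointwise, the solution tends to `(1,0,1,0,0)` as `|x| → ∞`
uniformly in `t ∈ [0,T]`, and `v−1, u, θ−1, b, w` and their first spatial derivatives
are square-integrable in `x` for each `t ∈ [0,T]`. -/
structure IsClassicalSolution (α β T : ℝ) (v u θ : ℝ → ℝ → ℝ)
    (w b : ℝ → ℝ → ℝ × ℝ) : Prop where
  v_pos : ∀ x : ℝ, ∀ t ∈ Icc (0:ℝ) T, 0 < v x t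
  θ_pos : ∀ x : ℝ, ∀ t ∈ Icc (0:ℝ) T, 0 < θ x t
  diff_x : ∀ x : ℝ, ∀ t ∈ Icc (0:ℝ) T,
    DifferentiableAt ℝ (fun y => v y t) x ∧ DifferentiableAt ℝ (fun y => u y t) x ∧
    DifferentiableAt ℝ (fun y => θ y t) x ∧ DifferentiableAt ℝ (fun y => w y t) x ∧
    DifferentiableAt ℝ (fun y => b y t) x
  diff_xx : ∀ x : ℝ, ∀ t ∈ Icc (0:ℝ) T,
    DifferentiableAt ℝ (fun y => pdx u y t) x ∧ DifferentiableAt ℝ (fun y => pdx θ y t) x ∧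
    DifferentiableAt ℝ (fun y => pdx w y t) x ∧ DifferentiableAt ℝ (fun y => pdx b y t) x
  diff_t : ∀ x : ℝ, ∀ t ∈ Icc (0:ℝ) T,
    DifferentiableWithinAt ℝ (fun s => v x s) (Icc 0 T) t ∧
    DifferentiableWithinAt ℝ (fun s => u x s) (Icc 0 T) t ∧
    DifferentiableWithinAt ℝ (fun s => θ x s) (Icc 0 T) t ∧
    DifferentiableWithinAt ℝ (fun s => w x s) (Icc 0 T) t ∧
    DifferentiableWithinAt ℝ (fun s => b x s) (Icc 0 T) t
  cont : ContinuousOn (fun p : ℝ × ℝ =>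
      (v p.1 p.2, u p.1 p.2, θ p.1 p.2, w p.1 p.2, b p.1 p.2)) (univ ×ˢ Icc 0 T)
  cont_dx : ContinuousOn (fun p : ℝ × ℝ =>
      (pdx v p.1 p.2, pdx u p.1 p.2, pdx θ p.1 p.2, pdx w p.1 p.2, pdx b p.1 p.2))
      (univ ×ˢ Icc 0 T)
  cont_dxx : ContinuousOn (fun p : ℝ × ℝ =>
      (pdx (pdx u) p.1 p.2, pdx (pdx θ) p.1 p.2, pdx (pdx w) p.1 p.2, pdx (pdx b) p.1 p.2))
      (univ ×ˢ Icc 0 T)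
  cont_dt : ContinuousOn (fun p : ℝ × ℝ =>
      (pdt T v p.1 p.2, pdt T u p.1 p.2, pdt T θ p.1 p.2, pdt T w p.1 p.2, pdt T b p.1 p.2))
      (univ ×ˢ Icc 0 T)
  eq_mass : ∀ x : ℝ, ∀ t ∈ Icc (0:ℝ) T, pdt T v x t = pdx u x t
  eq_mom : ∀ x : ℝ, ∀ t ∈ Icc (0:ℝ) T,
    pdt T u x t + pdx (fun y s => θ y s / v y s + sq2 (b y s) / 2) x t
      = pdx (fun y s => visc α (v y s) * pdx u y s / v y s) x t
  eq_w : ∀ x : ℝ, ∀ t ∈ Icc (0:ℝ) T,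
    pdt T w x t - pdx b x t = pdx (fun y s => (v y s)⁻¹ • pdx w y s) x t
  eq_b : ∀ x : ℝ, ∀ t ∈ Icc (0:ℝ) T,
    pdt T (fun y s => v y s • b y s) x t - pdx w x t
      = pdx (fun y s => (v y s)⁻¹ • pdx b y s) x t
  eq_temp : ∀ x : ℝ, ∀ t ∈ Icc (0:ℝ) T,
    pdt T θ x t + θ x t / v x t * pdx u x t
      = pdx (fun y s => θ y s ^ β * pdx θ y s / v y s) x t
        + (visc α (v x t) * pdx u x t ^ 2 + sq2 (pdx w x t) + sq2 (pdx b x t)) / v x t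
  farfield : ∀ ε > (0:ℝ), ∃ M : ℝ, ∀ x : ℝ, ∀ t ∈ Icc (0:ℝ) T, M ≤ |x| →
    |v x t - 1| < ε ∧ |u x t| < ε ∧ |θ x t - 1| < ε ∧
    Real.sqrt (sq2 (b x t)) < ε ∧ Real.sqrt (sq2 (w x t)) < ε
  sq_int : ∀ t ∈ Icc (0:ℝ) T,
    Integrable (fun x => (v x t - 1) ^ 2) ∧ Integrable (fun x => (u x t) ^ 2) ∧
    Integrable (fun x => (θ x t - 1) ^ 2) ∧ Integrable (fun x => sq2 (b x t)) ∧
    Integrable (fun x => sq2 (w x t)) ∧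
    Integrable (fun x => (pdx v x t) ^ 2) ∧ Integrable (fun x => (pdx u x t) ^ 2) ∧
    Integrable (fun x => (pdx θ x t) ^ 2) ∧ Integrable (fun x => sq2 (pdx b x t)) ∧
    Integrable (fun x => sq2 (pdx w x t))

/-- The initial data of a solution are `(K, δ)`-admissible: the `H¹`-type norm of
`(v₀−1, u₀, θ₀−1, b₀, w₀)` is at most `K²` and `v₀ ≥ δ`, `θ₀ ≥ δ`. -/
def Admissible (K δ : ℝ) (v u θ : ℝ → ℝ → ℝ) (w b : ℝ → ℝ → ℝ × ℝ) : Prop :=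
  (∫ x : ℝ, ((v x 0 - 1) ^ 2 + (u x 0) ^ 2 + (θ x 0 - 1) ^ 2 + sq2 (b x 0) + sq2 (w x 0)
      + (pdx v x 0) ^ 2 + (pdx u x 0) ^ 2 + (pdx θ x 0) ^ 2
      + sq2 (pdx b x 0) + sq2 (pdx w x 0))) ≤ K ^ 2 ∧
  (∀ x : ℝ, δ ≤ v x 0) ∧ (∀ x : ℝ, δ ≤ θ x 0)

namespace MHD

theorem cont_int {X : Type*} [TopologicalSpace X] [FirstCountableTopology X] {f : ℝ → X → ℝ} {a b : ℝ}
    (hf : Continuous fun p : ℝ × X => f p.1 p.2) :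
    Continuous fun t => ∫ x in a..b, f x t := by
  apply intervalIntegral.continuous_parametric_intervalIntegral_of_continuous'
    (f := fun t x => f x t)
  exact hf.comp continuous_swap

theorem int_swap {f : ℝ → ℝ → ℝ} (hf : Continuous fun p : ℝ × ℝ => f p.1 p.2) (a b c d : ℝ) :
    ∫ x in a..b, ∫ t in c..d, f x t = ∫ t in c..d, ∫ x in a..b, f x t := by
  apply intervalIntegral_intervalIntegral_swap
  have h : IntegrableOn (Function.uncurry f) (uIcc a b ×ˢ uIcc c d) (volume.prod volume) := by
    apply ContinuousOn.integrableOn_compact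
    · exact isCompact_uIcc.prod isCompact_uIcc
    · exact hf.continuousOn
  have h2 := h.mono_set (prod_mono (uIoc_subset_uIcc (a := a) (b := b))
    (uIoc_subset_uIcc (a := c) (b := d)))
  exact h2

theorem int_add {f g : ℝ → ℝ} (hf : Continuous f) (hg : Continuous g) {a b : ℝ} :
    ∫ x in a..b, (f x + g x) = (∫ x in a..b, f x) + ∫ x in a..b, g x :=
  intervalIntegral.integral_add (hf.intervalIntegrable _ _) (hg.intervalIntegrable _ _)

theorem int_sub {f g : ℝ → ℝ} (hf : Continuous f) (hg : Continuous g) {a b : ℝ} :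
    ∫ x in a..b, (f x - g x) = (∫ x in a..b, f x) - ∫ x in a..b, g x :=
  intervalIntegral.integral_sub (hf.intervalIntegrable _ _) (hg.intervalIntegrable _ _)

theorem slice_right {f : ℝ → ℝ → ℝ} (hf : Continuous fun p : ℝ × ℝ => f p.1 p.2) (x : ℝ) :
    Continuous fun t => f x t := hf.comp (by fun_prop : Continuous fun t : ℝ => (x, t))

theorem slice_left {f : ℝ → ℝ → ℝ} (hf : Continuous fun p : ℝ × ℝ => f p.1 p.2) (t : ℝ) :
    Continuous fun x => f x t := hf.comp (by fun_prop : Continuous fun x : ℝ => (x, t))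

theorem time_ftc_pt {T : ℝ} {f ft : ℝ → ℝ} (hf : Continuous f) (hft : Continuous ft)
    (hd : ∀ t ∈ Ioo 0 T, HasDerivAt f (ft t) t) {s t : ℝ} (hs : 0 ≤ s) (hst : s ≤ t) (ht : t ≤ T) :
    ∫ r in s..t, ft r = f t - f s :=
  intervalIntegral.integral_eq_sub_of_hasDerivAt_of_le hst hf.continuousOn
    (fun x hx => hd x ⟨hs.trans_lt hx.1, hx.2.trans_le ht⟩) (hft.intervalIntegrable _ _)

theorem time_ftc {T : ℝ} {f ft : ℝ → ℝ → ℝ} (hf : Continuous fun p : ℝ × ℝ => f p.1 p.2)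
    (hft : Continuous fun p : ℝ × ℝ => ft p.1 p.2)
    (hd : ∀ x, ∀ t ∈ Ioo 0 T, HasDerivAt (f x) (ft x t) t) (a b : ℝ) {t : ℝ} (ht : t ∈ Icc 0 T) :
    ∫ x in a..b, f x t = (∫ x in a..b, f x 0) + ∫ s in (0 : ℝ)..t, ∫ x in a..b, ft x s := by
  rw [← int_swap hft]
  have h : ∀ x, ∫ s in (0 : ℝ)..t, ft x s = f x t - f x 0 := fun x =>
    time_ftc_pt (slice_right hf x) (slice_right hft x) (hd x) le_rfl ht.1 ht.2
  simp only [h]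
  rw [intervalIntegral.integral_sub ((slice_left hf t).intervalIntegrable _ _)
    ((slice_left hf 0).intervalIntegrable _ _)]
  ring

/-- Integration by parts against a weight vanishing at the endpoints. -/
theorem ibp_zero {R : ℝ} {a ax F Fx : ℝ → ℝ} (ha : ∀ x, HasDerivAt a (ax x) x)
    (hF : ∀ x, HasDerivAt F (Fx x) x) (hax : Continuous ax) (hFx : Continuous Fx)
    (h1 : a R = 0) (h2 : a (-R) = 0) :
    ∫ x in (-R)..R, a x * Fx x = ∫ x in (-R)..R, -(ax x * F x) := by
  have := intervalIntegral.integral_mul_deriv_eq_deriv_mul (a := -R) (b := R)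
    (fun x _ => ha x) (fun x _ => hF x) (hax.intervalIntegrable _ _) (hFx.intervalIntegrable _ _)
  rw [this, h1, h2, intervalIntegral.integral_neg]
  ring

theorem ftc_diag {T : ℝ} {J : ℝ → ℝ} (hJ : Continuous J) {k : ℝ → ℝ → ℝ → ℝ}
    (hk : Continuous fun q : ℝ × ℝ × ℝ => k q.1 q.2.1 q.2.2)
    (h : ∀ s t, 0 ≤ s → s ≤ t → t ≤ T → J t - J s = ∫ σ in s..t, k t s σ) {t : ℝ}
    (ht : t ∈ Icc 0 T) : J t = J 0 + ∫ σ in (0 : ℝ)..t, k σ σ σ := by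
  have hkd : Continuous fun s => k s s s := hk.comp (by fun_prop : Continuous fun s : ℝ => (s, s, s))
  have := intervalIntegral.integral_eq_sub_of_hasDeriv_right_of_le (f := J) (f' := fun s => k s s s)
    ht.1 hJ.continuousOn ?_ (hkd.intervalIntegrable _ _)
  · rw [this]; ring
  intro s hs
  rw [hasDerivWithinAt_iff_isLittleO, Asymptotics.isLittleO_iff]
  intro c hc
  have hcont := Metric.continuous_iff.1 hk (s, s, s) c hc
  obtain ⟨δ, hδ, hδ'⟩ := hcont
  have h1 : Ioo s (min (s + δ) T) ∈ nhdsWithin s (Ioi s) :=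
    Ioo_mem_nhdsGT (lt_min (by linarith) (hs.2.trans_le ht.2))
  filter_upwards [h1] with r hr
  have hr2 := lt_min_iff.1 hr.2
  rw [h s r hs.1.le hr.1.le hr2.2.le]
  have e : (∫ σ in s..r, k r s σ) - (r - s) • k s s s = ∫ σ in s..r, (k r s σ - k s s s) := by
    rw [intervalIntegral.integral_sub]
    · simp
    · exact (hk.comp (by fun_prop : Continuous fun σ : ℝ => (r, s, σ))).intervalIntegrable _ _
    · simp
  rw [e]
  have := intervalIntegral.norm_integral_le_of_norm_le_const (a := s) (b := r) (C := c)
    (f := fun σ => k r s σ - k s s s) ?_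
  · rwa [Real.norm_eq_abs (r - s)]
  intro σ hσ
  rw [uIoc_of_le hr.1.le] at hσ
  have := hδ' (r, s, σ) (by
    simp only [Prod.dist_eq, Real.dist_eq, sub_self, abs_zero]
    have a1 : |r - s| < δ := by rw [abs_of_pos (by linarith [hr.1])]; linarith
    have a2 : |σ - s| < δ := by rw [abs_of_pos (by linarith [hσ.1])]; linarith [hσ.2]
    simp [a1, a2])
  exact this.le

/-- Weighted `L²` energy identity for the space derivative of a `C^{2,1}` function. -/
theorem energy_second {T R : ℝ} {f fx fxx ft a ax at' : ℝ → ℝ → ℝ}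
    (cf : Continuous fun p : ℝ × ℝ => f p.1 p.2) (cfx : Continuous fun p : ℝ × ℝ => fx p.1 p.2)
    (cfxx : Continuous fun p : ℝ × ℝ => fxx p.1 p.2) (cft : Continuous fun p : ℝ × ℝ => ft p.1 p.2)
    (ca : Continuous fun p : ℝ × ℝ => a p.1 p.2) (cax : Continuous fun p : ℝ × ℝ => ax p.1 p.2)
    (cat : Continuous fun p : ℝ × ℝ => at' p.1 p.2)
    (dx : ∀ x t, HasDerivAt (fun y => f y t) (fx x t) x)
    (dxx : ∀ x t, HasDerivAt (fun y => fx y t) (fxx x t) x)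
    (dt : ∀ x, ∀ t ∈ Ioo 0 T, HasDerivAt (f x) (ft x t) t)
    (dax : ∀ x t, HasDerivAt (fun y => a y t) (ax x t) x)
    (dat : ∀ x, ∀ t ∈ Ioo 0 T, HasDerivAt (a x) (at' x t) t)
    (a1 : ∀ t, a R t = 0) (a2 : ∀ t, a (-R) t = 0) {t : ℝ} (ht : t ∈ Icc 0 T) :
    ∫ x in (-R)..R, a x t * fx x t ^ 2 = (∫ x in (-R)..R, a x 0 * fx x 0 ^ 2) +
      ∫ s in (0 : ℝ)..t, ∫ x in (-R)..R,
        (at' x s * fx x s ^ 2 - 2 * (ax x s * fx x s + a x s * fxx x s) * ft x s) := by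
  have cc : ∀ {f : ℝ → ℝ → ℝ}, Continuous (fun p : ℝ × ℝ => f p.1 p.2) →
      ∀ {X : Type} [TopologicalSpace X] {g h : X → ℝ}, Continuous g → Continuous h →
      Continuous fun x => f (g x) (h x) := fun hf _ _ _ _ hg hh => hf.comp (hg.prodMk hh)
  set F : ℝ → ℝ × ℝ × ℝ → ℝ := fun x q =>
    at' x q.2.2 * fx x q.1 * fx x q.2.1 - (ax x q.1 * fx x q.1 + a x q.1 * fxx x q.1) * ft x q.2.2
      - (ax x q.2.1 * fx x q.2.1 + a x q.2.1 * fxx x q.2.1) * ft x q.2.2 with hF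
  have cF : Continuous fun p : ℝ × (ℝ × ℝ × ℝ) => F p.1 p.2 := by
    simp only [hF]
    have := @cc
    refine Continuous.sub (Continuous.sub ?_ ?_) ?_ <;>
    repeat (first | apply Continuous.mul | apply Continuous.add | apply cc cat | apply cc cfx | apply cc cax | apply cc ca | apply cc cfxx | apply cc cft | fun_prop)
  have cJ : Continuous fun t => ∫ x in (-R)..R, a x t * fx x t ^ 2 :=
    cont_int (ca.mul (cfx.pow 2))
  have key := ftc_diag (T := T) (J := fun t => ∫ x in (-R)..R, a x t * fx x t ^ 2) cJ
    (k := fun t s σ => ∫ x in (-R)..R, F x (t, s, σ)) (cont_int cF) ?_ ht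
  · rw [key]
    congr 1
    apply intervalIntegral.integral_congr
    intro s _
    apply intervalIntegral.integral_congr
    intro x _
    simp only [hF]; ring
  intro s t hs hst htT
  have cF2 : Continuous fun p : ℝ × ℝ => F p.1 (t, s, p.2) :=
    cF.comp (by fun_prop : Continuous fun p : ℝ × ℝ => (p.1, (t, s, p.2)))
  have sw := int_swap (f := fun x σ => F x (t, s, σ)) cF2 (-R) R s t
  refine Eq.trans ?_ sw
  have inner : ∀ x, ∫ σ in s..t, F x (t, s, σ) = (a x t - a x s) * (fx x t * fx x s)
      - (ax x t * fx x t + a x t * fxx x t) * (f x t - f x s)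
      - (ax x s * fx x s + a x s * fxx x s) * (f x t - f x s) := by
    intro x
    simp only [hF]
    have e1 := time_ftc_pt (slice_right ca x) (slice_right cat x) (dat x) hs hst htT
    have e2 := time_ftc_pt (slice_right cf x) (slice_right cft x) (dt x) hs hst htT
    have i1 : IntervalIntegrable (fun σ => at' x σ) volume s t := (slice_right cat x).intervalIntegrable _ _
    have i2 : IntervalIntegrable (fun σ => ft x σ) volume s t := (slice_right cft x).intervalIntegrable _ _
    rw [intervalIntegral.integral_sub, intervalIntegral.integral_sub]
    · simp only [mul_assoc, intervalIntegral.integral_mul_const, intervalIntegral.integral_const_mul, e1, e2]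
    · exact (i1.mul_const _).mul_const _
    · exact i2.const_mul _
    · exact ((i1.mul_const _).mul_const _).sub (i2.const_mul _)
    · exact i2.const_mul _
  simp only [inner]
  have ib : ∀ τ, ∫ x in (-R)..R, (a x τ * fx x τ) * (fx x t - fx x s)
      = ∫ x in (-R)..R, -((ax x τ * fx x τ + a x τ * fxx x τ) * (f x t - f x s)) := by
    intro τ
    refine ibp_zero (a := fun x => a x τ * fx x τ) (F := fun x => f x t - f x s)
      (fun x => (dax x τ).mul (dxx x τ)) (fun x => (dx x t).sub (dx x s)) ?_ ?_ ?_ ?_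
    · exact ((slice_left cax τ).mul (slice_left cfx τ)).add ((slice_left ca τ).mul (slice_left cfxx τ))
    · exact (slice_left cfx t).sub (slice_left cfx s)
    · simp [a1]
    · simp [a2]
  have hc : ∀ {f : ℝ → ℝ → ℝ}, Continuous (fun p : ℝ × ℝ => f p.1 p.2) → ∀ τ, Continuous fun x => f x τ :=
    fun hf τ => slice_left hf τ
  have cA : ∀ τ, Continuous fun x => (a x τ * fx x τ) * (fx x t - fx x s) := fun τ =>
    ((hc ca τ).mul (hc cfx τ)).mul ((hc cfx t).sub (hc cfx s))
  have cB : ∀ τ, Continuous fun x => -((ax x τ * fx x τ + a x τ * fxx x τ) * (f x t - f x s)) := fun τ =>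
    ((((hc cax τ).mul (hc cfx τ)).add ((hc ca τ).mul (hc cfxx τ))).mul ((hc cf t).sub (hc cf s))).neg
  have cC : Continuous fun x => (a x t - a x s) * (fx x t * fx x s) :=
    ((hc ca t).sub (hc ca s)).mul ((hc cfx t).mul (hc cfx s))
  calc (∫ x in (-R)..R, a x t * fx x t ^ 2) - ∫ x in (-R)..R, a x s * fx x s ^ 2
      = ∫ x in (-R)..R, ((a x t - a x s) * (fx x t * fx x s) + (a x t * fx x t) * (fx x t - fx x s)
          + (a x s * fx x s) * (fx x t - fx x s)) := by
        rw [← int_sub]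
        · congr 1; ext x; ring
        · exact (hc ca t).mul ((hc cfx t).pow 2)
        · exact (hc ca s).mul ((hc cfx s).pow 2)
    _ = (∫ x in (-R)..R, (a x t - a x s) * (fx x t * fx x s)) + (∫ x in (-R)..R, (a x t * fx x t) * (fx x t - fx x s))
          + ∫ x in (-R)..R, (a x s * fx x s) * (fx x t - fx x s) := by
        rw [int_add _ (cA s), int_add cC (cA t)]
        exact cC.add (cA t)
    _ = _ := by
        rw [ib t, ib s, ← int_add cC (cB t), ← int_add (cC.fun_add (cB t)) (cB s)]
        congr 1

/-- Integral form of Grönwall's inequality, bounding the right-hand side. -/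
theorem gronwall {T c : ℝ} {y a : ℝ → ℝ} (cy : Continuous y) (ca : Continuous a)
    (ha : ∀ t, 0 ≤ a t) (h : ∀ t ∈ Icc 0 T, y t ≤ c + ∫ s in (0 : ℝ)..t, a s * y s) {t : ℝ}
    (ht : t ∈ Icc 0 T) :
    c + ∫ s in (0 : ℝ)..t, a s * y s ≤ c * Real.exp (∫ s in (0 : ℝ)..t, a s) := by
  set W : ℝ → ℝ := fun t => c + ∫ s in (0 : ℝ)..t, a s * y s with hW
  set A : ℝ → ℝ := fun t => ∫ s in (0 : ℝ)..t, a s with hA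
  have cay : Continuous fun t => a t * y t := ca.mul cy
  have dW : ∀ t, HasDerivAt W (a t * y t) t := fun t =>
    (cay.integral_hasStrictDerivAt 0 t).hasDerivAt.const_add c
  have dA : ∀ t, HasDerivAt A (a t) t := fun t =>
    (ca.integral_hasStrictDerivAt 0 t).hasDerivAt
  have dP : ∀ t, HasDerivAt (fun t => W t * Real.exp (-A t))
      (a t * y t * Real.exp (-A t) + W t * (Real.exp (-A t) * (-a t))) t := fun t =>
    (dW t).mul ((dA t).neg.exp)
  have anti : AntitoneOn (fun t => W t * Real.exp (-A t)) (Icc 0 T) := by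
    apply antitoneOn_of_deriv_nonpos (convex_Icc 0 T)
    · exact fun t _ => (dP t).continuousAt.continuousWithinAt
    · exact fun t _ => (dP t).differentiableAt.differentiableWithinAt
    · intro t ht
      rw [interior_Icc] at ht
      rw [(dP t).deriv]
      have h1 := h t ⟨ht.1.le, ht.2.le⟩
      have h2 : a t * y t ≤ a t * W t := mul_le_mul_of_nonneg_left h1 (ha t)
      nlinarith [Real.exp_pos (-A t)]
  have := anti ⟨le_rfl, ht.1.trans ht.2⟩ ht ht.1
  simp only [hW, hA, intervalIntegral.integral_same, neg_zero, Real.exp_zero, add_zero, mul_one] at this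
  rw [Real.exp_neg] at this
  have hp := Real.exp_pos (∫ s in (0 : ℝ)..t, a s)
  calc _ = ((c + ∫ s in (0 : ℝ)..t, a s * y s) * (Real.exp (∫ s in (0 : ℝ)..t, a s))⁻¹) *
        Real.exp (∫ s in (0 : ℝ)..t, a s) := by field_simp
    _ ≤ _ := mul_le_mul_of_nonneg_right this hp.le

theorem int_mono {f g : ℝ → ℝ} (cf : Continuous f) (cg : Continuous g) {a b : ℝ} (hab : a ≤ b)
    (h : ∀ x ∈ Icc a b, f x ≤ g x) : ∫ x in a..b, f x ≤ ∫ x in a..b, g x :=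
  intervalIntegral.integral_mono_on hab (cf.intervalIntegrable _ _) (cg.intervalIntegrable _ _) h

theorem int_nonneg {f : ℝ → ℝ} {a b : ℝ} (hab : a ≤ b)
    (h : ∀ x, 0 ≤ f x) : 0 ≤ ∫ x in a..b, f x :=
  intervalIntegral.integral_nonneg hab fun x _ => h x

theorem int_subset {f : ℝ → ℝ} (cf : Continuous f) (hf : ∀ x, 0 ≤ f x) {a b c d : ℝ} (h1 : c ≤ a)
    (h2 : a ≤ b) (h3 : b ≤ d) : ∫ x in a..b, f x ≤ ∫ x in c..d, f x :=
  intervalIntegral.integral_mono_interval h1 h2 h3 (Eventually.of_forall hf)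
    (cf.intervalIntegrable _ _)

theorem int_le_sum {n : ℕ} {f : ℝ → ℝ} (cf : Continuous f) {g : Fin n → ℝ → ℝ}
    (cg : ∀ i, Continuous (g i)) (c : Fin n → ℝ) {a b : ℝ} (hab : a ≤ b)
    (h : ∀ x ∈ Icc a b, f x ≤ ∑ i, c i * g i x) :
    ∫ x in a..b, f x ≤ ∑ i, c i * ∫ x in a..b, g i x := by
  have cs : ∀ i, Continuous fun x => c i * g i x := fun i => continuous_const.mul (cg i)
  refine (int_mono cf (g := fun x => ∑ i, c i * g i x) (by fun_prop) hab h).trans ?_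
  rw [intervalIntegral.integral_finsetSum fun i _ => (cs i).intervalIntegrable _ _]
  simp only [intervalIntegral.integral_const_mul, le_refl]

theorem int_le_one {f g₁ : ℝ → ℝ} (cf : Continuous f) (h₁ : Continuous g₁) {c₁ a b : ℝ}
    (hab : a ≤ b) (h : ∀ x ∈ Icc a b, f x ≤ c₁ * g₁ x) :
    ∫ x in a..b, f x ≤ c₁ * ∫ x in a..b, g₁ x := by
  refine (int_mono cf (h₁.const_mul c₁) hab h).trans ?_
  rw [intervalIntegral.integral_const_mul]

theorem int_le_two {f g₁ g₂ : ℝ → ℝ} (cf : Continuous f) (h₁ : Continuous g₁) (h₂ : Continuous g₂)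
    {c₁ c₂ a b : ℝ} (hab : a ≤ b) (h : ∀ x ∈ Icc a b, f x ≤ c₁ * g₁ x + c₂ * g₂ x) :
    ∫ x in a..b, f x ≤ c₁ * (∫ x in a..b, g₁ x) + c₂ * ∫ x in a..b, g₂ x := by
  simpa [Fin.sum_univ_succ] using int_le_sum cf (g := ![g₁, g₂])
    (by simp [Fin.forall_fin_succ, *]) ![c₁, c₂] hab (by simpa [Fin.sum_univ_succ] using h)

theorem int_le_three {f g₁ g₂ g₃ : ℝ → ℝ} (cf : Continuous f) (h₁ : Continuous g₁)
    (h₂ : Continuous g₂) (h₃ : Continuous g₃) {c₁ c₂ c₃ a b : ℝ} (hab : a ≤ b)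
    (h : ∀ x ∈ Icc a b, f x ≤ c₁ * g₁ x + c₂ * g₂ x + c₃ * g₃ x) :
    ∫ x in a..b, f x ≤
      c₁ * (∫ x in a..b, g₁ x) + c₂ * (∫ x in a..b, g₂ x) + c₃ * ∫ x in a..b, g₃ x := by
  simpa [Fin.sum_univ_succ, add_assoc] using int_le_sum cf (g := ![g₁, g₂, g₃])
    (by simp [Fin.forall_fin_succ, *]) ![c₁, c₂, c₃] hab
    (by simpa [Fin.sum_univ_succ, add_assoc] using h)

theorem int_le_four {f g₁ g₂ g₃ g₄ : ℝ → ℝ} (cf : Continuous f) (h₁ : Continuous g₁)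
    (h₂ : Continuous g₂) (h₃ : Continuous g₃) (h₄ : Continuous g₄) {c₁ c₂ c₃ c₄ a b : ℝ}
    (hab : a ≤ b)
    (h : ∀ x ∈ Icc a b, f x ≤ c₁ * g₁ x + c₂ * g₂ x + c₃ * g₃ x + c₄ * g₄ x) :
    ∫ x in a..b, f x ≤ c₁ * (∫ x in a..b, g₁ x) + c₂ * (∫ x in a..b, g₂ x)
      + c₃ * (∫ x in a..b, g₃ x) + c₄ * ∫ x in a..b, g₄ x := by
  simpa [Fin.sum_univ_succ, add_assoc] using int_le_sum cf (g := ![g₁, g₂, g₃, g₄])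
    (by simp [Fin.forall_fin_succ, *]) ![c₁, c₂, c₃, c₄] hab
    (by simpa [Fin.sum_univ_succ, add_assoc] using h)

theorem int_cauchy_schwarz {f g : ℝ → ℝ} (cf : Continuous f) (cg : Continuous g) {a b : ℝ}
    (hab : a ≤ b) : (∫ x in a..b, f x * g x) ^ 2 ≤ (∫ x in a..b, f x ^ 2) * ∫ x in a..b, g x ^ 2 := by
  have h : ∀ z : ℝ, 0 ≤ (∫ x in a..b, f x ^ 2) * (z * z) + (-2 * ∫ x in a..b, f x * g x) * z
      + ∫ x in a..b, g x ^ 2 := by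
    intro z
    have e : ∫ x in a..b, (z * f x - g x) ^ 2 = (∫ x in a..b, f x ^ 2) * (z * z)
        + (-2 * ∫ x in a..b, f x * g x) * z + ∫ x in a..b, g x ^ 2 := by
      have : ∀ x, (z * f x - g x) ^ 2 = (z * z) * (f x ^ 2) + (-2 * z) * (f x * g x) + g x ^ 2 := by
        intro x; ring
      simp only [this]
      rw [intervalIntegral.integral_add, intervalIntegral.integral_add]
      · simp only [intervalIntegral.integral_const_mul]; ring
      all_goals apply Continuous.intervalIntegrable; fun_prop
    rw [← e]
    exact int_nonneg hab fun x => sq_nonneg _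
  have := discrim_le_zero h
  rw [discrim] at this
  nlinarith

theorem exists_le_int {f : ℝ → ℝ} (cf : Continuous f) (x : ℝ) :
    ∃ a ∈ Icc x (x + 1), f a ≤ ∫ y in x..x + 1, f y := by
  by_contra! hcon
  obtain ⟨a, ha, hm⟩ := isCompact_Icc.exists_isMinOn (nonempty_Icc.2 (by linarith : x ≤ x + 1))
    cf.continuousOn
  have h1 : ∫ y in x..x + 1, f a ≤ ∫ y in x..x + 1, f y :=
    int_mono continuous_const cf (by linarith) fun y hy => hm hy
  simp at h1
  linarith [hcon a ha]

/-- One-dimensional Sobolev inequality on a unit interval. -/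
theorem sup_unit {f fx : ℝ → ℝ} (cf : Continuous f) (cfx : Continuous fx)
    (hd : ∀ x, HasDerivAt f (fx x) x) {x y z : ℝ} (hy : y ∈ Icc x (x + 1)) (hz : z = x + 1) :
    f y ^ 2 ≤ 2 * (∫ y in x..z, f y ^ 2) + ∫ y in x..z, fx y ^ 2 := by
  subst hz
  obtain ⟨a, ha, h⟩ := exists_le_int (f := fun y => f y ^ 2) (by fun_prop) x
  have hh : ∀ x, HasDerivAt (fun x => f x ^ 2) (2 * f x * fx x) x := fun x => by
    simpa using (hd x).fun_pow 2
  have e := intervalIntegral.integral_eq_sub_of_hasDerivAt (fun x _ => hh x)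
    ((by fun_prop : Continuous fun x => 2 * f x * fx x).intervalIntegrable a y)
  have b1 : |∫ x in a..y, 2 * f x * fx x| ≤ ∫ t in x..x + 1, (f t ^ 2 + fx t ^ 2) := by
    have hp : ∀ t, |2 * f t * fx t| ≤ f t ^ 2 + fx t ^ 2 := fun t => by
      rw [abs_le]; constructor <;> nlinarith [sq_nonneg (f t + fx t), sq_nonneg (f t - fx t)]
    have cc : Continuous fun t => f t ^ 2 + fx t ^ 2 := by fun_prop
    have c2 : Continuous fun t => |2 * f t * fx t| := by fun_prop
    rcases le_total a y with hay | hay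
    · exact (intervalIntegral.abs_integral_le_integral_abs hay).trans
        ((int_mono c2 cc hay fun t _ => hp t).trans (int_subset cc (fun t => by positivity) ha.1 hay hy.2))
    · rw [intervalIntegral.integral_symm, abs_neg]
      exact (intervalIntegral.abs_integral_le_integral_abs hay).trans
        ((int_mono c2 cc hay fun t _ => hp t).trans (int_subset cc (fun t => by positivity) hy.1 hay ha.2))
  rw [int_add (by fun_prop) (by fun_prop)] at b1
  have := abs_le.1 b1
  linarith [this.2]

/-- The cut-off weight on `[-R, R]`. -/
def ph (R x : ℝ) : ℝ := 1 - (x / R) ^ 2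

/-- Derivative of the cut-off weight. -/
def dph (R x : ℝ) : ℝ := -(2 * x / R ^ 2)

@[fun_prop] theorem ph_cont {X : Type*} [TopologicalSpace X] {g : X → ℝ} (R : ℝ) (hg : Continuous g) :
    Continuous fun x => ph R (g x) := by unfold ph; fun_prop

@[fun_prop] theorem dph_cont {X : Type*} [TopologicalSpace X] {g : X → ℝ} (R : ℝ) (hg : Continuous g) :
    Continuous fun x => dph R (g x) := by unfold dph; fun_prop

theorem ph_deriv (R x : ℝ) : HasDerivAt (ph R) (dph R x) x := by
  have := (((hasDerivAt_id x).div_const R).fun_pow 2).const_sub 1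
  refine this.congr_deriv ?_
  simp [dph]; ring

theorem ph_sq_deriv (R x : ℝ) : HasDerivAt (fun x => ph R x ^ 2) (2 * ph R x * dph R x) x := by
  simpa using (ph_deriv R x).fun_pow 2

theorem ph_mem {R x : ℝ} (hR : 0 < R) (hx : x ∈ Icc (-R) R) : 0 ≤ ph R x ∧ ph R x ≤ 1 := by
  unfold ph
  have h : |x / R| ≤ 1 := by
    rw [abs_div, abs_of_pos hR, div_le_one hR]; exact abs_le.2 ⟨hx.1, hx.2⟩
  have := sq_le_one_iff_abs_le_one (x / R) |>.2 h
  constructor <;> nlinarith [sq_nonneg (x / R)]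

theorem dph_abs {R x : ℝ} (hR : 0 < R) (hx : x ∈ Icc (-R) R) : |dph R x| ≤ 2 / R := by
  unfold dph
  rw [abs_neg, abs_div, abs_mul, abs_of_pos (by positivity : 0 < R ^ 2), div_le_div_iff₀ (by positivity) hR]
  have : |x| ≤ R := abs_le.2 ⟨hx.1, hx.2⟩
  rw [abs_two]
  nlinarith [mul_le_mul_of_nonneg_right this hR.le]

theorem ph_half {R x : ℝ} (hR : 0 < R) (hx : 2 * |x| ≤ R) : 9 / 16 ≤ ph R x ^ 2 := by
  have h : |x / R| ≤ 1 / 2 := by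
    rw [abs_div, abs_of_pos hR, div_le_iff₀ hR]; linarith
  have h2 : (x / R) ^ 2 ≤ 1 / 4 := by
    rw [← sq_abs]; nlinarith [abs_nonneg (x / R)]
  unfold ph
  nlinarith

theorem int_le_weight {f : ℝ → ℝ} (cf : Continuous f) (hf : ∀ x, 0 ≤ f x) {L R : ℝ} (hL : 0 < L)
    (hR : 2 * L ≤ R) : ∫ x in (-L)..L, f x ≤ 2 * ∫ x in (-R)..R, ph R x ^ 2 * f x := by
  have c : Continuous fun x => ph R x ^ 2 * f x := by fun_prop
  refine (int_le_one cf c (c₁ := 2) (by linarith) fun x hx => ?_).trans ?_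
  · have : |x| ≤ L := abs_le.2 ⟨hx.1, hx.2⟩
    have := ph_half (R := R) (x := x) (by linarith) (by linarith)
    nlinarith [hf x]
  · have := int_subset c (fun x => mul_nonneg (sq_nonneg _) (hf x)) (a := -L) (b := L) (c := -R)
      (d := R) (by linarith) (by linarith) (by linarith)
    linarith

theorem sup_weight {f fx : ℝ → ℝ} (cf : Continuous f) (cfx : Continuous fx)
    (hd : ∀ x, HasDerivAt f (fx x) x) {R ε : ℝ} (hR : 1 ≤ R) (hε : 0 < ε) {x : ℝ}
    (hx : x ∈ Icc (-R) R) :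
    ph R x ^ 2 * f x ^ 2 ≤ ε * (∫ y in (-R)..R, ph R y ^ 2 * fx y ^ 2)
      + (1 / ε + 4) * ∫ y in (-R)..R, f y ^ 2 := by
  have hh : ∀ x, HasDerivAt (fun x => (ph R x * f x) ^ 2)
      (2 * (ph R x * f x) * (dph R x * f x + ph R x * fx x)) x := fun x => by
    simpa using ((ph_deriv R x).fun_mul (hd x)).fun_pow 2
  have cc : Continuous fun x => 2 * (ph R x * f x) * (dph R x * f x + ph R x * fx x) := by fun_prop
  have e := intervalIntegral.integral_eq_sub_of_hasDerivAt (fun x _ => hh x)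
    (cc.intervalIntegrable (-R) x)
  have h0 : ph R (-R) = 0 := by
    unfold ph; rw [neg_div, div_self (by linarith)]; norm_num
  simp only [h0, zero_mul, ne_eq, OfNat.ofNat_ne_zero, not_false_eq_true, zero_pow, sub_zero] at e
  rw [← mul_pow, ← e]
  have c3 : Continuous fun y => ε * (ph R y ^ 2 * fx y ^ 2) + (1 / ε + 4) * f y ^ 2 := by fun_prop
  have m1 : ∫ y in (-R)..x, 2 * (ph R y * f y) * (dph R y * f y + ph R y * fx y)
      ≤ ∫ y in (-R)..x, (ε * (ph R y ^ 2 * fx y ^ 2) + (1 / ε + 4) * f y ^ 2) := by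
    refine int_mono cc c3 hx.1 fun y hy => ?_
    have hy' : y ∈ Icc (-R) R := ⟨hy.1, hy.2.trans hx.2⟩
    obtain ⟨p0, p1⟩ := ph_mem (by linarith) hy'
    have d1 : |dph R y| ≤ 2 := (dph_abs (by linarith) hy').trans (by
      rw [div_le_iff₀ (by linarith)]; linarith)
    have d2 : ph R y * dph R y ≤ 2 := by
      have := le_abs_self (dph R y)
      nlinarith [abs_nonneg (dph R y)]
    have k1 : 2 * (ph R y * f y) * (dph R y * f y) ≤ 4 * f y ^ 2 := by
      nlinarith [sq_nonneg (f y)]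
    have k2 : 2 * (ph R y * f y) * (ph R y * fx y) ≤ ε * (ph R y ^ 2 * fx y ^ 2) + 1 / ε * (ph R y * f y) ^ 2 := by
      have : 0 ≤ (ε * (ph R y * fx y) - ph R y * f y) ^ 2 / ε := by positivity
      have e : (ε * (ph R y * fx y) - ph R y * f y) ^ 2 / ε
        = ε * (ph R y ^ 2 * fx y ^ 2) + 1 / ε * (ph R y * f y) ^ 2 - 2 * (ph R y * f y) * (ph R y * fx y) := by
        field_simp; ring
      linarith
    have k3 : 1 / ε * (ph R y * f y) ^ 2 ≤ 1 / ε * f y ^ 2 := by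
      apply mul_le_mul_of_nonneg_left _ (by positivity)
      rw [mul_pow]
      have : ph R y ^ 2 ≤ 1 := by nlinarith
      nlinarith [sq_nonneg (f y)]
    linarith
  have m2 := int_subset c3 (fun y => by positivity) (le_refl (-R)) hx.1 hx.2
  refine m1.trans (m2.trans (le_of_eq ?_))
  rw [intervalIntegral.integral_add, intervalIntegral.integral_const_mul, intervalIntegral.integral_const_mul]
  all_goals apply Continuous.intervalIntegrable; fun_prop

/-- The effective viscosity `μ(z) / z`. -/
def mv (α z : ℝ) : ℝ := z⁻¹ + α * z ^ (-α - 1)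

/-- Derivative of the effective viscosity. -/
def mvd (α z : ℝ) : ℝ := -(z⁻¹ ^ 2) - α * (α + 1) * z ^ (-α - 2)

/-- Scalar form of a classical solution with admissible data: all fields are extended
continuously to all times, and all derivatives are recorded as separate fields. -/
structure Sol (α β T K δ : ℝ) where
  (v vx u ux uxx ut θ θx θxx θt : ℝ → ℝ → ℝ)
  (w wx wxx wt b bx bxx bt : Fin 2 → ℝ → ℝ → ℝ)
  cv : Continuous fun p : ℝ × ℝ => v p.1 p.2
  cvx : Continuous fun p : ℝ × ℝ => vx p.1 p.2
  cu : Continuous fun p : ℝ × ℝ => u p.1 p.2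
  cux : Continuous fun p : ℝ × ℝ => ux p.1 p.2
  cuxx : Continuous fun p : ℝ × ℝ => uxx p.1 p.2
  cut : Continuous fun p : ℝ × ℝ => ut p.1 p.2
  cθ : Continuous fun p : ℝ × ℝ => θ p.1 p.2
  cθx : Continuous fun p : ℝ × ℝ => θx p.1 p.2
  cθxx : Continuous fun p : ℝ × ℝ => θxx p.1 p.2
  cθt : Continuous fun p : ℝ × ℝ => θt p.1 p.2
  cw : ∀ i, Continuous fun p : ℝ × ℝ => w i p.1 p.2
  cwx : ∀ i, Continuous fun p : ℝ × ℝ => wx i p.1 p.2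
  cwxx : ∀ i, Continuous fun p : ℝ × ℝ => wxx i p.1 p.2
  cwt : ∀ i, Continuous fun p : ℝ × ℝ => wt i p.1 p.2
  cb : ∀ i, Continuous fun p : ℝ × ℝ => b i p.1 p.2
  cbx : ∀ i, Continuous fun p : ℝ × ℝ => bx i p.1 p.2
  cbxx : ∀ i, Continuous fun p : ℝ × ℝ => bxx i p.1 p.2
  cbt : ∀ i, Continuous fun p : ℝ × ℝ => bt i p.1 p.2
  dv : ∀ x t, HasDerivAt (fun y => v y t) (vx x t) x
  du : ∀ x t, HasDerivAt (fun y => u y t) (ux x t) x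
  dux : ∀ x t, HasDerivAt (fun y => ux y t) (uxx x t) x
  dθ : ∀ x t, HasDerivAt (fun y => θ y t) (θx x t) x
  dθx : ∀ x t, HasDerivAt (fun y => θx y t) (θxx x t) x
  dw : ∀ i x t, HasDerivAt (fun y => w i y t) (wx i x t) x
  dwx : ∀ i x t, HasDerivAt (fun y => wx i y t) (wxx i x t) x
  db : ∀ i x t, HasDerivAt (fun y => b i y t) (bx i x t) x
  dbx : ∀ i x t, HasDerivAt (fun y => bx i y t) (bxx i x t) x
  dvt : ∀ x, ∀ t ∈ Ioo 0 T, HasDerivAt (v x) (ux x t) t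
  dut : ∀ x, ∀ t ∈ Ioo 0 T, HasDerivAt (u x) (ut x t) t
  dθt : ∀ x, ∀ t ∈ Ioo 0 T, HasDerivAt (θ x) (θt x t) t
  dwt : ∀ i x, ∀ t ∈ Ioo 0 T, HasDerivAt (w i x) (wt i x t) t
  dbt : ∀ i x, ∀ t ∈ Ioo 0 T, HasDerivAt (b i x) (bt i x t) t
  v_pos : ∀ x t, 0 < v x t
  θ_pos : ∀ x t, 0 < θ x t
  eq_u : ∀ x t, ut x t = mv α (v x t) * uxx x t + mvd α (v x t) * vx x t * ux x t
    - θx x t / v x t + θ x t * vx x t / v x t ^ 2 - (b 0 x t * bx 0 x t + b 1 x t * bx 1 x t)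
  eq_w : ∀ i x t, wt i x t = bx i x t + wxx i x t / v x t - wx i x t * vx x t / v x t ^ 2
  eq_b : ∀ i x t, v x t * bt i x t + ux x t * b i x t - wx i x t
    = bxx i x t / v x t - bx i x t * vx x t / v x t ^ 2
  eq_θ : ∀ x t, θt x t + θ x t / v x t * ux x t
    = θ x t ^ β * θxx x t / v x t + β * θ x t ^ (β - 1) * θx x t ^ 2 / v x t
      - θ x t ^ β * θx x t * vx x t / v x t ^ 2
      + (mv α (v x t) * v x t * ux x t ^ 2 + (wx 0 x t ^ 2 + wx 1 x t ^ 2)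
        + (bx 0 x t ^ 2 + bx 1 x t ^ 2)) / v x t
  far : ∀ ε > (0 : ℝ), ∃ M : ℝ, ∀ x t, M ≤ |x| →
    |v x t - 1| < ε ∧ |u x t| < ε ∧ |θ x t - 1| < ε ∧ (∀ i, |b i x t| < ε) ∧ ∀ i, |w i x t| < ε
  init : ∀ L, 0 ≤ L → ∫ x in (-L)..L, ((v x 0 - 1) ^ 2 + u x 0 ^ 2 + (θ x 0 - 1) ^ 2
    + (b 0 x 0 ^ 2 + b 1 x 0 ^ 2) + (w 0 x 0 ^ 2 + w 1 x 0 ^ 2) + vx x 0 ^ 2 + ux x 0 ^ 2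
    + θx x 0 ^ 2 + (bx 0 x 0 ^ 2 + bx 1 x 0 ^ 2) + (wx 0 x 0 ^ 2 + wx 1 x 0 ^ 2)) ≤ K ^ 2
  v_init : ∀ x, δ ≤ v x 0
  θ_init : ∀ x, δ ≤ θ x 0

namespace Sol

variable {α β T K δ : ℝ} (S : Sol α β T K δ) {X : Type*} [TopologicalSpace X] {g h : X → ℝ}

@[fun_prop] theorem fv (hg : Continuous g) (hh : Continuous h) :
    Continuous fun x => S.v (g x) (h x) := S.cv.comp (hg.prodMk hh)
@[fun_prop] theorem fvx (hg : Continuous g) (hh : Continuous h) :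
    Continuous fun x => S.vx (g x) (h x) := S.cvx.comp (hg.prodMk hh)
@[fun_prop] theorem fu (hg : Continuous g) (hh : Continuous h) :
    Continuous fun x => S.u (g x) (h x) := S.cu.comp (hg.prodMk hh)
@[fun_prop] theorem fux (hg : Continuous g) (hh : Continuous h) :
    Continuous fun x => S.ux (g x) (h x) := S.cux.comp (hg.prodMk hh)
@[fun_prop] theorem fuxx (hg : Continuous g) (hh : Continuous h) :
    Continuous fun x => S.uxx (g x) (h x) := S.cuxx.comp (hg.prodMk hh)
@[fun_prop] theorem fut (hg : Continuous g) (hh : Continuous h) :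
    Continuous fun x => S.ut (g x) (h x) := S.cut.comp (hg.prodMk hh)
@[fun_prop] theorem fθ (hg : Continuous g) (hh : Continuous h) :
    Continuous fun x => S.θ (g x) (h x) := S.cθ.comp (hg.prodMk hh)
@[fun_prop] theorem fθx (hg : Continuous g) (hh : Continuous h) :
    Continuous fun x => S.θx (g x) (h x) := S.cθx.comp (hg.prodMk hh)
@[fun_prop] theorem fθxx (hg : Continuous g) (hh : Continuous h) :
    Continuous fun x => S.θxx (g x) (h x) := S.cθxx.comp (hg.prodMk hh)
@[fun_prop] theorem fθt (hg : Continuous g) (hh : Continuous h) :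
    Continuous fun x => S.θt (g x) (h x) := S.cθt.comp (hg.prodMk hh)
@[fun_prop] theorem fw (i : Fin 2) (hg : Continuous g) (hh : Continuous h) :
    Continuous fun x => S.w i (g x) (h x) := (S.cw i).comp (hg.prodMk hh)
@[fun_prop] theorem fwx (i : Fin 2) (hg : Continuous g) (hh : Continuous h) :
    Continuous fun x => S.wx i (g x) (h x) := (S.cwx i).comp (hg.prodMk hh)
@[fun_prop] theorem fwxx (i : Fin 2) (hg : Continuous g) (hh : Continuous h) :
    Continuous fun x => S.wxx i (g x) (h x) := (S.cwxx i).comp (hg.prodMk hh)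
@[fun_prop] theorem fwt (i : Fin 2) (hg : Continuous g) (hh : Continuous h) :
    Continuous fun x => S.wt i (g x) (h x) := (S.cwt i).comp (hg.prodMk hh)
@[fun_prop] theorem fb (i : Fin 2) (hg : Continuous g) (hh : Continuous h) :
    Continuous fun x => S.b i (g x) (h x) := (S.cb i).comp (hg.prodMk hh)
@[fun_prop] theorem fbx (i : Fin 2) (hg : Continuous g) (hh : Continuous h) :
    Continuous fun x => S.bx i (g x) (h x) := (S.cbx i).comp (hg.prodMk hh)
@[fun_prop] theorem fbxx (i : Fin 2) (hg : Continuous g) (hh : Continuous h) :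
    Continuous fun x => S.bxx i (g x) (h x) := (S.cbxx i).comp (hg.prodMk hh)
@[fun_prop] theorem fbt (i : Fin 2) (hg : Continuous g) (hh : Continuous h) :
    Continuous fun x => S.bt i (g x) (h x) := (S.cbt i).comp (hg.prodMk hh)

@[simp] theorem v_ne (x t : ℝ) : S.v x t ≠ 0 := (S.v_pos x t).ne'
@[simp] theorem θ_ne (x t : ℝ) : S.θ x t ≠ 0 := (S.θ_pos x t).ne'

@[fun_prop] theorem fvrpow (p : ℝ) (hg : Continuous g) (hh : Continuous h) :
    Continuous fun x => S.v (g x) (h x) ^ p :=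
  (S.fv hg hh).rpow_const fun _ => .inl (S.v_ne _ _)
@[fun_prop] theorem fθrpow (p : ℝ) (hg : Continuous g) (hh : Continuous h) :
    Continuous fun x => S.θ (g x) (h x) ^ p :=
  (S.fθ hg hh).rpow_const fun _ => .inl (S.θ_ne _ _)
@[fun_prop] theorem fmv (hg : Continuous g) (hh : Continuous h) :
    Continuous fun x => mv α (S.v (g x) (h x)) := by
  unfold mv; fun_prop (disch := simp)
@[fun_prop] theorem fmvd (hg : Continuous g) (hh : Continuous h) :
    Continuous fun x => mvd α (S.v (g x) (h x)) := by
  unfold mvd; fun_prop (disch := simp)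

/-- The filter of points of space-time far away in space. -/
def farF : Filter (ℝ × ℝ) := comap (fun p : ℝ × ℝ => |p.1|) atTop

theorem eventually_farF {P : ℝ × ℝ → Prop} :
    (∀ᶠ p in farF, P p) ↔ ∃ M : ℝ, ∀ x t, M ≤ |x| → P (x, t) := by
  simp only [farF, eventually_comap, eventually_atTop]
  constructor
  · rintro ⟨M, hM⟩; exact ⟨M, fun x t hx => hM _ hx _ rfl⟩
  · rintro ⟨M, hM⟩; exact ⟨M, fun b hb a ha => hM a.1 a.2 (ha ▸ hb)⟩

theorem tendsto_farF {f : ℝ × ℝ → ℝ} {c : ℝ} :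
    Tendsto f farF (nhds c) ↔ ∀ ε > 0, ∃ M : ℝ, ∀ x t, M ≤ |x| → |f (x, t) - c| < ε := by
  simp only [Metric.tendsto_nhds, eventually_farF, Real.dist_eq]

theorem tv : Tendsto (fun p : ℝ × ℝ => S.v p.1 p.2) farF (nhds 1) := tendsto_farF.2 fun ε hε => by
  obtain ⟨M, hM⟩ := S.far ε hε
  exact ⟨M, fun x t hx => (hM x t hx).1⟩
theorem tu : Tendsto (fun p : ℝ × ℝ => S.u p.1 p.2) farF (nhds 0) := tendsto_farF.2 fun ε hε => by
  obtain ⟨M, hM⟩ := S.far ε hε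
  exact ⟨M, fun x t hx => by simpa using (hM x t hx).2.1⟩
theorem tθ : Tendsto (fun p : ℝ × ℝ => S.θ p.1 p.2) farF (nhds 1) := tendsto_farF.2 fun ε hε => by
  obtain ⟨M, hM⟩ := S.far ε hε
  exact ⟨M, fun x t hx => (hM x t hx).2.2.1⟩
theorem tb (i : Fin 2) : Tendsto (fun p : ℝ × ℝ => S.b i p.1 p.2) farF (nhds 0) :=
  tendsto_farF.2 fun ε hε => by
    obtain ⟨M, hM⟩ := S.far ε hε
    exact ⟨M, fun x t hx => by simpa using (hM x t hx).2.2.2.1 i⟩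
theorem tw (i : Fin 2) : Tendsto (fun p : ℝ × ℝ => S.w i p.1 p.2) farF (nhds 0) :=
  tendsto_farF.2 fun ε hε => by
    obtain ⟨M, hM⟩ := S.far ε hε
    exact ⟨M, fun x t hx => by simpa using (hM x t hx).2.2.2.2 i⟩

theorem tvpow (p : ℝ) : Tendsto (fun q : ℝ × ℝ => S.v q.1 q.2 ^ p) farF (nhds 1) := by
  simpa using S.tv.rpow_const (p := p) (.inl one_ne_zero)
theorem tθpow (p : ℝ) : Tendsto (fun q : ℝ × ℝ => S.θ q.1 q.2 ^ p) farF (nhds 1) := by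
  simpa using S.tθ.rpow_const (p := p) (.inl one_ne_zero)

theorem tmv : Tendsto (fun q : ℝ × ℝ => mv α (S.v q.1 q.2)) farF (nhds (1 + α)) := by
  unfold mv
  simpa using (S.tv.inv₀ one_ne_zero).add ((S.tvpow (-α - 1)).const_mul α)

/-- A continuous function with a limit at spatial infinity is bounded on the time strip. -/
theorem bdd_of_tendsto (T : ℝ) {f : ℝ → ℝ → ℝ} (hf : Continuous fun p : ℝ × ℝ => f p.1 p.2) {c : ℝ}
    (hl : Tendsto (fun p : ℝ × ℝ => f p.1 p.2) farF (nhds c)) :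
    ∃ M, 0 < M ∧ ∀ x, ∀ t ∈ Icc 0 T, |f x t| ≤ M := by
  obtain ⟨X, hX⟩ := tendsto_farF.1 hl 1 one_pos
  obtain ⟨M, hM⟩ := ((isCompact_Icc (a := -X) (b := X)).prod
    (isCompact_Icc (a := 0) (b := T))).exists_bound_of_continuousOn hf.continuousOn
  refine ⟨max M (|c| + 1), lt_max_of_lt_right (by positivity), fun x t ht => ?_⟩
  rcases le_total X |x| with h | h
  · have := hX x t h
    refine le_max_of_le_right ?_
    have := abs_sub_abs_le_abs_sub (f x t) c
    simp only at *
    linarith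
  · exact le_max_of_le_left (hM (x, t) ⟨abs_le.1 h, ht⟩)

/-- Averages over long intervals of a function decaying at spatial infinity are small. -/
theorem avg_small (T : ℝ) {f : ℝ → ℝ → ℝ} (hf : Continuous fun p : ℝ × ℝ => f p.1 p.2)
    (hl : Tendsto (fun p : ℝ × ℝ => f p.1 p.2) farF (nhds 0)) {ε : ℝ} (hε : 0 < ε) :
    ∃ R₀, 1 ≤ R₀ ∧ ∀ R ≥ R₀, ∀ t ∈ Icc 0 T, ∫ x in (-R)..R, 4 / R * |f x t| ≤ ε := by
  obtain ⟨X, hX⟩ := tendsto_farF.1 hl (ε / 16) (by positivity)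
  obtain ⟨M, hM0, hM⟩ := bdd_of_tendsto T hf hl
  set Y := max X 1 with hY
  have hY1 : 1 ≤ Y := le_max_right _ _
  refine ⟨max Y (16 * M * Y / ε), le_max_of_le_left hY1, fun R hR t ht => ?_⟩
  have hR1 : Y ≤ R := (le_max_left _ _).trans hR
  have hR2 : 16 * M * Y ≤ R * ε := by
    have := (le_max_right _ _).trans hR
    rwa [div_le_iff₀ hε] at this
  have hR0 : 0 < R := by linarith
  have cf : Continuous fun x => |f x t| := (slice_left hf t).abs
  rw [intervalIntegral.integral_const_mul]
  have b1 : ∫ x in (-R)..(-Y), |f x t| ≤ ∫ x in (-R)..(-Y), ε / 16 :=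
    int_mono cf continuous_const (by linarith) fun x hx => by
      have := hX x t (by rw [abs_of_nonpos (by linarith [hx.2])]; linarith [hx.2, le_max_left X 1])
      simpa using this.le
  have b2 : ∫ x in (-Y)..Y, |f x t| ≤ ∫ x in (-Y)..Y, M :=
    int_mono cf continuous_const (by linarith) fun x hx => hM x t ht
  have b3 : ∫ x in Y..R, |f x t| ≤ ∫ x in Y..R, ε / 16 :=
    int_mono cf continuous_const (by linarith) fun x hx => by
      have := hX x t (by rw [abs_of_nonneg (by linarith [hx.1])]; linarith [hx.1, le_max_left X 1])
      simpa using this.le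
  have ii : ∀ a b, IntervalIntegrable (fun x => |f x t|) volume a b := cf.intervalIntegrable
  rw [← intervalIntegral.integral_add_adjacent_intervals (ii (-R) (-Y)) (ii (-Y) R),
    ← intervalIntegral.integral_add_adjacent_intervals (ii (-Y) Y) (ii Y R)]
  simp only [intervalIntegral.integral_const, smul_eq_mul] at b1 b2 b3
  rw [div_mul_eq_mul_div, div_le_iff₀ hR0]
  nlinarith

theorem dmv {v vx : ℝ → ℝ} {x : ℝ} (hv : 0 < v x) (hd : HasDerivAt v (vx x) x) :
    HasDerivAt (fun y => mv α (v y)) (mvd α (v x) * vx x) x := by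
  have h1 := hd.fun_inv hv.ne'
  have h2 := (hd.rpow_const (p := -α - 1) (.inl hv.ne')).const_mul α
  refine (h1.fun_add h2).congr_deriv ?_
  have : -α - 1 - 1 = -α - 2 := by ring
  rw [this, mvd]; field_simp; ring

theorem mv_pos (hα : 0 ≤ α) {z : ℝ} (hz : 0 < z) : 0 < mv α z := by unfold mv; positivity

theorem mv_ge (hα : 0 ≤ α) {z : ℝ} (hz : 0 < z) : z⁻¹ ≤ mv α z := by
  have : 0 ≤ α * z ^ (-α - 1) := by positivity
  unfold mv; linarith

/-- The space derivative of `v` is differentiable in time. -/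
theorem dvxt (x t : ℝ) (ht : t ∈ Ioo 0 T) : HasDerivAt (S.vx x) (S.uxx x t) t := by
  have key : ∀ s ∈ Icc 0 T, ∀ x, S.vx x s - S.vx x 0 = ∫ r in (0 : ℝ)..s, S.uxx x r := by
    intro s hs
    have c1 : Continuous fun x => S.vx x s - S.vx x 0 := by fun_prop
    have c2 : Continuous fun x => ∫ r in (0 : ℝ)..s, S.uxx x r := cont_int (by fun_prop)
    have I : ∀ y, ∫ x in (0 : ℝ)..y, (S.vx x s - S.vx x 0)
        = ∫ x in (0 : ℝ)..y, ∫ r in (0 : ℝ)..s, S.uxx x r := by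
      intro y
      rw [int_swap (by fun_prop)]
      have e : ∀ r, ∫ x in (0 : ℝ)..y, S.uxx x r = S.ux y r - S.ux 0 r := fun r =>
        intervalIntegral.integral_eq_sub_of_hasDerivAt (fun x _ => S.dux x r)
          ((by fun_prop : Continuous fun x => S.uxx x r).intervalIntegrable _ _)
      have e2 : ∀ r, ∫ x in (0 : ℝ)..y, S.vx x r = S.v y r - S.v 0 r := fun r =>
        intervalIntegral.integral_eq_sub_of_hasDerivAt (fun x _ => S.dv x r)
          ((by fun_prop : Continuous fun x => S.vx x r).intervalIntegrable _ _)
      have e3 : ∀ y, ∫ r in (0 : ℝ)..s, S.ux y r = S.v y s - S.v y 0 := fun y =>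
        time_ftc_pt (T := T) (by fun_prop) (by fun_prop) (S.dvt y) le_rfl hs.1 hs.2
      simp only [e]
      rw [int_sub (by fun_prop) (by fun_prop), int_sub (by fun_prop) (by fun_prop), e2, e2, e3, e3]
      ring
    intro x
    have d1 := (c1.integral_hasStrictDerivAt 0 x).hasDerivAt
    have d2 := (c2.integral_hasStrictDerivAt 0 x).hasDerivAt
    rw [funext I] at d1
    exact d1.unique d2
  have c : Continuous fun r => S.uxx x r := by fun_prop
  have d := ((c.integral_hasStrictDerivAt 0 t).hasDerivAt).add_const (S.vx x 0)
  refine d.congr_of_eventuallyEq ?_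
  filter_upwards [Ioo_mem_nhds ht.1 ht.2] with s hs
  have := key s ⟨hs.1.le, hs.2.le⟩ x
  linarith

/-- Total dissipation quadratic form. -/
def Q (x t : ℝ) : ℝ := mv α (S.v x t) * S.v x t * S.ux x t ^ 2 + (S.wx 0 x t ^ 2 + S.wx 1 x t ^ 2)
  + (S.bx 0 x t ^ 2 + S.bx 1 x t ^ 2)

@[fun_prop] theorem fQ {X : Type*} [TopologicalSpace X] {g h : X → ℝ} (hg : Continuous g)
    (hh : Continuous h) : Continuous fun x => S.Q (g x) (h x) := by unfold Q; fun_prop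

theorem Q_nonneg (hα : 0 ≤ α) (x t : ℝ) : 0 ≤ S.Q x t := by
  have := mv_pos hα (S.v_pos x t)
  have := S.v_pos x t
  unfold Q; positivity

/-- Entropy density associated with a thermal part `Φ`. -/
def ent (Φ : ℝ → ℝ) (x t : ℝ) : ℝ := 1 / 2 * S.u x t ^ 2
  + 1 / 2 * S.v x t * (S.b 0 x t ^ 2 + S.b 1 x t ^ 2) + 1 / 2 * (S.w 0 x t ^ 2 + S.w 1 x t ^ 2)
  + (S.v x t - Real.log (S.v x t) - 1) + Φ (S.θ x t)

/-- Time derivative of `ent`. -/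
def entt (p : ℝ) (x t : ℝ) : ℝ := S.u x t * S.ut x t
  + 1 / 2 * S.ux x t * (S.b 0 x t ^ 2 + S.b 1 x t ^ 2)
  + S.v x t * (S.b 0 x t * S.bt 0 x t + S.b 1 x t * S.bt 1 x t)
  + (S.w 0 x t * S.wt 0 x t + S.w 1 x t * S.wt 1 x t)
  + (1 - 1 / S.v x t) * S.ux x t + (1 - S.θ x t ^ (-p)) * S.θt x t

/-- Weighted dissipation. -/
def diss (p : ℝ) (x t : ℝ) : ℝ := S.Q x t * S.θ x t ^ (-p) / S.v x t
  + p * S.θ x t ^ (β - 1 - p) * S.θx x t ^ 2 / S.v x t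

/-- Entropy flux without its dissipative part. -/
def fluxE (x t : ℝ) : ℝ :=
  S.u x t * (1 - S.θ x t / S.v x t - (S.b 0 x t ^ 2 + S.b 1 x t ^ 2) / 2)
  + (S.w 0 x t * S.b 0 x t + S.w 1 x t * S.b 1 x t)

/-- Entropy flux. -/
def flux (p : ℝ) (x t : ℝ) : ℝ := S.fluxE x t + S.u x t * (mv α (S.v x t) * S.ux x t)
  + (S.w 0 x t * S.wx 0 x t + S.w 1 x t * S.wx 1 x t) / S.v x t
  + (S.b 0 x t * S.bx 0 x t + S.b 1 x t * S.bx 1 x t) / S.v x t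
  + (1 - S.θ x t ^ (-p)) * S.θ x t ^ β * S.θx x t / S.v x t

theorem ent_deriv {p : ℝ} {Φ : ℝ → ℝ} (hΦ : ∀ z, 0 < z → HasDerivAt Φ (1 - z ^ (-p)) z) (x : ℝ)
    {t : ℝ} (ht : t ∈ Ioo 0 T) : HasDerivAt (S.ent Φ x) (S.entt p x t) t := by
  have hv := S.dvt x t ht
  have := (((((S.dut x t ht).fun_pow 2).const_mul (1 / 2)).fun_add
    ((hv.const_mul (1 / 2)).fun_mul
      (((S.dbt 0 x t ht).fun_pow 2).fun_add ((S.dbt 1 x t ht).fun_pow 2)))).fun_add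
    ((((S.dwt 0 x t ht).fun_pow 2).fun_add ((S.dwt 1 x t ht).fun_pow 2)).const_mul (1 / 2))).fun_add
    ((hv.fun_sub (hv.log (S.v_ne x t))).sub_const 1) |>.fun_add
    ((hΦ _ (S.θ_pos x t)).comp t (S.dθt x t ht))
  refine this.congr_deriv ?_
  simp only [entt]; push_cast; field_simp; ring

theorem flux_deriv (p x t : ℝ) : HasDerivAt (fun y => S.flux p y t)
    (S.entt p x t + S.diss p x t - (S.θ x t ^ (1 - p) - 1) * S.ux x t / S.v x t) x := by
  have hv := S.dv x t
  have hθ := S.dθ x t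
  have hv0 := S.v_ne x t
  have hθ0 := S.θ_ne x t
  have d1 := (S.du x t).fun_mul (((hθ.fun_div hv hv0).const_sub 1).fun_sub
    ((((S.db 0 x t).fun_pow 2).fun_add ((S.db 1 x t).fun_pow 2)).div_const 2))
  have d2 := ((S.dw 0 x t).fun_mul (S.db 0 x t)).fun_add ((S.dw 1 x t).fun_mul (S.db 1 x t))
  have d3 := (S.du x t).fun_mul ((dmv (α := α) (v := fun y => S.v y t) (vx := fun y => S.vx y t) (S.v_pos x t) hv).fun_mul
    (S.dux x t))
  have d4 := (((S.dw 0 x t).fun_mul (S.dwx 0 x t)).fun_add ((S.dw 1 x t).fun_mul (S.dwx 1 x t))).fun_div hv hv0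
  have d5 := (((S.db 0 x t).fun_mul (S.dbx 0 x t)).fun_add ((S.db 1 x t).fun_mul (S.dbx 1 x t))).fun_div hv hv0
  have d6 := ((((hθ.rpow_const (p := -p) (.inl hθ0)).const_sub 1).fun_mul
    (hθ.rpow_const (p := β) (.inl hθ0))).fun_mul (S.dθx x t)).fun_div hv hv0
  have := ((((d1.fun_add d2).fun_add d3).fun_add d4).fun_add d5).fun_add d6
  refine this.congr_deriv ?_
  have e1 : S.θ x t ^ (1 - p) = S.θ x t * S.θ x t ^ (-p) := by
    rw [sub_eq_add_neg, Real.rpow_add (S.θ_pos x t), Real.rpow_one]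
  have e2 : S.θ x t ^ (β - 1 - p) = S.θ x t ^ β * S.θ x t ^ (-p) / S.θ x t := by
    rw [show β - 1 - p = β + -p - 1 by ring, Real.rpow_sub_one hθ0, Real.rpow_add (S.θ_pos x t)]
  have e3 : S.θ x t ^ (β - 1) = S.θ x t ^ β / S.θ x t := Real.rpow_sub_one hθ0 _
  have e4 : S.θ x t ^ (-p - 1) = S.θ x t ^ (-p) / S.θ x t := Real.rpow_sub_one hθ0 _
  have q1 := S.eq_u x t
  have q2 := S.eq_w 0 x t
  have q3 := S.eq_w 1 x t
  have q4 := S.eq_b 0 x t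
  have q5 := S.eq_b 1 x t
  have q6 := S.eq_θ x t
  rw [e3] at q6
  simp only [entt, diss, Q, e1, e2, e3, e4]
  clear this d1 d2 d3 d4 d5 d6 e1 e2 e3 e4
  generalize S.θ x t ^ β = B at *
  generalize S.θ x t ^ (-p) = A at *
  generalize mv α (S.v x t) = m at *
  generalize mvd α (S.v x t) = m' at *
  linear_combination (norm := skip) (-S.u x t) * q1 - S.w 0 x t * q2 - S.w 1 x t * q3
    - S.b 0 x t * q4 - S.b 1 x t * q5 - (1 - A) * q6
  push_cast
  field_simp
  ring

theorem young {c : ℝ} (hc : 0 < c) (a b : ℝ) : 2 * a * b ≤ 1 / 2 * (c * a ^ 2) + 2 * (b ^ 2 / c) := by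
  have : 0 ≤ (c * a - 2 * b) ^ 2 / c := by positivity
  have e : (c * a - 2 * b) ^ 2 / c = c * a ^ 2 - 4 * a * b + 4 * (b ^ 2 / c) := by
    field_simp; ring
  linarith

/-- Error density in the localized entropy inequality. -/
def errE (p : ℝ) (x t : ℝ) : ℝ := 2 * (mv α (S.v x t) * S.u x t ^ 2 * S.θ x t ^ p
  + (S.w 0 x t ^ 2 + S.w 1 x t ^ 2) * S.θ x t ^ p / S.v x t
  + (S.b 0 x t ^ 2 + S.b 1 x t ^ 2) * S.θ x t ^ p / S.v x t
  + (1 - S.θ x t ^ (-p)) ^ 2 * S.θ x t ^ (β + 1 + p) / (p * S.v x t)) + |S.fluxE x t|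

theorem errE_cont {p : ℝ} (hp : 0 ≤ p) : Continuous fun q : ℝ × ℝ => S.errE p q.1 q.2 := by
  rcases hp.eq_or_lt with rfl | hp
  · simp only [errE, fluxE, neg_zero, Real.rpow_zero, sub_self, zero_mul, div_zero]
    fun_prop (disch := simp)
  · simp only [errE, fluxE]
    fun_prop (disch := simp [hp.ne'])

theorem errE_tendsto {p : ℝ} (hp : 0 ≤ p) :
    Tendsto (fun q : ℝ × ℝ => S.errE p q.1 q.2) farF (nhds 0) := by
  have h1 := (S.tmv.mul (S.tu.pow 2)).mul (S.tθpow p)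
  have h2 := (((S.tw 0).pow 2).add ((S.tw 1).pow 2)).mul (S.tθpow p) |>.div S.tv one_ne_zero
  have h3 := (((S.tb 0).pow 2).add ((S.tb 1).pow 2)).mul (S.tθpow p) |>.div S.tv one_ne_zero
  have h5 := (S.tu.mul (((S.tθ.div S.tv one_ne_zero).const_sub 1).sub
    ((((S.tb 0).pow 2).add ((S.tb 1).pow 2)).div_const 2))).add
    (((S.tw 0).mul (S.tb 0)).add ((S.tw 1).mul (S.tb 1))) |>.abs
  have h4 : Tendsto (fun q : ℝ × ℝ => (1 - S.θ q.1 q.2 ^ (-p)) ^ 2 * S.θ q.1 q.2 ^ (β + 1 + p) / (p * S.v q.1 q.2))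
      farF (nhds 0) := by
    rcases hp.eq_or_lt with rfl | hp
    · simp only [neg_zero, Real.rpow_zero, sub_self, zero_mul, div_zero, ne_eq,
        OfNat.ofNat_ne_zero, not_false_eq_true, zero_pow]
      exact tendsto_const_nhds
    · have h : p * 1 ≠ 0 := by simpa using hp.ne'
      have := ((((S.tθpow (-p)).const_sub 1).pow 2).mul (S.tθpow (β + 1 + p))).mul
        ((S.tv.const_mul p).inv₀ h)
      simpa [div_eq_mul_inv] using this
  have := ((((h1.add h2).add h3).add h4).const_mul 2).add h5
  simpa [errE, fluxE] using this

theorem flux_bound (hα : 0 ≤ α) {p R : ℝ} (hp : 0 ≤ p) (hR : 1 ≤ R) {x t : ℝ} (hx : x ∈ Icc (-R) R) :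
    -(2 * ph R x * dph R x * S.flux p x t) ≤
      1 / 2 * (ph R x ^ 2 * S.diss p x t) + 4 / R * |S.errE p x t| := by
  have hv := S.v_pos x t
  have hθ := S.θ_pos x t
  have hm := mv_pos hα hv
  obtain ⟨p0, p1⟩ := ph_mem (by linarith) hx
  have d1 := dph_abs (by linarith : 0 < R) hx
  have d2 : dph R x ^ 2 ≤ 4 / R := by
    rw [← sq_abs]
    have : |dph R x| ^ 2 ≤ (2 / R) ^ 2 := by gcongr
    refine this.trans ?_
    rw [div_pow, div_le_div_iff₀ (by positivity) (by positivity)]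
    nlinarith
  have hA : 0 < S.θ x t ^ (-p) := by positivity
  have hB : 0 < S.θ x t ^ β := by positivity
  have hpw : S.θ x t ^ p = (S.θ x t ^ (-p))⁻¹ := by rw [Real.rpow_neg hθ.le, inv_inv]
  have hbw : S.θ x t ^ (β + 1 + p) = S.θ x t ^ β * S.θ x t * (S.θ x t ^ (-p))⁻¹ := by
    rw [Real.rpow_add hθ, Real.rpow_add hθ, Real.rpow_one, hpw]
  have hdw : S.θ x t ^ (β - 1 - p) = S.θ x t ^ β * S.θ x t ^ (-p) / S.θ x t := by
    rw [show β - 1 - p = β + -p - 1 by ring, Real.rpow_sub_one (S.θ_ne x t), Real.rpow_add hθ]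
  have hE : 0 ≤ S.errE p x t := by unfold errE; positivity
  rw [abs_of_nonneg hE]
  have y1 := young (c := mv α (S.v x t) * S.θ x t ^ (-p)) (by positivity) (ph R x * S.ux x t)
    (-dph R x * (S.u x t * mv α (S.v x t)))
  have yy : ∀ f g : ℝ, 2 * (ph R x * g) * (-dph R x * (f / S.v x t)) ≤
      1 / 2 * (ph R x ^ 2 * (g ^ 2 * S.θ x t ^ (-p) / S.v x t))
        + 2 * (dph R x ^ 2 * (f ^ 2 * S.θ x t ^ p / S.v x t)) := by
    intro f g
    have := young (c := S.θ x t ^ (-p) / S.v x t) (by positivity) (ph R x * g) (-dph R x * (f / S.v x t))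
    refine this.trans (le_of_eq ?_)
    rw [hpw]; field_simp
  have y2 := yy (S.w 0 x t) (S.wx 0 x t)
  have y3 := yy (S.w 1 x t) (S.wx 1 x t)
  have y4 := yy (S.b 0 x t) (S.bx 0 x t)
  have y5 := yy (S.b 1 x t) (S.bx 1 x t)
  have y6 : 2 * (ph R x * S.θx x t) * (-dph R x * ((1 - S.θ x t ^ (-p)) * S.θ x t ^ β / S.v x t)) ≤
      1 / 2 * (ph R x ^ 2 * (p * S.θ x t ^ (β - 1 - p) * S.θx x t ^ 2 / S.v x t))
      + 2 * (dph R x ^ 2 * ((1 - S.θ x t ^ (-p)) ^ 2 * S.θ x t ^ (β + 1 + p) / (p * S.v x t))) := by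
    rcases hp.eq_or_lt with rfl | hp
    · simp
    · have := young (c := p * S.θ x t ^ (β - 1 - p) / S.v x t) (by positivity) (ph R x * S.θx x t)
        (-dph R x * ((1 - S.θ x t ^ (-p)) * S.θ x t ^ β / S.v x t))
      refine this.trans (le_of_eq ?_)
      rw [hbw, hdw]; field_simp
  have y7 : -(2 * ph R x * dph R x * S.fluxE x t) ≤ 4 / R * |S.fluxE x t| := by
    have : |2 * ph R x * dph R x * S.fluxE x t| ≤ 2 * 1 * (2 / R) * |S.fluxE x t| := by
      rw [abs_mul, abs_mul, abs_mul, abs_two, abs_of_nonneg p0]; gcongr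
    have := (neg_le_abs (2 * ph R x * dph R x * S.fluxE x t)).trans this
    refine this.trans (le_of_eq (by ring))
  have y8 : 2 * (dph R x ^ 2 * (mv α (S.v x t) * S.u x t ^ 2 * S.θ x t ^ p
    + (S.w 0 x t ^ 2 + S.w 1 x t ^ 2) * S.θ x t ^ p / S.v x t
    + (S.b 0 x t ^ 2 + S.b 1 x t ^ 2) * S.θ x t ^ p / S.v x t
    + (1 - S.θ x t ^ (-p)) ^ 2 * S.θ x t ^ (β + 1 + p) / (p * S.v x t))) ≤
    2 * (4 / R * (mv α (S.v x t) * S.u x t ^ 2 * S.θ x t ^ p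
    + (S.w 0 x t ^ 2 + S.w 1 x t ^ 2) * S.θ x t ^ p / S.v x t
    + (S.b 0 x t ^ 2 + S.b 1 x t ^ 2) * S.θ x t ^ p / S.v x t
    + (1 - S.θ x t ^ (-p)) ^ 2 * S.θ x t ^ (β + 1 + p) / (p * S.v x t))) := by
    gcongr
  have y1' : 2 * (ph R x * S.ux x t) * (-dph R x * (S.u x t * mv α (S.v x t))) ≤
      1 / 2 * (ph R x ^ 2 * (mv α (S.v x t) * S.v x t * S.ux x t ^ 2 * S.θ x t ^ (-p) / S.v x t))
      + 2 * (dph R x ^ 2 * (mv α (S.v x t) * S.u x t ^ 2 * S.θ x t ^ p)) := by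
    refine y1.trans (le_of_eq ?_)
    rw [hpw]; field_simp
  simp only [flux, diss, Q, errE]
  clear d1 d2 hpw hbw hdw yy y1
  ring_nf at *
  linarith

/-- Localized entropy inequality. -/
theorem entropy (hα : 0 ≤ α) (hT : 0 < T) {p : ℝ} (hp : 0 ≤ p) {Φ : ℝ → ℝ}
    (hΦ : ∀ z, 0 < z → HasDerivAt Φ (1 - z ^ (-p)) z) :
    ∃ R₀, 1 ≤ R₀ ∧ ∀ R ≥ R₀, ∀ t ∈ Icc 0 T,
      (∫ x in (-R)..R, ph R x ^ 2 * S.ent Φ x t)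
        + 1 / 2 * ∫ s in (0 : ℝ)..t, ∫ x in (-R)..R, ph R x ^ 2 * S.diss p x s
      ≤ (∫ x in (-R)..R, ph R x ^ 2 * S.ent Φ x 0)
        + (∫ s in (0 : ℝ)..t, ∫ x in (-R)..R,
          ph R x ^ 2 * ((S.θ x s ^ (1 - p) - 1) * S.ux x s / S.v x s)) + 1 := by
  obtain ⟨R₀, hR₀, hsm⟩ := avg_small T (S.errE_cont hp) (S.errE_tendsto hp) (ε := 1 / T) (by positivity)
  refine ⟨R₀, hR₀, fun R hR t ht => ?_⟩
  have hR1 : 1 ≤ R := hR₀.trans hR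
  have cΦ : Continuous fun q : ℝ × ℝ => Φ (S.θ q.1 q.2) := by
    rw [continuous_iff_continuousAt]
    intro q
    exact ContinuousAt.comp (f := fun q : ℝ × ℝ => S.θ q.1 q.2)
      (hΦ _ (S.θ_pos q.1 q.2)).continuousAt S.cθ.continuousAt
  have cent : Continuous fun q : ℝ × ℝ => S.ent Φ q.1 q.2 := by
    unfold ent; refine Continuous.add ?_ cΦ; fun_prop (disch := simp)
  have centt : Continuous fun q : ℝ × ℝ => S.entt p q.1 q.2 := by
    unfold entt; fun_prop (disch := simp)
  have cdiss : Continuous fun q : ℝ × ℝ => S.diss p q.1 q.2 := by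
    unfold diss; fun_prop (disch := simp)
  have cflux : Continuous fun q : ℝ × ℝ => S.flux p q.1 q.2 := by
    unfold flux fluxE; fun_prop (disch := simp)
  have cerr := S.errE_cont hp
  have cN : Continuous fun q : ℝ × ℝ => (S.θ q.1 q.2 ^ (1 - p) - 1) * S.ux q.1 q.2 / S.v q.1 q.2 := by
    fun_prop (disch := simp)
  have c3 : ∀ {f : ℝ → ℝ → ℝ}, Continuous (fun q : ℝ × ℝ => f q.1 q.2) →
      Continuous fun q : ℝ × ℝ => ph R q.1 ^ 2 * f q.1 q.2 := fun hf => by fun_prop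
  have c4 : ∀ {f : ℝ → ℝ → ℝ}, Continuous (fun q : ℝ × ℝ => f q.1 q.2) →
      Continuous fun s => ∫ x in (-R)..R, ph R x ^ 2 * f x s := fun {f} hf =>
    cont_int (f := fun x s => ph R x ^ 2 * f x s) (c3 hf)
  have cN3 := c3 (f := fun x s => (S.θ x s ^ (1 - p) - 1) * S.ux x s / S.v x s) cN
  have cNs : ∀ s, Continuous fun x => ph R x ^ 2 * ((S.θ x s ^ (1 - p) - 1) * S.ux x s / S.v x s) :=
    fun s => by fun_prop (disch := simp)
  have cDs : ∀ s, Continuous fun x => ph R x ^ 2 * S.diss p x s :=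
    fun s => (c3 cdiss).comp (by fun_prop : Continuous fun x : ℝ => (x, s))
  have cN4 := c4 (f := fun x s => (S.θ x s ^ (1 - p) - 1) * S.ux x s / S.v x s) cN
  have key := time_ftc (T := T) (c3 cent) (c3 centt)
    (fun x s hs => (S.ent_deriv hΦ x hs).const_mul (ph R x ^ 2)) (-R) R ht
  have main : ∀ s ∈ Icc 0 t, ∫ x in (-R)..R, ph R x ^ 2 * S.entt p x s ≤
      (-1 / 2) * (∫ x in (-R)..R, ph R x ^ 2 * S.diss p x s)
      + 1 * (∫ x in (-R)..R, ph R x ^ 2 * ((S.θ x s ^ (1 - p) - 1) * S.ux x s / S.v x s)) + 1 / T := by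
    intro s hs
    have hs' : s ∈ Icc 0 T := ⟨hs.1, hs.2.trans ht.2⟩
    have cfx : Continuous fun x => S.entt p x s + S.diss p x s
      - (S.θ x s ^ (1 - p) - 1) * S.ux x s / S.v x s :=
      ((slice_left centt s).add (slice_left cdiss s)).sub (slice_left (f := fun x s => (S.θ x s ^ (1 - p) - 1) * S.ux x s / S.v x s) cN s)
    have ib := ibp_zero (R := R) (a := fun x => ph R x ^ 2) (fun x => ph_sq_deriv R x)
      (fun x => S.flux_deriv p x s) (by fun_prop) cfx
      (by simp [ph, div_self (show R ≠ 0 by linarith)]) (by simp [ph, neg_div, div_self (show R ≠ 0 by linarith)])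
    have e1 : ∫ x in (-R)..R, ph R x ^ 2 * S.entt p x s =
        (∫ x in (-R)..R, ph R x ^ 2 * (S.entt p x s + S.diss p x s
      - (S.θ x s ^ (1 - p) - 1) * S.ux x s / S.v x s))
        + ∫ x in (-R)..R, (-(ph R x ^ 2 * S.diss p x s) + ph R x ^ 2 * ((S.θ x s ^ (1 - p) - 1) * S.ux x s / S.v x s)) := by
      rw [← int_add]
      · congr 1; ext x; ring
      · exact ((by fun_prop : Continuous fun x => ph R x ^ 2)).mul cfx
      · exact (cDs s).neg.add (cNs s)
    rw [e1, ib, ← int_add]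
    · have := int_le_three (f := fun x => -(2 * ph R x * dph R x * S.flux p x s) + (-(ph R x ^ 2 * S.diss p x s) + ph R x ^ 2 * ((S.θ x s ^ (1 - p) - 1) * S.ux x s / S.v x s)))
        (a := -R) (b := R) (c₁ := -1 / 2) (c₂ := 1) (c₃ := 1) ?_ (cDs s) (cNs s)
        (by
          have := (slice_left cerr s).abs
          exact this.const_mul (4 / R)) (by linarith)
          (fun x hx => by
            have := S.flux_bound hα hp hR1 (t := s) hx
            linarith)
      · have h2 := hsm R hR s hs'
        linarith
      · have h1 : Continuous fun x => -(2 * ph R x * dph R x * S.flux p x s) := by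
          have := slice_left cflux s
          fun_prop
        exact h1.add ((cDs s).neg.add (cNs s))
    · have := slice_left cflux s
      fun_prop
    · exact (cDs s).neg.add (cNs s)
  have fin := int_le_three (a := 0) (b := t) (f := fun s => ∫ x in (-R)..R, ph R x ^ 2 * S.entt p x s)
    (c4 centt) (c4 cdiss) cN4 (g₃ := fun _ => 1) continuous_const ht.1 (c₁ := -1 / 2) (c₂ := 1) (c₃ := 1 / T)
    (fun s hs => by have := main s hs; linarith)
  rw [key]
  have : 1 / T * ∫ s in (0 : ℝ)..t, (1 : ℝ) ≤ 1 := by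
    simp only [intervalIntegral.integral_const, sub_zero, smul_eq_mul, mul_one]
    rw [div_mul_eq_mul_div, one_mul, div_le_one hT]; exact ht.2
  linarith

section
variable {X : Type*} [TopologicalSpace X] {g h : X → ℝ}
@[fun_prop] theorem fdiss (p : ℝ) (hg : Continuous g) (hh : Continuous h) :
    Continuous fun x => S.diss p (g x) (h x) := by unfold diss; fun_prop (disch := simp)
theorem fent {Φ : ℝ → ℝ} (cΦ : ContinuousOn Φ (Ioi 0)) (hg : Continuous g) (hh : Continuous h) :
    Continuous fun x => S.ent Φ (g x) (h x) := by
  unfold ent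
  refine Continuous.add (by fun_prop (disch := simp)) ?_
  exact cΦ.comp_continuous (by fun_prop) fun x => S.θ_pos _ _
end

/-- The initial energy density. -/
def ini (x : ℝ) : ℝ := (S.v x 0 - 1) ^ 2 + S.u x 0 ^ 2 + (S.θ x 0 - 1) ^ 2
    + (S.b 0 x 0 ^ 2 + S.b 1 x 0 ^ 2) + (S.w 0 x 0 ^ 2 + S.w 1 x 0 ^ 2) + S.vx x 0 ^ 2 + S.ux x 0 ^ 2
    + S.θx x 0 ^ 2 + (S.bx 0 x 0 ^ 2 + S.bx 1 x 0 ^ 2) + (S.wx 0 x 0 ^ 2 + S.wx 1 x 0 ^ 2)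

theorem ini_cont : Continuous S.ini := by unfold ini; fun_prop

theorem ini_nonneg (x : ℝ) : 0 ≤ S.ini x := by unfold ini; positivity

theorem ini_int {a b : ℝ} (hab : a ≤ b) : ∫ x in a..b, S.ini x ≤ K ^ 2 := by
  have h0 : 0 ≤ |a| + |b| := by positivity
  refine le_trans ?_ (S.init (|a| + |b|) h0)
  refine int_subset S.ini_cont S.ini_nonneg ?_ hab ?_
  · linarith [neg_abs_le a, abs_nonneg b]
  · linarith [le_abs_self b, abs_nonneg a]

theorem v_init_le (x : ℝ) : S.v x 0 ≤ 2 + 2 * K ^ 2 := by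
  have h := sup_unit (f := fun x => S.v x 0 - 1) (fx := fun x => S.vx x 0) (by fun_prop) (by fun_prop)
    (fun x => (S.dv x 0).sub_const 1) (left_mem_Icc.2 (by linarith : x ≤ x + 1)) rfl
  have h1 := int_le_one (f := fun y => (S.v y 0 - 1) ^ 2) (g₁ := S.ini) (c₁ := 1) (by fun_prop)
    S.ini_cont (by linarith : x ≤ x + 1) fun y _ => by unfold ini; nlinarith
  have h2 := int_le_one (f := fun y => S.vx y 0 ^ 2) (g₁ := S.ini) (c₁ := 1) (by fun_prop)
    S.ini_cont (by linarith : x ≤ x + 1) fun y _ => by unfold ini; nlinarith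
  have h3 := S.ini_int (by linarith : x ≤ x + 1)
  nlinarith [sq_nonneg (S.v x 0 - 1 - 1)]

theorem log_bound {d z : ℝ} (hd : 0 < d) (h : d ≤ z) : z - Real.log z - 1 ≤ d⁻¹ * (z - 1) ^ 2 := by
  have hz : 0 < z := by linarith
  have h1 := Real.one_sub_inv_le_log_of_pos hz
  have h2 : z - Real.log z - 1 ≤ z⁻¹ * (z - 1) ^ 2 := by
    have : z⁻¹ * (z - 1) ^ 2 = z - 2 + z⁻¹ := by field_simp; ring
    linarith
  refine h2.trans ?_
  gcongr

theorem log_ge (z : ℝ) (hz : 0 < z) : z ≤ 2 * (z - Real.log z - 1) + 2 := by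
  have h1 := Real.log_le_sub_one_of_pos (by positivity : 0 < z / 2)
  rw [Real.log_div hz.ne' two_ne_zero] at h1
  have := Real.log_two_lt_d9
  linarith

theorem log_nonneg (z : ℝ) (hz : 0 < z) : 0 ≤ z - Real.log z - 1 := by
  linarith [Real.log_le_sub_one_of_pos hz]

theorem ent_init (hδ : 0 < δ) {Φ : ℝ → ℝ} (h1 : ∀ z, 0 < z → Φ z ≤ z - Real.log z - 1)
    (cΦ : ContinuousOn Φ (Ioi 0)) {R : ℝ}
    (hR : 1 ≤ R) : ∫ x in (-R)..R, ph R x ^ 2 * S.ent Φ x 0 ≤ (2 + K ^ 2 + δ⁻¹) * K ^ 2 := by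
  have hc := S.fent cΦ continuous_id (continuous_const (y := (0 : ℝ)))
  have := int_le_one (f := fun x => ph R x ^ 2 * S.ent Φ x 0) (g₁ := S.ini) (c₁ := 2 + K ^ 2 + δ⁻¹)
    (by exact ((by fun_prop : Continuous fun x => ph R x ^ 2)).mul hc) S.ini_cont (by linarith : -R ≤ R) ?_
  · refine this.trans ?_
    have := S.ini_int (by linarith : -R ≤ R)
    gcongr
  intro x hx
  have k1 := log_bound hδ (S.v_init x)
  have k2 := log_bound hδ (S.θ_init x)
  have k3 := h1 _ (S.θ_pos x 0)
  have k4 := S.v_init_le x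
  have hv := S.v_pos x 0
  obtain ⟨p0, p1⟩ := ph_mem (by linarith : 0 < R) hx
  have hi : 0 < δ⁻¹ := by positivity
  have e : S.ent Φ x 0 ≤ (2 + K ^ 2 + δ⁻¹) * S.ini x := by
    have k5 : S.v x 0 * (S.b 0 x 0 ^ 2 + S.b 1 x 0 ^ 2) ≤ (2 + 2 * K ^ 2) * (S.b 0 x 0 ^ 2 + S.b 1 x 0 ^ 2) := by
      gcongr
    set c := 2 + K ^ 2 + δ⁻¹ with hc
    have c1 : δ⁻¹ ≤ c := by rw [hc]; nlinarith [sq_nonneg K]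
    have c2 : 2 + K ^ 2 ≤ c := by rw [hc]; nlinarith
    have j1 : δ⁻¹ * (S.v x 0 - 1) ^ 2 ≤ c * (S.v x 0 - 1) ^ 2 := by gcongr
    have j2 : δ⁻¹ * (S.θ x 0 - 1) ^ 2 ≤ c * (S.θ x 0 - 1) ^ 2 := by gcongr
    have j3 : (2 + K ^ 2) * (S.b 0 x 0 ^ 2 + S.b 1 x 0 ^ 2) ≤ c * (S.b 0 x 0 ^ 2 + S.b 1 x 0 ^ 2) := by gcongr
    have j4 : (2 + K ^ 2) * (S.u x 0 ^ 2 + (S.w 0 x 0 ^ 2 + S.w 1 x 0 ^ 2)) ≤ c * (S.u x 0 ^ 2 + (S.w 0 x 0 ^ 2 + S.w 1 x 0 ^ 2)) := by gcongr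
    have j5 : 0 ≤ K ^ 2 * (S.u x 0 ^ 2 + (S.w 0 x 0 ^ 2 + S.w 1 x 0 ^ 2)) := by positivity
    have j6 : 0 ≤ c * (S.vx x 0 ^ 2 + S.ux x 0 ^ 2
    + S.θx x 0 ^ 2 + (S.bx 0 x 0 ^ 2 + S.bx 1 x 0 ^ 2) + (S.wx 0 x 0 ^ 2 + S.wx 1 x 0 ^ 2)) := by positivity
    have j7 : 0 ≤ S.u x 0 ^ 2 + (S.w 0 x 0 ^ 2 + S.w 1 x 0 ^ 2) := by positivity
    have j8 : 0 ≤ K ^ 2 * (S.b 0 x 0 ^ 2 + S.b 1 x 0 ^ 2) := by positivity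
    have j9 : 0 ≤ (S.b 0 x 0 ^ 2 + S.b 1 x 0 ^ 2) := by positivity
    unfold ent ini
    linarith
  have e0 : 0 ≤ (2 + K ^ 2 + δ⁻¹) * S.ini x := mul_nonneg (by positivity) (S.ini_nonneg x)
  have q : ph R x ^ 2 ≤ 1 := by nlinarith
  nlinarith [sq_nonneg (ph R x)]

theorem diss_nonneg (hα : 0 ≤ α) {p : ℝ} (hp : 0 ≤ p) (x t : ℝ) : 0 ≤ S.diss p x t := by
  have := S.Q_nonneg hα x t
  have := S.v_pos x t
  have := S.θ_pos x t
  unfold diss; positivity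

theorem ent_nonneg {Φ : ℝ → ℝ} (h0 : ∀ z, 0 < z → 0 ≤ Φ z) (x t : ℝ) : 0 ≤ S.ent Φ x t := by
  have := S.v_pos x t
  have := log_nonneg _ this
  have := h0 _ (S.θ_pos x t)
  unfold ent; positivity

theorem int_le_weight2 {f : ℝ → ℝ → ℝ} (cf : Continuous fun p : ℝ × ℝ => f p.1 p.2) (hf : ∀ x t, 0 ≤ f x t)
    {L R t : ℝ} (hL : 0 < L) (ht : 0 ≤ t) (hR : 2 * L ≤ R) : ∫ s in (0 : ℝ)..t, ∫ x in (-L)..L, f x s ≤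
      2 * ∫ s in (0 : ℝ)..t, ∫ x in (-R)..R, ph R x ^ 2 * f x s := by
  refine int_le_one (cont_int cf) (cont_int (f := fun x s => ph R x ^ 2 * f x s) (by fun_prop)) ht fun s _ => ?_
  exact int_le_weight (slice_left cf s) (fun x => hf x s) hL hR

/-- The physical entropy `z - log z - 1`. -/
def lg (z : ℝ) : ℝ := z - Real.log z - 1

theorem lg_cont : ContinuousOn lg (Ioi 0) := by
  unfold lg
  have : ContinuousOn Real.log (Ioi 0) := Real.continuousOn_log.mono fun z hz => (ne_of_gt hz)
  fun_prop

/-- Basic energy estimate. -/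
theorem basic_energy (hα : 0 ≤ α) (hT : 0 < T) (hδ : 0 < δ) :
    ∃ C, 0 < C ∧ ∀ S : Sol α β T K δ, ∀ L, 1 ≤ L → ∀ t ∈ Icc 0 T,
      ∫ x in (-L)..L, S.ent lg x t ≤ C ∧ ∫ s in (0 : ℝ)..t, ∫ x in (-L)..L, S.diss 1 x s ≤ C := by
  refine ⟨4 * ((2 + K ^ 2 + δ⁻¹) * K ^ 2 + 1), by positivity, fun S L hL t ht => ?_⟩
  obtain ⟨R₀, hR₀, H⟩ := S.entropy hα hT zero_le_one (Φ := lg) (fun z hz => by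
    have := ((hasDerivAt_id z).sub (Real.hasDerivAt_log hz.ne')).sub_const 1
    rw [Real.rpow_neg_one]
    exact this)
  set R := max R₀ (2 * L)
  have h := H R (le_max_left _ _) t ht
  have hR2 : 2 * L ≤ R := le_max_right _ _
  have h2 := S.ent_init hδ (Φ := lg) (fun z _ => le_rfl) lg_cont (hR₀.trans (le_max_left R₀ (2 * L)))
  simp only [sub_self, Real.rpow_zero, zero_mul, zero_div, mul_zero,
    intervalIntegral.integral_zero, add_zero] at h
  have ce := S.fent lg_cont (g := fun x => x) (h := fun _ => t) continuous_id continuous_const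
  have e0 := fun x => S.ent_nonneg (Φ := lg) log_nonneg x t
  have w1 := int_le_weight ce e0 (by linarith) hR2
  have w2 := int_le_weight2 (f := S.diss 1) (by fun_prop) (S.diss_nonneg hα zero_le_one) (by linarith) ht.1 hR2
  have n1 : 0 ≤ ∫ x in (-R)..R, ph R x ^ 2 * S.ent lg x t := int_nonneg (by linarith) fun x =>
    mul_nonneg (sq_nonneg _) (e0 x)
  have n2 : 0 ≤ ∫ s in (0 : ℝ)..t, ∫ x in (-R)..R, ph R x ^ 2 * S.diss 1 x s := int_nonneg ht.1 fun s =>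
    int_nonneg (by linarith) fun x => mul_nonneg (sq_nonneg _) (S.diss_nonneg hα zero_le_one x s)
  change _ ≤ (∫ x in (-R)..R, ph R x ^ 2 * S.ent lg x 0) + 1 at h
  constructor <;> linarith

/-- Energy bounds on arbitrary intervals. -/
theorem energy_int (hα : 0 ≤ α) (hT : 0 < T) (hδ : 0 < δ) :
    ∃ C, 0 < C ∧ ∀ S : Sol α β T K δ, ∀ t ∈ Icc 0 T, ∀ a b, a ≤ b →
      ∫ x in a..b, S.u x t ^ 2 ≤ C ∧ ∫ x in a..b, S.w 0 x t ^ 2 + S.w 1 x t ^ 2 ≤ C ∧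
      ∫ x in a..b, S.v x t * (S.b 0 x t ^ 2 + S.b 1 x t ^ 2) ≤ C ∧
      ∫ x in a..b, lg (S.v x t) ≤ C ∧ ∫ x in a..b, lg (S.θ x t) ≤ C ∧
      ∫ s in (0 : ℝ)..t, ∫ x in a..b, S.diss 1 x s ≤ C := by
  obtain ⟨C, hC, H⟩ := basic_energy (β := β) (K := K) hα hT hδ
  refine ⟨2 * C, by positivity, fun S t ht a b hab => ?_⟩
  have hL : 1 ≤ |a| + |b| + 1 := by linarith [abs_nonneg a, abs_nonneg b]
  obtain ⟨h1, h2⟩ := H S _ hL t ht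
  have a1 : -(|a| + |b| + 1) ≤ a := by linarith [neg_abs_le a, abs_nonneg b]
  have a2 : b ≤ |a| + |b| + 1 := by linarith [le_abs_self b, abs_nonneg a]
  have ce := S.fent lg_cont (g := fun x => x) (h := fun _ => t) continuous_id continuous_const
  have e0 := fun x => S.ent_nonneg (Φ := lg) log_nonneg x t
  have h3 : ∫ x in a..b, S.ent lg x t ≤ C := (int_subset ce e0 a1 hab a2).trans h1
  have key : ∀ f : ℝ → ℝ, Continuous f → (∀ x, f x ≤ 2 * S.ent lg x t) → ∫ x in a..b, f x ≤ 2 * C := by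
    intro f hf hle
    refine (int_le_one hf ce hab fun x _ => hle x).trans ?_
    linarith
  have pos : ∀ x, 0 ≤ S.v x t * (S.b 0 x t ^ 2 + S.b 1 x t ^ 2) := fun x =>
    mul_nonneg (S.v_pos x t).le (by positivity)
  have l1 := fun x => log_nonneg _ (S.v_pos x t)
  have l2 := fun x => log_nonneg _ (S.θ_pos x t)
  refine ⟨key _ (by fun_prop) fun x => ?_, key _ (by fun_prop) fun x => ?_,
    key _ (by fun_prop) fun x => ?_, key _ (by unfold lg; fun_prop (disch := simp)) fun x => ?_,
    key _ (by unfold lg; fun_prop (disch := simp)) fun x => ?_, ?_⟩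
  iterate 5
    · have := pos x; have := l1 x; have := l2 x
      unfold ent lg
      nlinarith [sq_nonneg (S.u x t), sq_nonneg (S.w 0 x t), sq_nonneg (S.w 1 x t)]
  · have : ∫ s in (0 : ℝ)..t, ∫ x in a..b, S.diss 1 x s ≤
        ∫ s in (0 : ℝ)..t, ∫ x in (-(|a| + |b| + 1))..(|a| + |b| + 1), S.diss 1 x s :=
      int_mono (cont_int (by fun_prop)) (cont_int (by fun_prop)) ht.1 fun s _ =>
        int_subset (by fun_prop) (fun x => S.diss_nonneg hα zero_le_one x s) a1 hab a2
    linarith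

/-- Total pressure. -/
def pr (x t : ℝ) : ℝ := S.θ x t / S.v x t + (S.b 0 x t ^ 2 + S.b 1 x t ^ 2) / 2

@[fun_prop] theorem fpr {X : Type*} [TopologicalSpace X] {g h : X → ℝ} (hg : Continuous g)
    (hh : Continuous h) : Continuous fun x => S.pr (g x) (h x) := by
  unfold pr; fun_prop (disch := simp)

theorem pr_nonneg (x t : ℝ) : 0 ≤ S.pr x t := by
  have := S.v_pos x t
  have := S.θ_pos x t
  unfold pr; positivity

/-- Total pressure integrated in time. -/
def gg (x t : ℝ) : ℝ := ∫ s in (0 : ℝ)..t, S.pr x s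

theorem gg_nonneg (x : ℝ) {t : ℝ} (ht : 0 ≤ t) : 0 ≤ S.gg x t := int_nonneg ht fun s => S.pr_nonneg x s

theorem gg_deriv (x t : ℝ) : HasDerivAt (S.gg x) (S.pr x t) t := by
  have c : Continuous fun s => S.pr x s := by fun_prop
  exact (c.integral_hasStrictDerivAt 0 t).hasDerivAt

/-- Primitive of the effective viscosity. -/
def Fv (α z : ℝ) : ℝ := Real.log z - z ^ (-α)

theorem Fv_deriv {z : ℝ} (hz : 0 < z) : HasDerivAt (Fv α) (mv α z) z := by
  refine ((Real.hasDerivAt_log hz.ne').fun_sub (Real.hasDerivAt_rpow_const (.inl hz.ne'))).congr_deriv ?_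
  unfold mv; ring

theorem Fv_le_log {z : ℝ} (hz : 0 < z) : Fv α z ≤ Real.log z := by
  have : 0 ≤ z ^ (-α) := by positivity
  unfold Fv; linarith

theorem Fv_ge (hα : 0 ≤ α) {c z : ℝ} (hc : 0 < c) (h : c ≤ z) : Real.log z - c ^ (-α) ≤ Fv α z := by
  have := Real.rpow_le_rpow_of_nonpos hc h (by linarith : -α ≤ 0)
  unfold Fv; linarith

@[fun_prop] theorem fFv {X : Type*} [TopologicalSpace X] {g h : X → ℝ} (hg : Continuous g)
    (hh : Continuous h) : Continuous fun x => Fv α (S.v (g x) (h x)) := by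
  unfold Fv; fun_prop (disch := simp)

/-- Combination of specific volume and pressure that oscillates little in space. -/
def G (x t : ℝ) : ℝ := Fv α (S.v x t) - Fv α (S.v x 0) - S.gg x t

@[fun_prop] theorem fgg {X : Type*} [TopologicalSpace X] {h : X → ℝ} (x : ℝ)
    (hh : Continuous h) : Continuous fun y => S.gg x (h y) := by
  have : Continuous (S.gg x) := continuous_iff_continuousAt.2 fun t => (S.gg_deriv x t).continuousAt
  exact this.comp hh

theorem G_cont (x : ℝ) : Continuous (S.G x) := by unfold G; fun_prop

theorem stress_deriv (x t : ℝ) : HasDerivAt (fun y => mv α (S.v y t) * S.ux y t - S.pr y t)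
    (S.ut x t) x := by
  have hv0 := S.v_ne x t
  have h := ((dmv (α := α) (v := fun y => S.v y t) (vx := fun y => S.vx y t) (S.v_pos x t) (S.dv x t)).fun_mul (S.dux x t)).fun_sub
    (((S.dθ x t).fun_div (S.dv x t) hv0).fun_add
      ((((S.db 0 x t).fun_pow 2).fun_add ((S.db 1 x t).fun_pow 2)).div_const 2))
  refine h.congr_deriv ?_
  rw [S.eq_u]
  push_cast
  field_simp
  ring

theorem G_sub (a x : ℝ) {t : ℝ} (ht : t ∈ Icc 0 T) :
    S.G x t - S.G a t = ∫ y in a..x, (S.u y t - S.u y 0) := by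
  have e : ∀ y, S.G y t = ∫ s in (0 : ℝ)..t, (mv α (S.v y s) * S.ux y s - S.pr y s) := by
    intro y
    have := time_ftc_pt (T := T) (f := fun s => Fv α (S.v y s) - S.gg y s)
      (ft := fun s => mv α (S.v y s) * S.ux y s - S.pr y s) (by fun_prop) (by fun_prop)
      (fun s hs => ((Fv_deriv (S.v_pos y s)).comp s (S.dvt y s hs)).sub (S.gg_deriv y s)) le_rfl ht.1 ht.2
    rw [this]
    simp [G, gg]; ring
  rw [e, e, ← int_sub (by fun_prop) (by fun_prop)]
  have e1 : ∀ s, (mv α (S.v x s) * S.ux x s - S.pr x s) - (mv α (S.v a s) * S.ux a s - S.pr a s)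
      = ∫ y in a..x, S.ut y s := fun s => (intervalIntegral.integral_eq_sub_of_hasDerivAt
        (fun y _ => S.stress_deriv y s)
        ((by fun_prop : Continuous fun y => S.ut y s).intervalIntegrable _ _)).symm
  simp only [e1]
  rw [← int_swap (f := fun y s => S.ut y s) (by fun_prop)]
  congr 1; ext y
  exact time_ftc_pt (T := T) (f := S.u y) (by fun_prop) (by fun_prop) (S.dut y) le_rfl ht.1 ht.2

theorem exp_gg (x t : ℝ) : Real.exp (S.gg x t) = 1 + ∫ s in (0 : ℝ)..t, S.pr x s * Real.exp (S.gg x s) := by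
  rw [intervalIntegral.integral_eq_sub_of_hasDerivAt (f := fun s => Real.exp (S.gg x s))
    (fun s _ => ((S.gg_deriv x s).exp).congr_deriv (mul_comm _ _))
    ((by fun_prop : Continuous fun s => S.pr x s * Real.exp (S.gg x s)).intervalIntegrable _ _)]
  simp [gg]

/-- Bounds for the specific volume in terms of the integrated pressure. -/
theorem v_bounds (hα : 0 ≤ α) (hT : 0 < T) (hδ : 0 < δ) :
    ∃ c C, 0 < c ∧ 0 < C ∧ ∀ S : Sol α β T K δ, ∀ x, ∀ t ∈ Icc 0 T,
      c ≤ S.v x t ∧ Real.log (S.v x t) ≤ C + S.gg x t := by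
  obtain ⟨E, hE, H⟩ := energy_int (β := β) (K := K) hα hT hδ
  set c₀ := 1 + 2 * K ^ 2 + |Real.log δ| + δ ^ (-α) with hc₀
  set c₁ := 1 + E with hc₁
  set M := Real.exp (c₀ + c₁) with hM
  set D := M * (3 * E + 2) with hD
  have M0 : 0 < M := Real.exp_pos _
  set c₄ := E + D with hc₄
  set c₅ := 1 + c₄ + Real.exp (-1 - c₄) ^ (-α) with hc₅
  set c₆ := Real.exp (c₅ + c₁ + c₀) * (1 + c₄) with hc₆
  have D0 : 0 < D := by positivity
  have p4 : 0 < c₄ := by positivity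
  have p6 : 0 < c₆ := by positivity
  set c₇ := c₆ * Real.exp (c₆ * T) with hc₇
  have p7 : 0 < c₇ := by positivity
  set c := Real.exp (-Real.log c₇ - c₀) with hc
  have pc : 0 < c := Real.exp_pos _
  refine ⟨c, |Real.log ((2 * E + 2) * M)| + c₀ + c ^ (-α), pc, ?_, ?_⟩
  · have : 0 ≤ δ ^ (-α) := by positivity
    positivity
  intro S a t ht
  have hF0 : ∀ x, |Fv α (S.v x 0)| ≤ c₀ := by
    intro x
    have h1 := S.v_init_le x
    have h2 := S.v_init x
    have h3 := Real.log_le_sub_one_of_pos (S.v_pos x 0)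
    have h4 := Real.log_le_log hδ h2
    have h5 := Fv_le_log (α := α) (S.v_pos x 0)
    have h6 := Fv_ge hα hδ h2
    have h7 := neg_abs_le (Real.log δ)
    have h8 : 0 ≤ δ ^ (-α) := by positivity
    have h9 := abs_nonneg (Real.log δ)
    rw [abs_le]; constructor <;> nlinarith [sq_nonneg K]
  have osc : ∀ s ∈ Icc 0 T, ∀ x ∈ Icc a (a + 1), |S.G x s - S.G a s| ≤ c₁ := by
    intro s hs x hx
    rw [S.G_sub a x hs]
    obtain ⟨h1, -⟩ := H S s hs a x hx.1
    obtain ⟨h2, -⟩ := H S 0 ⟨le_rfl, hT.le⟩ a x hx.1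
    have h3 := int_le_two (f := fun y => |S.u y s - S.u y 0|) (g₁ := fun _ => 1)
      (g₂ := fun y => S.u y s ^ 2 + S.u y 0 ^ 2) (c₁ := 1) (c₂ := 1 / 2)
      (by fun_prop) (by fun_prop) (by fun_prop) hx.1
      (fun y _ => abs_le.2 ⟨by nlinarith [sq_nonneg (S.u y s + 1), sq_nonneg (S.u y 0 - 1)],
        by nlinarith [sq_nonneg (S.u y s - 1), sq_nonneg (S.u y 0 + 1)]⟩)
    rw [int_add (by fun_prop) (by fun_prop)] at h3
    have h4 := intervalIntegral.abs_integral_le_integral_abs (f := fun y => S.u y s - S.u y 0) (μ := volume) hx.1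
    simp only [intervalIntegral.integral_const, smul_eq_mul] at h3
    linarith [hx.2]
  have up : ∀ s ∈ Icc 0 T, Real.exp (S.G a s) ≤ (2 * E + 2) * M := by
    intro s hs
    obtain ⟨-, -, -, h1, -⟩ := H S s hs a (a + 1) (by linarith)
    have h2 := int_le_two (f := fun y => Real.exp (S.G a s - c₀ - c₁)) (g₁ := fun y => lg (S.v y s))
      (g₂ := fun _ => 1) (c₁ := 2) (c₂ := 2) (by fun_prop) (by unfold lg; fun_prop (disch := simp))
      (by fun_prop) (by linarith : a ≤ a + 1) (fun y hy => by
        have k1 := log_ge _ (S.v_pos y s)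
        have k2 := abs_le.1 (osc s hs y hy)
        have k3 := abs_le.1 (hF0 y)
        have k4 := Fv_le_log (α := α) (S.v_pos y s)
        have k5 := S.gg_nonneg y hs.1
        have k6 : Fv α (S.v y s) = S.G y s + Fv α (S.v y 0) + S.gg y s := by unfold G; ring
        have k7 : Real.exp (S.G a s - c₀ - c₁) ≤ S.v y s := by
          rw [← Real.le_log_iff_exp_le (S.v_pos y s)]; linarith
        unfold lg; linarith)
    simp only [intervalIntegral.integral_const, smul_eq_mul] at h2
    have h3 : Real.exp (S.G a s) = Real.exp (S.G a s - c₀ - c₁) * M := by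
      rw [hM, ← Real.exp_add]; ring_nf
    rw [h3]
    gcongr
    linarith
  have cG : Continuous (S.G a) := S.G_cont a
  have gr : ∀ s ∈ Icc 0 T, Real.exp (-S.G a s) ≤ c₆ + ∫ r in (0 : ℝ)..s, c₆ * Real.exp (-S.G a r) := by
    intro s hs
    set B := 1 + ∫ r in (0 : ℝ)..s, Real.exp (-S.G a r) with hB
    have B1 : 1 ≤ B := by
      have : 0 ≤ ∫ r in (0 : ℝ)..s, Real.exp (-S.G a r) := int_nonneg hs.1 fun r => (Real.exp_pos _).le
      linarith
    set Z : ℝ → ℝ := fun x => ∫ r in (0 : ℝ)..s, (S.θ x r + 1 / 2 * (S.v x r * (S.b 0 x r ^ 2 + S.b 1 x r ^ 2))) *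
      (M * Real.exp (-S.G a r)) with hZ
    have cZ : Continuous Z := cont_int (f := fun r x => (S.θ x r + 1 / 2 * (S.v x r * (S.b 0 x r ^ 2 + S.b 1 x r ^ 2))) *
      (M * Real.exp (-S.G a r))) (by fun_prop)
    have Zle : ∀ x ∈ Icc a (a + 1), Real.exp (S.gg x s) ≤ 1 + Z x := by
      intro x hx
      rw [S.exp_gg, hZ]
      gcongr 1 + ?_
      refine int_mono (by fun_prop) (by fun_prop) hs.1 fun r hr => ?_
      have hr' : r ∈ Icc 0 T := ⟨hr.1, hr.2.trans hs.2⟩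
      have k2 := abs_le.1 (osc r hr' x hx)
      have k3 := abs_le.1 (hF0 x)
      have k4 := Fv_le_log (α := α) (S.v_pos x r)
      have k6 : S.gg x r = Fv α (S.v x r) - S.G x r - Fv α (S.v x 0) := by unfold G; ring
      have k7 : Real.exp (S.gg x r) ≤ S.v x r * (M * Real.exp (-S.G a r)) := by
        rw [← Real.log_le_log_iff (Real.exp_pos _) (by have := S.v_pos x r; positivity), Real.log_exp,
          Real.log_mul (S.v_ne _ _) (by positivity), Real.log_mul M0.ne' (by positivity), Real.log_exp,
          Real.log_exp]
        linarith
      calc S.pr x r * Real.exp (S.gg x r) ≤ S.pr x r * (S.v x r * (M * Real.exp (-S.G a r))) :=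
            mul_le_mul_of_nonneg_left k7 (S.pr_nonneg x r)
        _ = _ := by
            have := S.v_ne x r
            unfold pr; field_simp
    have IZ : ∫ x in a..(a + 1), Z x ≤ D * B := by
      rw [hZ, int_swap (f := fun x r => (S.θ x r + 1 / 2 * (S.v x r * (S.b 0 x r ^ 2 + S.b 1 x r ^ 2))) *
        (M * Real.exp (-S.G a r))) (by fun_prop)]
      have : ∫ r in (0 : ℝ)..s, ∫ x in a..(a + 1), (S.θ x r + 1 / 2 * (S.v x r * (S.b 0 x r ^ 2 + S.b 1 x r ^ 2))) *
          (M * Real.exp (-S.G a r)) ≤ D * ∫ r in (0 : ℝ)..s, Real.exp (-S.G a r) := by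
        refine int_le_one (cont_int (by fun_prop)) (by fun_prop) hs.1 fun r hr => ?_
        have hr' : r ∈ Icc 0 T := ⟨hr.1, hr.2.trans hs.2⟩
        obtain ⟨-, -, h1, -, h2, -⟩ := H S r hr' a (a + 1) (by linarith)
        rw [intervalIntegral.integral_mul_const, hD]
        have h3 := int_le_three (f := fun x => S.θ x r + 1 / 2 * (S.v x r * (S.b 0 x r ^ 2 + S.b 1 x r ^ 2)))
          (g₁ := fun x => lg (S.θ x r)) (g₂ := fun x => S.v x r * (S.b 0 x r ^ 2 + S.b 1 x r ^ 2))
          (g₃ := fun _ => 1) (c₁ := 2) (c₂ := 1 / 2) (c₃ := 2) (by fun_prop)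
          (by unfold lg; fun_prop (disch := simp)) (by fun_prop) (by fun_prop) (by linarith : a ≤ a + 1)
          (fun x _ => by
            have := log_ge _ (S.θ_pos x r)
            unfold lg; linarith)
        simp only [intervalIntegral.integral_const, smul_eq_mul] at h3
        have h4 : ∫ x in a..(a + 1), (S.θ x r + 1 / 2 * (S.v x r * (S.b 0 x r ^ 2 + S.b 1 x r ^ 2))) ≤ 3 * E + 2 := by
          linarith
        calc _ ≤ (3 * E + 2) * (M * Real.exp (-S.G a r)) := by gcongr
          _ = _ := by ring
      rw [hB]; linarith
    obtain ⟨x, hx, hle⟩ := exists_le_int (f := fun x => lg (S.v x s) + B⁻¹ * Z x)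
      (by unfold lg; fun_prop (disch := simp)) a
    obtain ⟨-, -, -, h1, -⟩ := H S s hs a (a + 1) (by linarith)
    rw [int_add (by unfold lg; fun_prop (disch := simp)) (by fun_prop), intervalIntegral.integral_const_mul] at hle
    have Bp : 0 < B := by linarith
    have h2 : B⁻¹ * ∫ x in a..(a + 1), Z x ≤ D := by
      rw [inv_mul_le_iff₀ Bp]; linarith
    have h3 : 0 ≤ lg (S.v x s) := log_nonneg _ (S.v_pos x s)
    have Z0 : 0 ≤ Z x := by
      have := Zle x hx
      have := Real.one_le_exp (S.gg_nonneg x hs.1)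
      linarith
    have h4 : 0 ≤ B⁻¹ * Z x := by positivity
    have h5 : lg (S.v x s) ≤ c₄ := by linarith
    have h6 : Z x ≤ c₄ * B := by
      have : B⁻¹ * Z x ≤ c₄ := by linarith
      rwa [inv_mul_le_iff₀ Bp, mul_comm] at this
    have h7 : -1 - c₄ ≤ Real.log (S.v x s) := by
      have := S.v_pos x s
      unfold lg at h5; linarith
    have h8 := Fv_ge hα (Real.exp_pos _) ((Real.le_log_iff_exp_le (S.v_pos x s)).1 h7)
    have k2 := abs_le.1 (osc s hs x hx)
    have k3 := abs_le.1 (hF0 x)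
    have k6 : S.gg x s = Fv α (S.v x s) - S.G x s - Fv α (S.v x 0) := by unfold G; ring
    have k8 : Real.exp (-S.G a s) ≤ Real.exp (c₅ + c₁ + c₀) * Real.exp (S.gg x s) := by
      rw [← Real.exp_add]
      apply Real.exp_le_exp.2
      linarith
    rw [intervalIntegral.integral_const_mul]
    calc _ ≤ Real.exp (c₅ + c₁ + c₀) * ((1 + c₄) * B) := by
          refine k8.trans ?_
          gcongr
          have := Zle x hx
          linarith
      _ = _ := by rw [hc₆, hB]; ring
  have g2 := gronwall (by fun_prop) continuous_const (fun _ => p6.le) gr ht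
  have g3 : Real.exp (-S.G a t) ≤ c₇ := by
    refine (gr t ht).trans (g2.trans ?_)
    simp only [intervalIntegral.integral_const, smul_eq_mul]
    rw [hc₇]
    gcongr ?_ * Real.exp ?_
    nlinarith [ht.2]
  have k3 := abs_le.1 (hF0 a)
  have k5 := S.gg_nonneg a ht.1
  have k6 : S.gg a t = Fv α (S.v a t) - S.G a t - Fv α (S.v a 0) := by unfold G; ring
  have k4 := Fv_le_log (α := α) (S.v_pos a t)
  have l1 : c ≤ S.v a t := by
    rw [hc, ← Real.le_log_iff_exp_le (S.v_pos a t)]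
    have := (Real.le_log_iff_exp_le p7).2 g3
    linarith
  refine ⟨l1, ?_⟩
  have k7 := Fv_ge hα pc l1
  have k8 := (Real.le_log_iff_exp_le (by positivity)).2 (up t ht)
  have k9 := le_abs_self (Real.log ((2 * E + 2) * M))
  linarith

end Sol

/-- Second derivative test at a local minimum. -/
theorem second_nonneg_of_isLocalMin {f fx : ℝ → ℝ} {fxx x : ℝ} (hf : ∀ y, HasDerivAt f (fx y) y)
    (hfx : HasDerivAt fx fxx x) (hm : IsLocalMin f x) : 0 ≤ fxx := by
  by_contra! hneg
  have e : deriv f = fx := funext fun y => (hf y).deriv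
  have h0 : deriv f x = 0 := hm.deriv_eq_zero
  have h1 : IsLocalMax f x := isLocalMax_of_deriv_deriv_neg (by rw [e, hfx.deriv]; exact hneg) h0
    (hf x).continuousAt
  have h2 : f =ᶠ[nhds x] fun _ => f x := by
    filter_upwards [hm, h1] with y a b using le_antisymm b a
  have h3 : fx =ᶠ[nhds x] fun _ => 0 := by
    filter_upwards [h2.eventually_nhds] with y hy
    exact (hf y).unique ((hasDerivAt_const y (f x)).congr_of_eventuallyEq hy)
  have h4 := hfx.unique ((hasDerivAt_const x (0 : ℝ)).congr_of_eventuallyEq h3)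
  linarith

/-- The derivative at a maximum attained at the right end point is nonnegative. -/
theorem deriv_nonneg_of_left_max {f : ℝ → ℝ} {f' t : ℝ} (hf : HasDerivAt f f' t) (h0 : 0 < t)
    (hm : ∀ s ∈ Icc 0 t, f s ≤ f t) : 0 ≤ f' := by
  have h1 := (hasDerivAt_iff_tendsto_slope.1 hf).mono_left (nhdsWithin_mono t (fun s (hs : s ∈ Iio t) => hs.ne))
  refine ge_of_tendsto h1 ?_
  filter_upwards [Ioo_mem_nhdsLT h0] with s hs
  rw [slope_def_field]
  exact div_nonneg_of_nonpos (by linarith [hm s ⟨hs.1.le, hs.2.le⟩]) (by linarith [hs.2])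

namespace Sol

variable {α β T K δ : ℝ} (S : Sol α β T K δ)

/-- Lower bound for the temperature (maximum principle for `1 / θ`). -/
theorem θ_bound (hα : 0 ≤ α) (hT : 0 < T) (hδ : 0 < δ) :
    ∃ c, 0 < c ∧ ∀ S : Sol α β T K δ, ∀ x, ∀ t ∈ Icc 0 T, c ≤ S.θ x t := by
  obtain ⟨c, _, hc, _, H⟩ := v_bounds (β := β) (K := K) hα hT hδ
  set B := 1 / (2 * c) with hB
  have B0 : 0 < B := by positivity
  have key : ∀ S : Sol α β T K δ, ∀ x, ∀ t ∈ Ico 0 T, (S.θ x t)⁻¹ - B * t ≤ 2 + δ⁻¹ := by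
    intro S x₁ t₁ ht₁
    by_contra! hbig
    obtain ⟨X₀, hX₀⟩ := S.far (1 / 2) (by norm_num)
    set X := max X₀ (|x₁|) with hX
    obtain ⟨⟨xm, tm⟩, ⟨hxm, htm⟩, hmax⟩ := ((isCompact_Icc (a := -X) (b := X)).prod
      (isCompact_Icc (a := 0) (b := t₁))).exists_isMaxOn
      ⟨(x₁, t₁), abs_le.1 (le_max_right _ _), ⟨ht₁.1, le_rfl⟩⟩
      (f := fun p : ℝ × ℝ => (S.θ p.1 p.2)⁻¹ - B * p.2) (by
        have : Continuous fun p : ℝ × ℝ => (S.θ p.1 p.2)⁻¹ - B * p.2 := by fun_prop (disch := simp)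
        exact this.continuousOn)
    have hmax' : ∀ x t, x ∈ Icc (-X) X → t ∈ Icc 0 t₁ → (S.θ x t)⁻¹ - B * t ≤ (S.θ xm tm)⁻¹ - B * tm :=
      fun x t hx ht => hmax (a := (x, t)) ⟨hx, ht⟩
    have h1 := hmax' x₁ t₁ (abs_le.1 (le_max_right _ _)) ⟨ht₁.1, le_rfl⟩
    have δi : 0 < δ⁻¹ := by positivity
    have hxlt : |xm| < X := by
      by_contra! hge
      have := (abs_lt.1 (hX₀ xm tm ((le_max_left _ _).trans hge)).2.2.1).1
      have h2 : (S.θ xm tm)⁻¹ ≤ 2 := by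
        rw [inv_le_comm₀ (S.θ_pos _ _) two_pos]; linarith
      nlinarith [htm.1]
    have htpos : 0 < tm := by
      rcases htm.1.eq_or_lt with h | h
      · exfalso
        have h : tm = 0 := h.symm
        subst h
        have : (S.θ xm 0)⁻¹ ≤ δ⁻¹ := inv_anti₀ hδ (S.θ_init xm)
        linarith
      · exact h
    have htT : tm ∈ Ioo 0 T := ⟨htpos, htm.2.trans_lt ht₁.2⟩
    have hmin : IsLocalMin (fun y => S.θ y tm) xm := by
      filter_upwards [Icc_mem_nhds (abs_lt.1 hxlt).1 (abs_lt.1 hxlt).2] with y hy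
      have := hmax' y tm hy htm
      have : (S.θ y tm)⁻¹ ≤ (S.θ xm tm)⁻¹ := by linarith
      rwa [inv_le_inv₀ (S.θ_pos _ _) (S.θ_pos _ _)] at this
    have hx0 : S.θx xm tm = 0 := hmin.hasDerivAt_eq_zero (S.dθ xm tm)
    have hxx : 0 ≤ S.θxx xm tm :=
      second_nonneg_of_isLocalMin (fun y => S.dθ y tm) (S.dθx xm tm) hmin
    have hd := ((S.dθt xm tm htT).fun_inv (S.θ_ne xm tm)).fun_sub ((hasDerivAt_id tm).const_mul B)
    have h2 := deriv_nonneg_of_left_max hd htpos fun s hs =>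
      hmax' xm s hxm ⟨hs.1, hs.2.trans htm.2⟩
    have hθ := S.θ_pos xm tm
    have hv := S.v_pos xm tm
    have hcv := (H S xm tm ⟨htpos.le, htT.2.le⟩).1
    have heq := S.eq_θ xm tm
    rw [hx0] at heq
    have h3 : S.θt xm tm ≤ -B * S.θ xm tm ^ 2 := by
      have : B ≤ -S.θt xm tm / S.θ xm tm ^ 2 := by linarith
      rw [le_div_iff₀ (by positivity)] at this
      linarith
    have h4 : 1 ≤ mv α (S.v xm tm) * S.v xm tm := by
      have := mv_ge hα hv
      calc 1 = (S.v xm tm)⁻¹ * S.v xm tm := by field_simp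
        _ ≤ _ := by gcongr
    have h5 : 0 ≤ S.θ xm tm ^ β * S.θxx xm tm := by positivity
    have h6 : S.v xm tm * S.θt xm tm = S.θ xm tm ^ β * S.θxx xm tm - S.θ xm tm * S.ux xm tm
        + (mv α (S.v xm tm) * S.v xm tm * S.ux xm tm ^ 2 + (S.wx 0 xm tm ^ 2 + S.wx 1 xm tm ^ 2)
        + (S.bx 0 xm tm ^ 2 + S.bx 1 xm tm ^ 2)) := by
      rw [zero_pow two_ne_zero] at heq
      simp only [mul_zero, zero_mul, zero_div, add_zero, sub_zero] at heq
      field_simp at heq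
      linarith
    have h7 : S.ux xm tm ^ 2 ≤ mv α (S.v xm tm) * S.v xm tm * S.ux xm tm ^ 2 :=
      le_mul_of_one_le_left (sq_nonneg _) h4
    have h8 : S.v xm tm * S.θt xm tm ≤ S.v xm tm * (-B * S.θ xm tm ^ 2) := by gcongr
    have h9 : 1 / 2 ≤ S.v xm tm * B := by
      rw [hB]; rw [mul_one_div, le_div_iff₀ (by positivity)]; linarith
    nlinarith [sq_nonneg (2 * S.ux xm tm - S.θ xm tm), sq_nonneg (S.wx 0 xm tm), sq_nonneg (S.wx 1 xm tm),
      sq_nonneg (S.bx 0 xm tm), sq_nonneg (S.bx 1 xm tm), mul_le_mul_of_nonneg_right h9 (sq_nonneg (S.θ xm tm)),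
      pow_pos hθ 2]
  have dp : 0 < 2 + δ⁻¹ + B * T := by positivity
  refine ⟨(2 + δ⁻¹ + B * T)⁻¹, by positivity, fun S x t ht => ?_⟩
  have cl : IsClosed {t | (2 + δ⁻¹ + B * T)⁻¹ ≤ S.θ x t} :=
    isClosed_le continuous_const (by fun_prop)
  have sub : Ico 0 T ⊆ {t | (2 + δ⁻¹ + B * T)⁻¹ ≤ S.θ x t} := fun s hs => by
    have := key S x s hs
    simp only [mem_ofPred_eq]
    rw [inv_le_comm₀ dp (S.θ_pos _ _)]
    nlinarith [hs.2]
  rw [← closure_Ico hT.ne] at ht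
  exact closure_minimal sub cl ht

end Sol

theorem sq_le_lg {z : ℝ} (hz : 0 < z) : (z - 1) ^ 2 ≤ 2 * (1 + z) * (z - Real.log z - 1) := by
  have hs : 0 < √z := Real.sqrt_pos.2 hz
  have h1 := Real.log_le_sub_one_of_pos hs
  rw [Real.log_sqrt hz.le] at h1
  have h2 : √z ^ 2 = z := Real.sq_sqrt hz.le
  have h3 : (√z - 1) ^ 2 ≤ z - Real.log z - 1 := by nlinarith
  have h4 : (√z + 1) ^ 2 ≤ 2 * (1 + z) := by nlinarith [sq_nonneg (√z - 1)]
  calc (z - 1) ^ 2 = (√z + 1) ^ 2 * (√z - 1) ^ 2 := by nlinarith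
    _ ≤ _ := by gcongr

theorem rpow_sq_le_lg {p z : ℝ} (h0 : 0 ≤ p) (h1 : p ≤ 1) (hz : 0 < z) :
    (z ^ (1 - p) - 1) ^ 2 * z ^ p ≤ 4 * (z - Real.log z - 1) * (1 + z ^ (1 - p)) := by
  have hl := Sol.log_nonneg z hz
  have hq := sq_le_lg hz
  have e : z ^ (1 - p) * z ^ p = z := by rw [← Real.rpow_add hz]; simp
  have hp : 0 < z ^ p := by positivity
  have hp1 : 0 < z ^ (1 - p) := by positivity
  rcases le_total 1 z with h | h
  · have a1 : 1 ≤ z ^ p := Real.one_le_rpow h h0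
    have a2 : 1 ≤ z ^ (1 - p) := Real.one_le_rpow h (by linarith)
    have a3 : (z ^ (1 - p) - 1) * z ^ p ≤ z - 1 := by nlinarith
    have a4 : z * (z ^ (1 - p) - 1) ≤ z ^ (1 - p) * (z - 1) := by
      have : z ^ (1 - p) ≤ z := by nlinarith
      linarith
    have a5 : z * ((z ^ (1 - p) - 1) ^ 2 * z ^ p) ≤ z ^ (1 - p) * (z - 1) ^ 2 := by
      calc _ = (z * (z ^ (1 - p) - 1)) * ((z ^ (1 - p) - 1) * z ^ p) := by ring
        _ ≤ (z ^ (1 - p) * (z - 1)) * (z - 1) := by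
          apply mul_le_mul a4 a3 <;> apply mul_nonneg <;> linarith
        _ = _ := by ring
    have a6 : (z - 1) ^ 2 ≤ z * (4 * (z - Real.log z - 1)) := by nlinarith
    have a7 : z * ((z ^ (1 - p) - 1) ^ 2 * z ^ p) ≤ z * (4 * (z - Real.log z - 1) * z ^ (1 - p)) := by
      calc _ ≤ z ^ (1 - p) * (z - 1) ^ 2 := a5
        _ ≤ z ^ (1 - p) * (z * (4 * (z - Real.log z - 1))) := by gcongr
        _ = _ := by ring
    have a8 := le_of_mul_le_mul_left a7 hz
    linarith
  · have a1 : z ^ p ≤ 1 := Real.rpow_le_one hz.le h h0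
    have a2 : z ^ (1 - p) ≤ 1 := Real.rpow_le_one hz.le h (by linarith)
    have a3 : z ≤ z ^ (1 - p) := by nlinarith
    have a4 : (z ^ (1 - p) - 1) ^ 2 ≤ (z - 1) ^ 2 := by nlinarith
    have a5 : 0 ≤ (z - Real.log z - 1) * z ^ (1 - p) := by positivity
    have a6 : (z ^ (1 - p) - 1) ^ 2 * z ^ p ≤ (z ^ (1 - p) - 1) ^ 2 := mul_le_of_le_one_right (sq_nonneg _) a1
    nlinarith

/-- The exponent used in the improved entropy estimate. -/
def pp (β : ℝ) : ℝ := min β 1 / 2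

theorem pp_pos {β : ℝ} (hβ : 0 < β) : 0 < pp β := by unfold pp; positivity
theorem pp_le (β : ℝ) : pp β ≤ 1 / 2 := by
  have := min_le_right β 1
  unfold pp; linarith
theorem pp_le' (β : ℝ) : 2 * pp β ≤ β := by
  have := min_le_left β 1
  unfold pp; linarith

/-- The entropy with derivative `1 - z ^ (-p)`. -/
def en (p z : ℝ) : ℝ := z - 1 - (z ^ (1 - p) - 1) / (1 - p)

theorem en_deriv {p z : ℝ} (hp : p < 1) (hz : 0 < z) : HasDerivAt (en p) (1 - z ^ (-p)) z := by
  have h := ((hasDerivAt_id z).sub_const 1).fun_sub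
    (((Real.hasDerivAt_rpow_const (p := 1 - p) (.inl hz.ne')).sub_const 1).div_const (1 - p))
  refine h.congr_deriv ?_
  have : 1 - p ≠ 0 := by linarith
  have e : 1 - p - 1 = -p := by ring
  rw [e]; field_simp

theorem en_nonneg {p : ℝ} (h0 : 0 ≤ p) (h1 : p < 1) {z : ℝ} (hz : 0 < z) : 0 ≤ en p z := by
  have h := rpow_one_add_le_one_add_mul_self (by linarith : -1 ≤ z - 1) (by linarith : 0 ≤ 1 - p) (by linarith)
  have e : 1 + (z - 1) = z := by ring
  rw [e] at h
  unfold en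
  have : (z ^ (1 - p) - 1) / (1 - p) ≤ z - 1 := by
    rw [div_le_iff₀ (by linarith)]; linarith
  linarith

theorem en_le {p : ℝ} (h1 : p < 1) {z : ℝ} (hz : 0 < z) : en p z ≤ z - Real.log z - 1 := by
  have h := Real.add_one_le_exp (Real.log z * (1 - p))
  rw [← Real.rpow_def_of_pos hz] at h
  have : Real.log z ≤ (z ^ (1 - p) - 1) / (1 - p) := by
    rw [le_div_iff₀ (by linarith)]; linarith
  unfold en; linarith

/-- Every point has a unit interval towards the origin where the weight is comparable. -/
theorem ph_inward {R x : ℝ} (hR : 2 ≤ R) (hx : x ∈ Icc (-R) R) :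
    ∃ a, -R ≤ a ∧ a + 1 ≤ R ∧ x ∈ Icc a (a + 1) ∧ ∀ y ∈ Icc a (a + 1), ph R x ^ 2 ≤ 2 * ph R y ^ 2 := by
  have hR0 : 0 < R := by linarith
  have main : ∀ y, y ^ 2 ≤ max (x ^ 2) 1 → ph R x ^ 2 ≤ 2 * ph R y ^ 2 := by
    intro y hy
    obtain ⟨p0, p1⟩ := ph_mem hR0 hx
    rcases le_total (x ^ 2) 1 with h | h
    · rw [max_eq_right h] at hy
      have : (3 : ℝ) / 4 ≤ ph R y := by
        unfold ph
        have : (y / R) ^ 2 ≤ 1 / 4 := by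
          rw [div_pow, div_le_iff₀ (by positivity)]; nlinarith
        linarith
      nlinarith
    · rw [max_eq_left h] at hy
      have : ph R x ≤ ph R y := by
        unfold ph
        have : (y / R) ^ 2 ≤ (x / R) ^ 2 := by
          rw [div_pow, div_pow]; gcongr
        linarith
      nlinarith
  rcases le_total 0 x with h | h
  · refine ⟨x - 1, by linarith, by linarith [hx.2], ⟨by linarith, by linarith⟩, fun y hy => main y ?_⟩
    rcases le_total 0 y with h' | h'
    · exact le_max_of_le_left (by nlinarith [hy.2])
    · exact le_max_of_le_right (by nlinarith [hy.1])
  · refine ⟨x, hx.1, by linarith [hx.2], ⟨le_rfl, by linarith⟩, fun y hy => main y ?_⟩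
    rcases le_total 0 y with h' | h'
    · exact le_max_of_le_right (by nlinarith [hy.2])
    · exact le_max_of_le_left (by nlinarith [hy.1])

theorem abs_int_le {f : ℝ → ℝ} (cf : Continuous f) {a b x y : ℝ} (hx : x ∈ Icc a b) (hy : y ∈ Icc a b) :
    |∫ z in x..y, f z| ≤ ∫ z in a..b, |f z| := by
  rcases le_total x y with h | h
  · exact (intervalIntegral.abs_integral_le_integral_abs h).trans
      (int_subset (by fun_prop) (fun t => abs_nonneg _) hx.1 h hy.2)
  · rw [intervalIntegral.integral_symm, abs_neg]
    exact (intervalIntegral.abs_integral_le_integral_abs h).trans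
      (int_subset (by fun_prop) (fun t => abs_nonneg _) hy.1 h hx.2)

/-- Sup bound for a function on a unit interval by a weighted Dirichlet integral. -/
theorem sup_unit_weight {f fx k : ℝ → ℝ} (cfx : Continuous fx) (ck : Continuous k)
    (hk : ∀ x, 0 < k x) (hd : ∀ x, HasDerivAt f (fx x) x) {a x y : ℝ} (hx : x ∈ Icc a (a + 1))
    (hy : y ∈ Icc a (a + 1)) :
    f x ^ 2 ≤ 2 * f y ^ 2 + 2 * ((∫ z in a..(a + 1), fx z ^ 2 / k z) * ∫ z in a..(a + 1), k z) := by
  have ii : ∀ c d, IntervalIntegrable fx volume c d := cfx.intervalIntegrable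
  have e : f x - f y = ∫ z in y..x, fx z :=
    (intervalIntegral.integral_eq_sub_of_hasDerivAt (fun z _ => hd z) (ii y x)).symm
  have ck0 : ∀ x, √(k x) ≠ 0 := fun x => (Real.sqrt_pos.2 (hk x)).ne'
  have h1 : |f x - f y| ≤ ∫ z in a..(a + 1), |fx z| := by
    rw [e]
    exact abs_int_le cfx hy hx
  have h2 := int_cauchy_schwarz (f := fun z => |fx z| / √(k z)) (g := fun z => √(k z))
    (by fun_prop (disch := simp [ck0])) (by fun_prop) (by linarith : a ≤ a + 1)
  have e1 : ∀ z, |fx z| / √(k z) * √(k z) = |fx z| := fun z => div_mul_cancel₀ _ (ck0 z)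
  have e2 : ∀ z, (|fx z| / √(k z)) ^ 2 = fx z ^ 2 / k z := fun z => by
    rw [div_pow, sq_abs, Real.sq_sqrt (hk z).le]
  have e3 : ∀ z, √(k z) ^ 2 = k z := fun z => Real.sq_sqrt (hk z).le
  simp only [e1, e2, e3] at h2
  have h3 : (f x - f y) ^ 2 ≤ (∫ z in a..(a + 1), |fx z|) ^ 2 := sq_le_sq' (by linarith [neg_abs_le (f x - f y)])
    ((le_abs_self _).trans h1)
  nlinarith [sq_nonneg (f x - 2 * f y)]

namespace Sol

variable {α β T K δ : ℝ} (S : Sol α β T K δ)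

theorem Q_div_le_diss (x t : ℝ) : S.Q x t / S.v x t ≤ S.diss 0 x t := by
  unfold diss; simp

theorem θx_le_diss (hα : 0 ≤ α) {p : ℝ} (hp : 0 < p) (x t : ℝ) :
    S.θ x t ^ (β - 1 - p) * S.θx x t ^ 2 / S.v x t ≤ p⁻¹ * S.diss p x t := by
  have h1 := S.Q_nonneg hα x t
  have h2 := S.v_pos x t
  have h3 := S.θ_pos x t
  have h4 : 0 ≤ S.Q x t * S.θ x t ^ (-p) / S.v x t := by positivity
  have h5 : S.diss p x t = S.Q x t * S.θ x t ^ (-p) / S.v x t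
    + p * (S.θ x t ^ (β - 1 - p) * S.θx x t ^ 2 / S.v x t) := by unfold diss; ring
  rw [inv_mul_eq_div, le_div_iff₀ hp]
  linarith

theorem ux_le_diss (hα : 0 ≤ α) {p : ℝ} (hp : 0 ≤ p) (x t : ℝ) :
    S.ux x t ^ 2 * S.θ x t ^ (-p) / S.v x t ≤ S.diss p x t := by
  have h2 := S.v_pos x t
  have h3 := S.θ_pos x t
  have h4 : 0 ≤ p * S.θ x t ^ (β - 1 - p) * S.θx x t ^ 2 / S.v x t := by positivity
  have h5 : S.ux x t ^ 2 ≤ S.Q x t := by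
    have h6 : 1 ≤ mv α (S.v x t) * S.v x t := by
      have := mv_ge hα h2
      calc 1 = (S.v x t)⁻¹ * S.v x t := by field_simp
        _ ≤ _ := by gcongr
    have := le_mul_of_one_le_left (sq_nonneg (S.ux x t)) h6
    unfold Q; nlinarith [sq_nonneg (S.wx 0 x t), sq_nonneg (S.wx 1 x t), sq_nonneg (S.bx 0 x t), sq_nonneg (S.bx 1 x t)]
  have h7 : S.ux x t ^ 2 * S.θ x t ^ (-p) / S.v x t ≤ S.Q x t * S.θ x t ^ (-p) / S.v x t := by gcongr
  unfold diss; linarith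

/-- Pointwise bound of the temperature by the local dissipation. -/
theorem θ_sup (hα : 0 ≤ α) (hT : 0 < T) (hδ : 0 < δ) (hβ : 0 < β) :
    ∃ C, 0 < C ∧ ∀ S : Sol α β T K δ, ∀ t ∈ Icc 0 T, ∀ a, ∀ x ∈ Icc a (a + 1),
      S.θ x t ^ (β + 1 - pp β) ≤ C * (1 + ∫ y in a..(a + 1), S.diss (pp β) y t) := by
  obtain ⟨E, hE, H⟩ := energy_int (β := β) (K := K) hα hT hδ
  have hp := pp_pos hβ
  have hp2 := pp_le' β
  set p := pp β
  set κ := (β + 1 - p) / 2 with hκ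
  have κ0 : 0 < κ := by rw [hκ]; linarith
  set D := 2 * (2 * E + 2) ^ (β + 1 - p) + 2 * (κ ^ 2 * p⁻¹ * (2 * E + 2)) with hD
  refine ⟨D, by positivity, fun S t ht a x hx => ?_⟩
  obtain ⟨-, -, -, h1, h2, -⟩ := H S t ht a (a + 1) (by linarith)
  obtain ⟨y, hy, hle⟩ := exists_le_int (f := fun x => lg (S.θ x t)) (by unfold lg; fun_prop (disch := simp)) a
  have hy2 : S.θ y t ≤ 2 * E + 2 := by
    have := log_ge _ (S.θ_pos y t)
    unfold lg at *; linarith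
  have hs := sup_unit_weight (f := fun x => S.θ x t ^ κ) (fx := fun x => κ * S.θ x t ^ (κ - 1) * S.θx x t)
    (k := fun x => S.v x t) (by fun_prop) (by fun_prop) (fun x => S.v_pos x t)
    (fun x => ((S.dθ x t).rpow_const (.inl (S.θ_ne x t))).congr_deriv (by ring)) hx hy
  have sq : ∀ z (r : ℝ), (S.θ z t ^ r) ^ 2 = S.θ z t ^ (2 * r) := fun z r => by
    rw [pow_two, ← Real.rpow_add (S.θ_pos z t), two_mul]
  have e1 : 2 * κ = β + 1 - p := by rw [hκ]; ring
  have e2 : 2 * (κ - 1) = β - 1 - p := by rw [hκ]; ring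
  simp only [sq, mul_pow, e1, e2] at hs
  have h3 := int_le_one (f := fun z => κ ^ 2 * S.θ z t ^ (β - 1 - p) * S.θx z t ^ 2 / S.v z t)
    (g₁ := fun z => S.diss p z t) (c₁ := κ ^ 2 * p⁻¹) (by fun_prop (disch := simp)) (by fun_prop)
    (by linarith : a ≤ a + 1) (fun z _ => by
      have := mul_le_mul_of_nonneg_left (S.θx_le_diss hα hp z t) (sq_nonneg κ)
      calc _ = κ ^ 2 * (S.θ z t ^ (β - 1 - p) * S.θx z t ^ 2 / S.v z t) := by ring
        _ ≤ _ := this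
        _ = _ := by ring)
  have h4 := int_le_two (f := fun z => S.v z t) (g₁ := fun z => lg (S.v z t)) (g₂ := fun _ => 1) (c₁ := 2) (c₂ := 2)
    (by fun_prop) (by unfold lg; fun_prop (disch := simp)) (by fun_prop) (by linarith : a ≤ a + 1)
    (fun z _ => by
      have := log_ge _ (S.v_pos z t)
      unfold lg; linarith)
  simp only [intervalIntegral.integral_const, smul_eq_mul] at h4
  have h5 : 0 ≤ ∫ z in a..(a + 1), S.v z t := int_nonneg (by linarith) fun z => (S.v_pos z t).le
  have h6 : 0 ≤ ∫ z in a..(a + 1), S.diss p z t := int_nonneg (by linarith) fun z => S.diss_nonneg hα hp.le z t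
  have h7 : S.θ y t ^ (β + 1 - p) ≤ (2 * E + 2) ^ (β + 1 - p) :=
    Real.rpow_le_rpow (S.θ_pos y t).le hy2 (by linarith)
  set I := ∫ z in a..(a + 1), S.diss p z t with hI
  calc _ ≤ 2 * S.θ y t ^ (β + 1 - p) + 2 * ((κ ^ 2 * p⁻¹ * I) * ∫ z in a..(a + 1), S.v z t) := by
        refine hs.trans ?_
        gcongr
    _ ≤ 2 * (2 * E + 2) ^ (β + 1 - p) + 2 * ((κ ^ 2 * p⁻¹ * I) * (2 * E + 2)) := by
        gcongr
        linarith
    _ ≤ _ := by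
        have : 0 ≤ 2 * (2 * E + 2) ^ (β + 1 - p) * I + 2 * (κ ^ 2 * p⁻¹ * (2 * E + 2)) := by positivity
        rw [hD]; linarith

/-- Pointwise bound of the magnetic field by the local dissipation. -/
theorem b_sup (hα : 0 ≤ α) (hT : 0 < T) (hδ : 0 < δ) :
    ∃ C, 0 < C ∧ ∀ S : Sol α β T K δ, ∀ t ∈ Icc 0 T, ∀ a, ∀ x ∈ Icc a (a + 1),
      S.b 0 x t ^ 2 + S.b 1 x t ^ 2 ≤ C * (1 + ∫ y in a..(a + 1), S.diss 0 y t) := by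
  obtain ⟨E, hE, H⟩ := energy_int (β := β) (K := K) hα hT hδ
  obtain ⟨c, _, hc, _, Hv⟩ := v_bounds (β := β) (K := K) hα hT hδ
  refine ⟨2 * (c⁻¹ * E) + 4 * (2 * E + 2), by positivity, fun S t ht a x hx => ?_⟩
  obtain ⟨-, -, h0, h1, -, -⟩ := H S t ht a (a + 1) (by linarith)
  obtain ⟨y, hy, hle⟩ := exists_le_int (f := fun x => S.v x t * (S.b 0 x t ^ 2 + S.b 1 x t ^ 2)) (by fun_prop) a
  have hy2 : S.b 0 y t ^ 2 + S.b 1 y t ^ 2 ≤ c⁻¹ * E := by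
    rw [le_inv_mul_iff₀ hc]
    have := (Hv S y t ht).1
    calc _ ≤ S.v y t * (S.b 0 y t ^ 2 + S.b 1 y t ^ 2) := by gcongr
      _ ≤ E := hle.trans h0
  have hs : ∀ i, S.b i x t ^ 2 ≤ 2 * S.b i y t ^ 2 +
      2 * ((∫ z in a..(a + 1), S.bx i z t ^ 2 / S.v z t) * ∫ z in a..(a + 1), S.v z t) := fun i =>
    sup_unit_weight (f := fun x => S.b i x t) (fx := fun x => S.bx i x t)
    (k := fun x => S.v x t) (by fun_prop) (by fun_prop) (fun x => S.v_pos x t) (fun x => S.db i x t) hx hy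
  have h3 : ∀ i : Fin 2, ∫ z in a..(a + 1), S.bx i z t ^ 2 / S.v z t ≤ 1 * ∫ z in a..(a + 1), S.diss 0 z t := by
    intro i
    refine int_le_one (by fun_prop (disch := simp)) (by fun_prop) (by linarith) fun z _ => ?_
    have hv := S.v_pos z t
    have hm := mv_pos hα hv
    have h1 := S.Q_div_le_diss z t
    have h2 : S.bx i z t ^ 2 / S.v z t ≤ S.Q z t / S.v z t := by
      gcongr
      have : 0 ≤ mv α (S.v z t) * S.v z t * S.ux z t ^ 2 := by positivity
      unfold Q
      fin_cases i <;> simp <;> nlinarith [sq_nonneg (S.wx 0 z t), sq_nonneg (S.wx 1 z t), sq_nonneg (S.bx 0 z t), sq_nonneg (S.bx 1 z t)]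
    linarith
  have h4 := int_le_two (f := fun z => S.v z t) (g₁ := fun z => lg (S.v z t)) (g₂ := fun _ => 1) (c₁ := 2) (c₂ := 2)
    (by fun_prop) (by unfold lg; fun_prop (disch := simp)) (by fun_prop) (by linarith : a ≤ a + 1)
    (fun z _ => by
      have := log_ge _ (S.v_pos z t)
      unfold lg; linarith)
  simp only [intervalIntegral.integral_const, smul_eq_mul] at h4
  have h5 : 0 ≤ ∫ z in a..(a + 1), S.v z t := int_nonneg (by linarith) fun z => (S.v_pos z t).le
  have h6 : 0 ≤ ∫ z in a..(a + 1), S.diss 0 z t := int_nonneg (by linarith) fun z => S.diss_nonneg hα le_rfl z t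
  set I := ∫ z in a..(a + 1), S.diss 0 z t with hI
  have h8 : ∀ i : Fin 2, (∫ z in a..(a + 1), S.bx i z t ^ 2 / S.v z t) * ∫ z in a..(a + 1), S.v z t
      ≤ I * (2 * E + 2) := fun i => mul_le_mul (by linarith [h3 i]) (by linarith) h5 h6
  have h9 : 0 ≤ 2 * (c⁻¹ * E) * I + 4 * (2 * E + 2) := by positivity
  linarith [hs 0, hs 1, h8 0, h8 1]

theorem rpow_interp {q r ε : ℝ} (hqr : q < r) (hq : 0 ≤ q) (hε : 0 < ε) :
    ∃ C, 0 < C ∧ ∀ z, 0 < z → z ^ q ≤ ε * z ^ r + C := by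
  refine ⟨(ε ^ (-(r - q)⁻¹)) ^ q, by positivity, fun z hz => ?_⟩
  have hM : 0 < ε ^ (-(r - q)⁻¹) := by positivity
  have hd : r - q ≠ 0 := by linarith
  rcases le_total z (ε ^ (-(r - q)⁻¹)) with h | h
  · have := Real.rpow_le_rpow hz.le h hq
    have : 0 ≤ ε * z ^ r := by positivity
    linarith
  · have h1 := Real.rpow_le_rpow_of_nonpos hM h (by linarith : -(r - q) ≤ 0)
    rw [← Real.rpow_mul hε.le, neg_mul_neg, inv_mul_cancel₀ hd, Real.rpow_one] at h1
    have h2 : z ^ q = z ^ (-(r - q)) * z ^ r := by rw [← Real.rpow_add hz]; ring_nf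
    have h3 : z ^ (-(r - q)) * z ^ r ≤ ε * z ^ r := by gcongr
    have : 0 < (ε ^ (-(r - q)⁻¹)) ^ q := by positivity
    linarith

theorem θ_sup_weight (hα : 0 ≤ α) (hT : 0 < T) (hδ : 0 < δ) (hβ : 0 < β) :
    ∃ C, 0 < C ∧ ∀ S : Sol α β T K δ, ∀ t ∈ Icc 0 T, ∀ R, 2 ≤ R → ∀ x ∈ Icc (-R) R,
      ph R x ^ 2 * S.θ x t ^ (β + 1 - pp β) ≤
        C * (1 + ∫ y in (-R)..R, ph R y ^ 2 * S.diss (pp β) y t) := by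
  obtain ⟨C, hC, H⟩ := θ_sup (K := K) hα hT hδ hβ
  refine ⟨2 * C, by positivity, fun S t ht R hR x hx => ?_⟩
  obtain ⟨a, ha, ha', hxa, hy⟩ := ph_inward hR hx
  have h1 := H S t ht a x hxa
  have h0 := fun y => S.diss_nonneg hα (pp_pos hβ).le y t
  have h2 := int_le_one (f := fun y => ph R x ^ 2 * S.diss (pp β) y t) (g₁ := fun y => ph R y ^ 2 * S.diss (pp β) y t)
    (c₁ := 2) (by fun_prop) (by fun_prop) (by linarith : a ≤ a + 1) fun y hy' => by
      have := mul_le_mul_of_nonneg_right (hy y hy') (h0 y)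
      linarith
  rw [intervalIntegral.integral_const_mul] at h2
  have h3 : ∫ y in a..(a + 1), ph R y ^ 2 * S.diss (pp β) y t ≤ ∫ y in (-R)..R, ph R y ^ 2 * S.diss (pp β) y t :=
    int_subset (by fun_prop) (fun y => mul_nonneg (sq_nonneg _) (h0 y)) ha (by linarith) ha'
  obtain ⟨p0, p1⟩ := ph_mem (by linarith : 0 < R) hx
  have h4 : ph R x ^ 2 ≤ 1 := by nlinarith
  have h5 := mul_le_mul_of_nonneg_left h1 (sq_nonneg (ph R x))
  nlinarith

/-- Improved entropy estimate. -/
theorem improved (hα : 0 ≤ α) (hT : 0 < T) (hδ : 0 < δ) (hβ : 0 < β) :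
    ∃ C, 0 < C ∧ ∀ S : Sol α β T K δ, ∃ R₀, 2 ≤ R₀ ∧ ∀ R ≥ R₀, ∀ t ∈ Icc 0 T,
      ∫ s in (0 : ℝ)..t, ∫ x in (-R)..R, ph R x ^ 2 * S.diss (pp β) x s ≤ C := by
  obtain ⟨E, hE, H⟩ := energy_int (β := β) (K := K) hα hT hδ
  obtain ⟨c, _, hc, _, Hv⟩ := v_bounds (β := β) (K := K) hα hT hδ
  obtain ⟨A, hA, Hs⟩ := θ_sup_weight (K := K) hα hT hδ hβ
  have hp := pp_pos hβ
  have hp2 := pp_le β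
  set p := pp β
  set ε := (32 * (c⁻¹ * E * A))⁻¹ with hε
  have ε0 : 0 < ε := by positivity
  obtain ⟨B, hB, Hi⟩ := rpow_interp (q := 1 - p) (r := β + 1 - p) (by linarith) (by linarith) ε0
  refine ⟨8 * ((2 + K ^ 2 + δ⁻¹) * K ^ 2 + 1 + 4 * (c⁻¹ * E) * (1 + B + ε * A) * T), by positivity, fun S => ?_⟩
  obtain ⟨R₀, hR₀, H1⟩ := S.entropy hα hT hp.le (Φ := en p) fun z hz => en_deriv (by linarith) hz
  refine ⟨max R₀ 2, le_max_right _ _, fun R hR t ht => ?_⟩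
  have hR1 : 2 ≤ R := (le_max_right _ _).trans hR
  have h := H1 R ((le_max_left _ _).trans hR) t ht
  have hi := S.ent_init hδ (Φ := en p) (fun z hz => en_le (by linarith) hz) (fun z hz =>
    (en_deriv (by linarith) hz).continuousAt.continuousWithinAt) (by linarith : 1 ≤ R)
  have h0 := fun x s => S.diss_nonneg hα hp.le x s
  have he : 0 ≤ ∫ x in (-R)..R, ph R x ^ 2 * S.ent (en p) x t := int_nonneg (by linarith) fun x =>
    mul_nonneg (sq_nonneg _) (S.ent_nonneg (fun z hz => en_nonneg hp.le (by linarith) hz) x t)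
  set D : ℝ → ℝ := fun s => ∫ x in (-R)..R, ph R x ^ 2 * S.diss p x s with hD
  have cD : Continuous D := cont_int (f := fun x s => ph R x ^ 2 * S.diss p x s) (by fun_prop)
  have D0 : ∀ s, 0 ≤ D s := fun s => int_nonneg (by linarith) fun x => mul_nonneg (sq_nonneg _) (h0 x s)
  have key : ∫ s in (0 : ℝ)..t, ∫ x in (-R)..R, ph R x ^ 2 * ((S.θ x s ^ (1 - p) - 1) * S.ux x s / S.v x s)
      ≤ 3 / 8 * (∫ s in (0 : ℝ)..t, D s) + (4 * (c⁻¹ * E) * (1 + B + ε * A)) * ∫ s in (0 : ℝ)..t, (1 : ℝ) := by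
    refine int_le_two (cont_int (f := fun x s => ph R x ^ 2 * ((S.θ x s ^ (1 - p) - 1) * S.ux x s / S.v x s))
      (by fun_prop (disch := simp))) cD continuous_const ht.1 fun s hs => ?_
    have hs' : s ∈ Icc 0 T := ⟨hs.1, hs.2.trans ht.2⟩
    obtain ⟨-, -, -, -, hl, -⟩ := H S s hs' (-R) R (by linarith)
    have hI0 := int_le_two (f := fun x => ph R x ^ 2 * ((S.θ x s ^ (1 - p) - 1) * S.ux x s / S.v x s))
      (g₁ := fun x => ph R x ^ 2 * S.diss p x s) (g₂ := fun x => lg (S.θ x s)) (c₁ := 1 / 4)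
      (c₂ := 4 * c⁻¹ * (1 + B + ε * (A * (1 + D s)))) (a := -R) (b := R)
      (by fun_prop (disch := simp)) (by fun_prop) (by unfold lg; fun_prop (disch := simp)) (by linarith)
      fun x hx => by
        have hv := S.v_pos x s
        have hθ := S.θ_pos x s
        have hcv := (Hv S x s hs').1
        have hl0 : 0 ≤ lg (S.θ x s) := log_nonneg _ hθ
        have k1 := S.ux_le_diss hα hp.le x s
        have k2 := rpow_sq_le_lg hp.le (by linarith : p ≤ 1) hθ
        have k3 := Hs S s hs' R hR1 x hx
        have k4 := Hi _ hθ
        obtain ⟨p0, p1⟩ := ph_mem (by linarith : 0 < R) hx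
        have p2 : ph R x ^ 2 ≤ 1 := by nlinarith
        have tp : 0 < S.θ x s ^ p := by positivity
        have k5 : (S.θ x s ^ (1 - p) - 1) * S.ux x s / S.v x s ≤
            1 / 4 * (S.ux x s ^ 2 * S.θ x s ^ (-p) / S.v x s) + (S.θ x s ^ (1 - p) - 1) ^ 2 * S.θ x s ^ p / S.v x s := by
          have e : 1 / 4 * (S.ux x s ^ 2 * S.θ x s ^ (-p) / S.v x s) + (S.θ x s ^ (1 - p) - 1) ^ 2 * S.θ x s ^ p / S.v x s
              - (S.θ x s ^ (1 - p) - 1) * S.ux x s / S.v x s = (1 / 2 * S.ux x s - (S.θ x s ^ (1 - p) - 1) * S.θ x s ^ p) ^ 2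
                / (S.θ x s ^ p * S.v x s) := by
            rw [Real.rpow_neg hθ.le]; field_simp; ring
          have : 0 ≤ (1 / 2 * S.ux x s - (S.θ x s ^ (1 - p) - 1) * S.θ x s ^ p) ^ 2 / (S.θ x s ^ p * S.v x s) := by
            positivity
          linarith
        have k6 : (S.θ x s ^ (1 - p) - 1) ^ 2 * S.θ x s ^ p / S.v x s ≤ c⁻¹ * (4 * lg (S.θ x s) * (1 + S.θ x s ^ (1 - p))) := by
          rw [div_eq_mul_inv, mul_comm]
          apply mul_le_mul (inv_anti₀ hc hcv) k2 (by positivity) (by positivity)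
        have k7 : ph R x ^ 2 * (1 + S.θ x s ^ (1 - p)) ≤ 1 + B + ε * (A * (1 + D s)) := by
          have m1 := mul_le_mul_of_nonneg_left k4 (sq_nonneg (ph R x))
          have m2 := mul_le_mul_of_nonneg_left k3 ε0.le
          have m3 := mul_le_mul_of_nonneg_right p2 hB.le
          simp only [hD]
          linarith
        calc ph R x ^ 2 * ((S.θ x s ^ (1 - p) - 1) * S.ux x s / S.v x s)
            ≤ ph R x ^ 2 * (1 / 4 * S.diss p x s + c⁻¹ * (4 * lg (S.θ x s) * (1 + S.θ x s ^ (1 - p)))) := by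
              gcongr; linarith
          _ = 1 / 4 * (ph R x ^ 2 * S.diss p x s) + 4 * c⁻¹ * (ph R x ^ 2 * (1 + S.θ x s ^ (1 - p))) * lg (S.θ x s) := by ring
          _ ≤ _ := by gcongr
    have q : 4 * c⁻¹ * (1 + B + ε * (A * (1 + D s))) * ∫ x in (-R)..R, lg (S.θ x s) ≤
        4 * c⁻¹ * (1 + B + ε * (A * (1 + D s))) * E := by
      have := D0 s
      gcongr
    have e : ε * (32 * (c⁻¹ * E * A)) = 1 := inv_mul_cancel₀ (by positivity)
    have e2 : ε * (32 * (c⁻¹ * E * A)) * D s = D s := by rw [e, one_mul]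
    refine hI0.trans ?_
    linarith
  simp only [intervalIntegral.integral_const, smul_eq_mul, mul_one, sub_zero] at key
  have : (4 * (c⁻¹ * E) * (1 + B + ε * A)) * t ≤ (4 * (c⁻¹ * E) * (1 + B + ε * A)) * T := by
    have := ht.2
    gcongr
  linarith

theorem diss_zero (hα : 0 ≤ α) (hT : 0 < T) (hδ : 0 < δ) (hβ : 0 < β) :
    ∃ C, 0 < C ∧ ∀ S : Sol α β T K δ, ∃ R₀, 2 ≤ R₀ ∧ ∀ R ≥ R₀, ∀ t ∈ Icc 0 T,
      ∫ s in (0 : ℝ)..t, ∫ x in (-R)..R, ph R x ^ 2 * S.diss 0 x s ≤ C := by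
  obtain ⟨E, hE, H⟩ := energy_int (β := β) (K := K) hα hT hδ
  obtain ⟨c, _, hc, _, Hv⟩ := v_bounds (β := β) (K := K) hα hT hδ
  obtain ⟨A, hA, Hs⟩ := θ_sup_weight (K := K) hα hT hδ hβ
  obtain ⟨F, hF, HF⟩ := improved (K := K) hα hT hδ hβ
  have hp := pp_pos hβ
  have hp2 := pp_le' β
  obtain ⟨B, hB, Hi⟩ := rpow_interp (q := 1) (r := β + 1 - pp β) (by linarith) (by linarith) one_pos
  refine ⟨4 * ((2 + K ^ 2 + δ⁻¹) * K ^ 2 + 1 + 2 * (c⁻¹ * E) * (1 + B + A) * T + 2 * (c⁻¹ * E) * A * F),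
    by positivity, fun S => ?_⟩
  obtain ⟨R₀, hR₀, H1⟩ := S.entropy hα hT le_rfl (Φ := fun _ => 0) fun z hz => by
    simpa using hasDerivAt_const z (0 : ℝ)
  obtain ⟨R₁, hR₁, H2⟩ := HF S
  refine ⟨max R₀ R₁, hR₁.trans (le_max_right _ _), fun R hR t ht => ?_⟩
  have hR1 : R₁ ≤ R := (le_max_right _ _).trans hR
  have h := H1 R ((le_max_left _ _).trans hR) t ht
  have hF := H2 R hR1 t ht
  have hi := S.ent_init hδ (Φ := fun _ => 0) (fun z hz => log_nonneg z hz) continuousOn_const (by linarith : 1 ≤ R)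
  have h0 := fun x s => S.diss_nonneg hα hp.le x s
  have he : 0 ≤ ∫ x in (-R)..R, ph R x ^ 2 * S.ent (fun _ => 0) x t := int_nonneg (by linarith) fun x =>
    mul_nonneg (sq_nonneg _) (S.ent_nonneg (fun z hz => le_rfl) x t)
  set D : ℝ → ℝ := fun s => ∫ x in (-R)..R, ph R x ^ 2 * S.diss (pp β) x s with hD
  have cD : Continuous D := cont_int (f := fun x s => ph R x ^ 2 * S.diss (pp β) x s) (by fun_prop)
  have D0 : ∀ s, 0 ≤ D s := fun s => int_nonneg (by linarith) fun x => mul_nonneg (sq_nonneg _) (h0 x s)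
  have key : ∫ s in (0 : ℝ)..t, ∫ x in (-R)..R, ph R x ^ 2 * ((S.θ x s ^ (1 - (0 : ℝ)) - 1) * S.ux x s / S.v x s)
      ≤ 1 / 4 * (∫ s in (0 : ℝ)..t, ∫ x in (-R)..R, ph R x ^ 2 * S.diss 0 x s)
        + (2 * (c⁻¹ * E) * (1 + B + A)) * (∫ s in (0 : ℝ)..t, (1 : ℝ)) + (2 * (c⁻¹ * E) * A) * ∫ s in (0 : ℝ)..t, D s := by
    refine int_le_three (cont_int (f := fun x s => ph R x ^ 2 * ((S.θ x s ^ (1 - (0 : ℝ)) - 1) * S.ux x s / S.v x s))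
      (by fun_prop (disch := simp))) (cont_int (f := fun x s => ph R x ^ 2 * S.diss 0 x s) (by fun_prop))
      continuous_const cD ht.1 fun s hs => ?_
    have hs' : s ∈ Icc 0 T := ⟨hs.1, hs.2.trans ht.2⟩
    obtain ⟨-, -, -, -, hl, -⟩ := H S s hs' (-R) R (by linarith)
    have hI0 := int_le_two (f := fun x => ph R x ^ 2 * ((S.θ x s ^ (1 - (0 : ℝ)) - 1) * S.ux x s / S.v x s))
      (g₁ := fun x => ph R x ^ 2 * S.diss 0 x s) (g₂ := fun x => lg (S.θ x s)) (c₁ := 1 / 4)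
      (c₂ := 2 * c⁻¹ * (1 + B + A * (1 + D s))) (a := -R) (b := R)
      (by fun_prop (disch := simp)) (by fun_prop) (by unfold lg; fun_prop (disch := simp)) (by linarith)
      fun x hx => by
        have hv := S.v_pos x s
        have hθ := S.θ_pos x s
        have hcv := (Hv S x s hs').1
        have hl0 : 0 ≤ lg (S.θ x s) := log_nonneg _ hθ
        have k1 := S.ux_le_diss hα le_rfl x s
        simp only [neg_zero, Real.rpow_zero, mul_one] at k1
        have k2 : _ ≤ _ * lg (S.θ x s) := sq_le_lg hθ
        have k3 := Hs S s hs' R (by linarith) x hx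
        have k4 := Hi _ hθ
        rw [Real.rpow_one] at k4
        obtain ⟨p0, p1⟩ := ph_mem (by linarith : 0 < R) hx
        have p2 : ph R x ^ 2 ≤ 1 := by nlinarith
        rw [sub_zero, Real.rpow_one]
        have k5 : (S.θ x s - 1) * S.ux x s / S.v x s ≤
            1 / 4 * (S.ux x s ^ 2 / S.v x s) + (S.θ x s - 1) ^ 2 / S.v x s := by
          have e : 1 / 4 * (S.ux x s ^ 2 / S.v x s) + (S.θ x s - 1) ^ 2 / S.v x s
              - (S.θ x s - 1) * S.ux x s / S.v x s = (1 / 2 * S.ux x s - (S.θ x s - 1)) ^ 2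
                / S.v x s := by
            field_simp; ring
          have : 0 ≤ (1 / 2 * S.ux x s - (S.θ x s - 1)) ^ 2 / S.v x s := by
            positivity
          linarith
        have k6 : (S.θ x s - 1) ^ 2 / S.v x s ≤ c⁻¹ * (2 * (1 + S.θ x s) * lg (S.θ x s)) := by
          rw [div_eq_mul_inv, mul_comm]
          apply mul_le_mul (inv_anti₀ hc hcv) k2 (by positivity) (by positivity)
        have k7 : ph R x ^ 2 * (1 + S.θ x s) ≤ 1 + B + A * (1 + D s) := by
          have m1 := mul_le_mul_of_nonneg_left k4 (sq_nonneg (ph R x))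
          have m3 := mul_le_mul_of_nonneg_right p2 hB.le
          simp only [hD]
          linarith
        calc ph R x ^ 2 * ((S.θ x s - 1) * S.ux x s / S.v x s)
            ≤ ph R x ^ 2 * (1 / 4 * S.diss 0 x s + c⁻¹ * (2 * (1 + S.θ x s) * lg (S.θ x s))) := by
              gcongr; linarith
          _ = 1 / 4 * (ph R x ^ 2 * S.diss 0 x s) + 2 * c⁻¹ * (ph R x ^ 2 * (1 + S.θ x s)) * lg (S.θ x s) := by ring
          _ ≤ _ := by gcongr
    have q : 2 * c⁻¹ * (1 + B + A * (1 + D s)) * ∫ x in (-R)..R, lg (S.θ x s) ≤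
        2 * c⁻¹ * (1 + B + A * (1 + D s)) * E := by
      have := D0 s
      gcongr
    refine hI0.trans ?_
    linarith
  simp only [intervalIntegral.integral_const, smul_eq_mul, mul_one, sub_zero] at key
  have h3 : (2 * (c⁻¹ * E) * (1 + B + A)) * t ≤ (2 * (c⁻¹ * E) * (1 + B + A)) * T := by
    have := ht.2
    gcongr
  have h4 : (2 * (c⁻¹ * E) * A) * (∫ s in (0 : ℝ)..t, D s) ≤ (2 * (c⁻¹ * E) * A) * F := by
    gcongr
  simp only [sub_zero] at h
  linarith

/-- Local dissipation rate, controlling all the coefficients in the higher order estimates. -/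
def A (L s : ℝ) : ℝ := 1 + ∫ x in (-L)..L, (S.diss (pp β) x s + S.diss 0 x s)

@[fun_prop] theorem fA {X : Type*} [TopologicalSpace X] {h : X → ℝ} (L : ℝ) (hh : Continuous h) :
    Continuous fun x => S.A L (h x) := by
  have : Continuous (S.A L) := by
    unfold A
    exact continuous_const.add (cont_int (f := fun x s => S.diss (pp β) x s + S.diss 0 x s) (by fun_prop))
  exact this.comp hh

theorem A_ge (hα : 0 ≤ α) (hβ : 0 < β) {L : ℝ} (hL : 0 ≤ L) (s : ℝ) : 1 ≤ S.A L s := by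
  have : 0 ≤ ∫ x in (-L)..L, (S.diss (pp β) x s + S.diss 0 x s) := int_nonneg (by linarith) fun x =>
    add_nonneg (S.diss_nonneg hα (pp_pos hβ).le x s) (S.diss_nonneg hα le_rfl x s)
  unfold A; linarith

theorem A_int (hα : 0 ≤ α) (hT : 0 < T) (hδ : 0 < δ) (hβ : 0 < β) :
    ∃ C, 0 < C ∧ ∀ S : Sol α β T K δ, ∀ L, 1 ≤ L → ∀ t ∈ Icc 0 T, ∫ s in (0 : ℝ)..t, S.A L s ≤ C := by
  obtain ⟨C₁, h₁, H₁⟩ := improved (K := K) hα hT hδ hβ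
  obtain ⟨C₂, h₂, H₂⟩ := diss_zero (K := K) hα hT hδ hβ
  refine ⟨T + 2 * (C₁ + C₂), by positivity, fun S L hL t ht => ?_⟩
  obtain ⟨R₁, r₁, H₁⟩ := H₁ S
  obtain ⟨R₂, r₂, H₂⟩ := H₂ S
  have hR : 2 * L ≤ max (2 * L) (max R₁ R₂) := le_max_left _ _
  have hR1 : R₁ ≤ max (2 * L) (max R₁ R₂) := (le_max_left _ _).trans (le_max_right _ _)
  have hR2 : R₂ ≤ max (2 * L) (max R₁ R₂) := (le_max_right _ _).trans (le_max_right _ _)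
  set R := max (2 * L) (max R₁ R₂)
  have d1 := fun x s => S.diss_nonneg hα (pp_pos hβ).le x s
  have d0 := fun x s => S.diss_nonneg hα le_rfl x s
  have k1 := int_le_weight2 (f := fun x s => S.diss (pp β) x s) (by fun_prop) d1 (by linarith : 0 < L) ht.1 hR
  have k2 := int_le_weight2 (f := fun x s => S.diss 0 x s) (by fun_prop) d0 (by linarith : 0 < L) ht.1 hR
  have k3 : ∫ s in (0 : ℝ)..t, S.A L s ≤ 1 * (∫ s in (0 : ℝ)..t, (1 : ℝ))
      + 1 * (∫ s in (0 : ℝ)..t, ∫ x in (-L)..L, S.diss (pp β) x s) + 1 * ∫ s in (0 : ℝ)..t, ∫ x in (-L)..L, S.diss 0 x s :=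
    int_le_three (by fun_prop) continuous_const (cont_int (f := fun x s => S.diss (pp β) x s) (by fun_prop))
      (cont_int (f := fun x s => S.diss 0 x s) (by fun_prop)) ht.1 fun s _ => by
        unfold A
        rw [int_add (by fun_prop) (by fun_prop)]; linarith
  simp only [intervalIntegral.integral_const, smul_eq_mul, mul_one, sub_zero] at k3
  linarith [H₁ R hR1 t ht, H₂ R hR2 t ht, ht.2]

/-- Every point of `[-L, L]` lies in a unit interval contained in `[-L, L]`. -/
theorem exists_unit {L x : ℝ} (hL : 1 ≤ L) (hx : x ∈ Icc (-L) L) :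
    ∃ a, -L ≤ a ∧ a + 1 ≤ L ∧ x ∈ Icc a (a + 1) := by
  obtain ⟨h1, h2⟩ := hx
  rcases le_total x (L - 1) with h | h
  · exact ⟨x, h1, by linarith, le_rfl, by linarith⟩
  · exact ⟨L - 1, by linarith, by linarith, h, by linarith⟩

/-- Uniform bounds of the solution in terms of the dissipation rate. -/
theorem bounds (hα : 0 ≤ α) (hT : 0 < T) (hδ : 0 < δ) (hβ : 0 < β) :
    ∃ C, 1 ≤ C ∧ ∀ S : Sol α β T K δ, ∀ t ∈ Icc 0 T, (∀ x, C⁻¹ ≤ S.v x t ∧ S.v x t ≤ C ∧ C⁻¹ ≤ S.θ x t) ∧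
      ∀ L, 1 ≤ L → (∀ x ∈ Icc (-L) L, S.θ x t ^ (β + 1 - pp β) ≤ C * S.A L t ∧ S.θ x t ≤ C * S.A L t ∧
        S.b 0 x t ^ 2 + S.b 1 x t ^ 2 ≤ C * S.A L t) ∧ ∫ s in (0 : ℝ)..t, S.A L s ≤ C := by
  obtain ⟨a, ha, Ha⟩ := A_int (K := K) hα hT hδ hβ
  obtain ⟨cv, B, hcv, hB, Hv⟩ := v_bounds (β := β) (K := K) hα hT hδ
  obtain ⟨cθ, hcθ, Hθ⟩ := θ_bound (β := β) (K := K) hα hT hδ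
  obtain ⟨C₁, h₁, H₁⟩ := θ_sup (K := K) hα hT hδ hβ
  obtain ⟨C₂, h₂, H₂⟩ := b_sup (β := β) (K := K) hα hT hδ
  have hp := pp_pos hβ
  have hp2 := pp_le' β
  obtain ⟨C₃, h₃, H₃⟩ := rpow_interp (q := 1) (r := β + 1 - pp β) (by linarith) (by linarith) one_pos
  set M := B + (cv⁻¹ * (C₁ + C₃) + C₂) * a with hM
  refine ⟨1 + cv⁻¹ + Real.exp M + cθ⁻¹ + C₁ + (C₁ + C₃) + C₂ + a, by
    have := Real.exp_pos M
    have := inv_pos.2 hcv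
    have := inv_pos.2 hcθ
    linarith, ?_⟩
  have e0 := Real.exp_pos M
  have e1 := inv_pos.2 hcv
  have e2 := inv_pos.2 hcθ
  set C := 1 + cv⁻¹ + Real.exp M + cθ⁻¹ + C₁ + (C₁ + C₃) + C₂ + a with hC
  intro S
  have d1 := fun x s => S.diss_nonneg hα hp.le x s
  have d0 := fun x s => S.diss_nonneg hα le_rfl x s
  have hsup : ∀ t ∈ Icc 0 T, ∀ L, 1 ≤ L → ∀ x ∈ Icc (-L) L, S.θ x t ^ (β + 1 - pp β) ≤ C₁ * S.A L t ∧
      S.θ x t ≤ (C₁ + C₃) * S.A L t ∧ S.b 0 x t ^ 2 + S.b 1 x t ^ 2 ≤ C₂ * S.A L t := by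
    intro t ht L hL x hx
    obtain ⟨y, hy1, hy2, hy⟩ := exists_unit hL hx
    have k1 : ∀ p, 0 ≤ p → ∫ z in y..(y + 1), S.diss p z t ≤ ∫ z in (-L)..L, S.diss p z t := fun p hp =>
      int_subset (by fun_prop) (fun z => S.diss_nonneg hα hp z t) hy1 (by linarith) hy2
    have k2 : S.A L t = 1 + ((∫ z in (-L)..L, S.diss (pp β) z t) + ∫ z in (-L)..L, S.diss 0 z t) := by
      unfold A; rw [int_add (by fun_prop) (by fun_prop)]
    have k3 : 0 ≤ ∫ z in (-L)..L, S.diss (pp β) z t := int_nonneg (by linarith) fun z => d1 z t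
    have k4 : 0 ≤ ∫ z in (-L)..L, S.diss 0 z t := int_nonneg (by linarith) fun z => d0 z t
    have k5 : S.θ x t ^ (β + 1 - pp β) ≤ C₁ * S.A L t := by
      refine (H₁ S t ht y x hy).trans ?_
      gcongr
      linarith [k1 _ hp.le]
    refine ⟨k5, ?_, ?_⟩
    · have := H₃ _ (S.θ_pos x t)
      rw [Real.rpow_one] at this
      have := S.A_ge hα hβ (by linarith : 0 ≤ L) t
      nlinarith
    · refine (H₂ S t ht y x hy).trans ?_
      gcongr
      linarith [k1 _ le_rfl]
  have hv : ∀ t ∈ Icc 0 T, ∀ x, S.v x t ≤ Real.exp M := by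
    intro t ht x
    rw [← Real.log_le_iff_le_exp (S.v_pos x t)]
    refine (Hv S x t ht).2.trans ?_
    rw [hM]
    gcongr
    have hL : 1 ≤ |x| + 1 := by linarith [abs_nonneg x]
    calc S.gg x t ≤ (cv⁻¹ * (C₁ + C₃) + C₂) * ∫ s in (0 : ℝ)..t, S.A (|x| + 1) s := by
          refine int_le_one (by fun_prop) (by fun_prop) ht.1 fun s hs => ?_
          have hs' : s ∈ Icc 0 T := ⟨hs.1, hs.2.trans ht.2⟩
          obtain ⟨-, k2, k3⟩ := hsup s hs' (|x| + 1) hL x ⟨by linarith [neg_abs_le x], by linarith [le_abs_self x]⟩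
          have k4 : S.θ x s / S.v x s ≤ cv⁻¹ * ((C₁ + C₃) * S.A (|x| + 1) s) := by
            rw [div_eq_mul_inv, mul_comm]
            exact mul_le_mul (inv_anti₀ hcv (Hv S x s hs').1) k2 (S.θ_pos x s).le e1.le
          have : 0 ≤ S.b 0 x s ^ 2 + S.b 1 x s ^ 2 := by positivity
          unfold pr
          linarith
      _ ≤ _ := by
          gcongr
          exact Ha S _ hL t ht
  intro t ht
  refine ⟨fun x => ⟨?_, ?_, ?_⟩, fun L hL => ⟨fun x hx => ?_, ?_⟩⟩
  · refine le_trans ?_ (Hv S x t ht).1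
    rw [inv_le_comm₀ (by linarith) hcv]; linarith
  · linarith [hv t ht x]
  · refine le_trans ?_ (Hθ S x t ht)
    rw [inv_le_comm₀ (by linarith) hcθ]; linarith
  · have h0 : 0 ≤ S.A L t := by linarith [S.A_ge hα hβ (by linarith : 0 ≤ L) t]
    obtain ⟨k1, k2, k3⟩ := hsup t ht L hL x hx
    exact ⟨k1.trans (by gcongr; linarith), k2.trans (by gcongr; linarith), k3.trans (by gcongr; linarith)⟩
  · linarith [Ha S L hL t ht]

end Sol

theorem mv_le {α : ℝ} (hα : 0 ≤ α) {B z : ℝ} (hB : 0 < B) (h : B⁻¹ ≤ z) : mv α z ≤ B + α * B ^ (α + 1) := by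
  have hz : 0 < z := (inv_pos.2 hB).trans_le h
  have h1 : z⁻¹ ≤ B := inv_le_of_inv_le₀ hB h
  have h2 : z ^ (-α - 1) ≤ B ^ (α + 1) := by
    rw [show -α - 1 = -(α + 1) by ring, Real.rpow_neg hz.le, ← Real.inv_rpow hz.le]
    exact Real.rpow_le_rpow (inv_pos.2 hz).le h1 (by linarith)
  unfold mv; gcongr

theorem mvd_le {α : ℝ} (hα : 0 ≤ α) {B z : ℝ} (hB : 0 < B) (h : B⁻¹ ≤ z) :
    |mvd α z| ≤ B ^ 2 + α * (α + 1) * B ^ (α + 2) := by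
  have hz : 0 < z := (inv_pos.2 hB).trans_le h
  have h1 : z⁻¹ ≤ B := inv_le_of_inv_le₀ hB h
  have h2 : z ^ (-α - 2) ≤ B ^ (α + 2) := by
    rw [show -α - 2 = -(α + 2) by ring, Real.rpow_neg hz.le, ← Real.inv_rpow hz.le]
    exact Real.rpow_le_rpow (inv_pos.2 hz).le h1 (by linarith)
  have h3 : 0 ≤ z⁻¹ ^ 2 + α * (α + 1) * z ^ (-α - 2) := by positivity
  rw [show mvd α z = -(z⁻¹ ^ 2 + α * (α + 1) * z ^ (-α - 2)) by unfold mvd; ring, abs_neg, abs_of_nonneg h3]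
  gcongr

/-- Comparison of powers on a half-line. -/
theorem rpow_le_mul {B z p q : ℝ} (hB : 0 < B) (hz : B⁻¹ ≤ z) (hpq : p ≤ q) :
    z ^ p ≤ B ^ (q - p) * z ^ q := by
  have h0 : 0 < z := (inv_pos.2 hB).trans_le hz
  have h1 : z⁻¹ ≤ B := inv_le_of_inv_le₀ hB hz
  have h2 : z⁻¹ ^ (q - p) ≤ B ^ (q - p) := Real.rpow_le_rpow (inv_pos.2 h0).le h1 (by linarith)
  rw [Real.inv_rpow h0.le, ← Real.rpow_neg h0.le] at h2
  calc z ^ p = z ^ (-(q - p)) * z ^ q := by rw [← Real.rpow_add h0]; ring_nf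
    _ ≤ _ := by gcongr

namespace Sol

variable {α β T K δ : ℝ} (S : Sol α β T K δ)

theorem Q_ge (hα : 0 ≤ α) (x t : ℝ) : S.ux x t ^ 2 + (S.wx 0 x t ^ 2 + S.wx 1 x t ^ 2)
    + (S.bx 0 x t ^ 2 + S.bx 1 x t ^ 2) ≤ S.Q x t := by
  have h2 := S.v_pos x t
  have h6 : 1 ≤ mv α (S.v x t) * S.v x t := by
    calc 1 = (S.v x t)⁻¹ * S.v x t := by field_simp
      _ ≤ _ := by gcongr; exact mv_ge hα h2
  have := le_mul_of_one_le_left (sq_nonneg (S.ux x t)) h6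
  unfold Q; linarith

theorem grad_le_diss (hα : 0 ≤ α) {B x t : ℝ} (hB : 0 < B) (h : S.v x t ≤ B) :
    S.ux x t ^ 2 + (S.wx 0 x t ^ 2 + S.wx 1 x t ^ 2) + (S.bx 0 x t ^ 2 + S.bx 1 x t ^ 2) ≤ B * S.diss 0 x t := by
  have h1 := S.Q_ge hα x t
  have h2 := S.Q_div_le_diss x t
  have h3 := S.v_pos x t
  have h4 := S.Q_nonneg hα x t
  refine h1.trans ?_
  calc S.Q x t = S.v x t * (S.Q x t / S.v x t) := by field_simp
    _ ≤ B * S.diss 0 x t := by gcongr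

/-- Effective velocity. -/
def hh (x t : ℝ) : ℝ := mv α (S.v x t) * S.vx x t - S.u x t

@[fun_prop] theorem fhh {X : Type*} [TopologicalSpace X] {g h : X → ℝ} (hg : Continuous g)
    (hk : Continuous h) : Continuous fun x => S.hh (g x) (h x) := by
  unfold hh; fun_prop

theorem hh_deriv (x : ℝ) {t : ℝ} (ht : t ∈ Ioo 0 T) : HasDerivAt (S.hh x)
    (S.θx x t / S.v x t - S.θ x t * S.vx x t / S.v x t ^ 2 + (S.b 0 x t * S.bx 0 x t + S.b 1 x t * S.bx 1 x t)) t := by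
  have h := ((dmv (α := α) (v := fun s => S.v x s) (vx := fun s => S.ux x s) (S.v_pos x t) (S.dvt x t ht)).fun_mul
    (S.dvxt x t ht)).fun_sub (S.dut x t ht)
  refine h.congr_deriv ?_
  rw [S.eq_u]; ring

set_option maxHeartbeats 1000000 in
/-- Square-integrability of the space derivative of the specific volume. -/
theorem vx_int (hα : 0 ≤ α) (hT : 0 < T) (hδ : 0 < δ) (hβ : 0 < β) :
    ∃ C, 0 < C ∧ ∀ S : Sol α β T K δ, ∀ t ∈ Icc 0 T, ∀ L, 1 ≤ L → ∫ x in (-L)..L, S.vx x t ^ 2 ≤ C := by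
  obtain ⟨E, hE, HE⟩ := energy_int (β := β) (K := K) hα hT hδ
  obtain ⟨B, hB, H⟩ := bounds (K := K) hα hT hδ hβ
  have hp := pp_pos hβ
  have hp2 := pp_le' β
  have hB0 : 0 < B := by linarith
  set p := pp β with hpdef
  set k := B ^ (β + 1 - p - (1 + p - β)) with hk
  have k0 : 0 < k := by positivity
  set m := B + α * B ^ (α + 1) with hm
  have m0 : 0 < m := by positivity
  set k₁ := p⁻¹ + B with hk₁
  set k₂ := B ^ 2 * k + B with hk₂
  set c₀ := 2 * (m ^ 2 + 1) * K ^ 2 + (k₁ + B ^ 2 * E) * B with hc₀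
  have k10 : 0 < k₁ := by positivity
  refine ⟨2 * B ^ 2 * (c₀ * Real.exp (k₂ * B) + E), by positivity, fun S t ht L hL => ?_⟩
  have hA0 : ∀ s, 0 ≤ S.A L s := fun s => by linarith [S.A_ge hα hβ (by linarith : 0 ≤ L) s]
  have hLL : -L ≤ L := by linarith
  have h0T : (0 : ℝ) ∈ Icc 0 T := ⟨le_rfl, hT.le⟩

  have hi : ∫ x in (-L)..L, S.hh x 0 ^ 2 ≤ 2 * (m ^ 2 + 1) * K ^ 2 := by
    refine (int_le_one (by fun_prop) S.ini_cont hLL fun x _ => ?_ : _ ≤ 2 * (m ^ 2 + 1) * _).trans ?_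
    · have h1 := mv_le hα hB0 ((H S 0 h0T).1 x).1
      have h2 := mv_pos hα (S.v_pos x 0)
      have h3 : mv α (S.v x 0) ^ 2 ≤ m ^ 2 := by gcongr
      have h4 : S.hh x 0 ^ 2 ≤ 2 * (mv α (S.v x 0) ^ 2 * S.vx x 0 ^ 2) + 2 * S.u x 0 ^ 2 := by
        unfold hh; nlinarith [sq_nonneg (mv α (S.v x 0) * S.vx x 0 + S.u x 0)]
      have h5 : S.vx x 0 ^ 2 + S.u x 0 ^ 2 ≤ S.ini x := by
        unfold ini
        nlinarith [sq_nonneg (S.v x 0 - 1), sq_nonneg (S.θ x 0 - 1), sq_nonneg (S.b 0 x 0), sq_nonneg (S.b 1 x 0),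
          sq_nonneg (S.w 0 x 0), sq_nonneg (S.w 1 x 0), sq_nonneg (S.ux x 0), sq_nonneg (S.θx x 0),
          sq_nonneg (S.bx 0 x 0), sq_nonneg (S.bx 1 x 0), sq_nonneg (S.wx 0 x 0), sq_nonneg (S.wx 1 x 0)]
      calc _ ≤ 2 * (m ^ 2 * S.vx x 0 ^ 2) + 2 * S.u x 0 ^ 2 := by refine h4.trans ?_; gcongr
        _ ≤ 2 * (m ^ 2 + 1) * (S.vx x 0 ^ 2 + S.u x 0 ^ 2) := by
          nlinarith [sq_nonneg (S.vx x 0), mul_nonneg (sq_nonneg m) (sq_nonneg (S.u x 0))]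
        _ ≤ _ := by gcongr
    · have := S.ini_int hLL
      gcongr
  set P : ℝ → ℝ → ℝ := fun x t => S.θx x t / S.v x t - S.θ x t * S.vx x t / S.v x t ^ 2
    + (S.b 0 x t * S.bx 0 x t + S.b 1 x t * S.bx 1 x t) with hP
  have cP : Continuous fun q : ℝ × ℝ => P q.1 q.2 := by simp only [hP]; fun_prop (disch := simp)
  set Y : ℝ → ℝ := fun t => ∫ x in (-L)..L, S.hh x t ^ 2 with hY
  have cY : Continuous Y := cont_int (f := fun x t => S.hh x t ^ 2) (by fun_prop)
  have cPh : Continuous fun q : ℝ × ℝ => 2 * S.hh q.1 q.2 * P q.1 q.2 := by fun_prop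
  have main : ∀ t ∈ Icc 0 T, Y t ≤ c₀ + ∫ s in (0 : ℝ)..t, k₂ * S.A L s * Y s := by
    intro t ht
    have e := time_ftc (T := T) (f := fun x t => S.hh x t ^ 2) (ft := fun x t => 2 * S.hh x t * P x t)
      (by fun_prop) cPh (fun x t ht => ((S.hh_deriv x ht).fun_pow 2).congr_deriv (by simp [hP])) (-L) L ht
    have i1 : ∫ s in (0 : ℝ)..t, ∫ x in (-L)..L, 2 * S.hh x s * P x s ≤
        (k₁ + B ^ 2 * E) * (∫ s in (0 : ℝ)..t, S.A L s) + 1 * ∫ s in (0 : ℝ)..t, k₂ * S.A L s * Y s := by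
      refine int_le_two (cont_int (f := fun x s => 2 * S.hh x s * P x s) cPh) (by fun_prop)
        (by fun_prop) ht.1 fun s hs => ?_
      have hs' : s ∈ Icc 0 T := ⟨hs.1, hs.2.trans ht.2⟩
      obtain ⟨hu, -⟩ := HE S s hs' (-L) L hLL
      obtain ⟨Hv, HL⟩ := H S s hs'
      have Hx := (HL L hL).1
      have i2 := int_le_three (f := fun x => 2 * S.hh x s * P x s)
        (g₁ := fun x => S.diss p x s + S.diss 0 x s) (g₂ := fun x => S.hh x s ^ 2) (g₃ := fun x => S.u x s ^ 2)
        (c₁ := k₁) (c₂ := k₂ * S.A L s) (c₃ := B ^ 2 * S.A L s) (slice_left (f := fun x t => 2 * S.hh x t * P x t) cPh s) (by fun_prop) (by fun_prop)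
        (by fun_prop) hLL fun x hx => by
          obtain ⟨v1, v2, t1⟩ := Hv x
          obtain ⟨x1, x2, x3⟩ := Hx x hx
          have hv := S.v_pos x s
          have hθ := S.θ_pos x s
          have hA := hA0 s
          have d0 := S.diss_nonneg hα le_rfl x s
          have dp := S.diss_nonneg hα hp.le x s
          have hm1 := mv_pos hα hv
          have hm2 := mv_ge hα hv
          have vinv : (S.v x s)⁻¹ ≤ B := inv_le_of_inv_le₀ hB0 v1
          have hvx : S.vx x s = (S.hh x s + S.u x s) / mv α (S.v x s) := by
            unfold hh; field_simp; ring
          have n1 : 2 * S.hh x s * (S.θx x s / S.v x s) ≤ p⁻¹ * S.diss p x s + B ^ 2 * k * S.A L s * S.hh x s ^ 2 := by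
            have q1 := S.θx_le_diss hα hp x s
            have q2 := rpow_le_mul hB0 t1 (by linarith : 1 + p - β ≤ β + 1 - p)
            have q3 : 2 * S.hh x s * (S.θx x s / S.v x s) ≤ S.θ x s ^ (β - 1 - p) * S.θx x s ^ 2 / S.v x s
                + S.θ x s ^ (1 + p - β) * S.hh x s ^ 2 * (S.v x s)⁻¹ := by
              have e : S.θ x s ^ (1 + p - β) = (S.θ x s ^ (β - 1 - p))⁻¹ := by
                rw [← Real.rpow_neg hθ.le]; ring_nf
              have y0 : 0 < S.θ x s ^ (β - 1 - p) := by positivity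
              rw [e]
              set y := S.θ x s ^ (β - 1 - p)
              have : 0 ≤ (y * S.θx x s - S.hh x s) ^ 2 / (y * S.v x s) := by positivity
              have e2 : (y * S.θx x s - S.hh x s) ^ 2 / (y * S.v x s) = y * S.θx x s ^ 2 / S.v x s
                + y⁻¹ * S.hh x s ^ 2 * (S.v x s)⁻¹ - 2 * S.hh x s * (S.θx x s / S.v x s) := by
                field_simp; ring
              linarith
            have q4 : S.θ x s ^ (1 + p - β) * S.hh x s ^ 2 * (S.v x s)⁻¹ ≤ k * (B * S.A L s) * S.hh x s ^ 2 * B := by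
              gcongr
              exact q2.trans (by gcongr)
            linarith
          have n2 : -(2 * S.hh x s * (S.θ x s * S.vx x s / S.v x s ^ 2)) ≤ B ^ 2 * S.A L s * S.u x s ^ 2 := by
            have e : -(2 * S.hh x s * (S.θ x s * S.vx x s / S.v x s ^ 2)) ≤
                (mv α (S.v x s) * S.v x s)⁻¹ * (S.v x s)⁻¹ * S.θ x s * S.u x s ^ 2 := by
              rw [hvx]
              have e1 : (mv α (S.v x s) * S.v x s)⁻¹ * (S.v x s)⁻¹ * S.θ x s * S.u x s ^ 2 +
                  2 * S.hh x s * (S.θ x s * ((S.hh x s + S.u x s) / mv α (S.v x s)) / S.v x s ^ 2) =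
                  (mv α (S.v x s) * S.v x s)⁻¹ * (S.v x s)⁻¹ * S.θ x s * (S.hh x s ^ 2 + (S.hh x s + S.u x s) ^ 2) := by
                field_simp; ring
              have : 0 ≤ (mv α (S.v x s) * S.v x s)⁻¹ * (S.v x s)⁻¹ * S.θ x s * (S.hh x s ^ 2 + (S.hh x s + S.u x s) ^ 2) := by
                positivity
              linarith
            have e2 : (mv α (S.v x s) * S.v x s)⁻¹ ≤ 1 := by
              apply inv_le_one_of_one_le₀
              calc 1 = (S.v x s)⁻¹ * S.v x s := by field_simp
                _ ≤ _ := by gcongr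
            have hu2 := sq_nonneg (S.u x s)
            have hvi := inv_pos.2 hv
            calc _ ≤ _ := e
              _ ≤ 1 * B * (B * S.A L s) * S.u x s ^ 2 := by gcongr
              _ = _ := by ring
          have n3 : 2 * S.hh x s * (S.b 0 x s * S.bx 0 x s + S.b 1 x s * S.bx 1 x s) ≤
              B * S.diss 0 x s + B * S.A L s * S.hh x s ^ 2 := by
            have q1 := S.grad_le_diss hα hB0 v2
            have q2 := mul_le_mul_of_nonneg_right x3 (sq_nonneg (S.hh x s))
            nlinarith [sq_nonneg (S.hh x s * S.b 0 x s - S.bx 0 x s), sq_nonneg (S.hh x s * S.b 1 x s - S.bx 1 x s),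
              sq_nonneg (S.ux x s), sq_nonneg (S.wx 0 x s), sq_nonneg (S.wx 1 x s)]
          have n4 : 0 ≤ p⁻¹ * S.diss 0 x s + B * S.diss p x s := by positivity
          simp only [hP, hk₁, hk₂]
          linarith
      have i3 : ∫ x in (-L)..L, S.diss p x s + S.diss 0 x s = S.A L s - 1 := by unfold A; rw [← hpdef]; ring
      rw [i3] at i2
      have hA := hA0 s
      have i4 : B ^ 2 * S.A L s * (∫ x in (-L)..L, S.u x s ^ 2) ≤ B ^ 2 * S.A L s * E := by gcongr
      have i5 : k₁ * (S.A L s - 1) ≤ k₁ * S.A L s := by gcongr; linarith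
      simp only [hY]
      linarith
    have i6 : (k₁ + B ^ 2 * E) * (∫ s in (0 : ℝ)..t, S.A L s) ≤ (k₁ + B ^ 2 * E) * B := by
      gcongr
      exact ((H S t ht).2 L hL).2
    simp only [hY] at i1 ⊢
    linarith
  have g1 := gronwall cY (by fun_prop) (fun s => mul_nonneg (by positivity) (hA0 s)) main ht
  have g2 : Y t ≤ c₀ * Real.exp (k₂ * B) := by
    refine (main t ht).trans (g1.trans ?_)
    rw [intervalIntegral.integral_const_mul]
    have := ((H S t ht).2 L hL).2
    gcongr
  have g3 := int_le_two (f := fun x => S.vx x t ^ 2) (g₁ := fun x => S.hh x t ^ 2) (g₂ := fun x => S.u x t ^ 2)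
    (c₁ := 2 * B ^ 2) (c₂ := 2 * B ^ 2) (by fun_prop) (by fun_prop) (by fun_prop) hLL fun x _ => by
      have hv := S.v_pos x t
      have hm1 := mv_pos hα hv
      have hm2 := mv_ge hα hv
      have hvB := ((H S t ht).1 x).2.1
      have hm3 : (mv α (S.v x t))⁻¹ ≤ B := (inv_le_of_inv_le₀ hv hm2).trans hvB
      have hvx : S.vx x t = (mv α (S.v x t))⁻¹ * (S.hh x t + S.u x t) := by
        unfold hh; field_simp; ring
      have hm4 : ((mv α (S.v x t))⁻¹) ^ 2 ≤ B ^ 2 := by gcongr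
      have : (S.hh x t + S.u x t) ^ 2 ≤ 2 * S.hh x t ^ 2 + 2 * S.u x t ^ 2 := by
        nlinarith [sq_nonneg (S.hh x t - S.u x t)]
      rw [hvx, mul_pow]
      calc _ ≤ B ^ 2 * (2 * S.hh x t ^ 2 + 2 * S.u x t ^ 2) := by gcongr
        _ = _ := by ring
  obtain ⟨hu, -⟩ := HE S t ht (-L) L hLL
  have g4 : 2 * B ^ 2 * (∫ x in (-L)..L, S.u x t ^ 2) ≤ 2 * B ^ 2 * E := by gcongr
  have g5 : 2 * B ^ 2 * (∫ x in (-L)..L, S.hh x t ^ 2) ≤ 2 * B ^ 2 * (c₀ * Real.exp (k₂ * B)) := by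
    gcongr
  linarith

end Sol

theorem ph_end {R : ℝ} (hR : 0 < R) : ph R R = 0 ∧ ph R (-R) = 0 := by
  unfold ph
  rw [neg_div, div_self hR.ne']
  norm_num

/-- Weighted second order energy estimate for a linear parabolic equation. -/
theorem parabolic {T R M : ℝ} {f fx fxx ft m g : ℝ → ℝ → ℝ}
    (cf : Continuous fun p : ℝ × ℝ => f p.1 p.2) (cfx : Continuous fun p : ℝ × ℝ => fx p.1 p.2)
    (cfxx : Continuous fun p : ℝ × ℝ => fxx p.1 p.2) (cft : Continuous fun p : ℝ × ℝ => ft p.1 p.2)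
    (cg : Continuous fun p : ℝ × ℝ => g p.1 p.2)
    (dx : ∀ x t, HasDerivAt (fun y => f y t) (fx x t) x)
    (dxx : ∀ x t, HasDerivAt (fun y => fx y t) (fxx x t) x)
    (dt : ∀ x, ∀ t ∈ Ioo 0 T, HasDerivAt (f x) (ft x t) t)
    (heq : ∀ x t, ft x t = m x t * fxx x t + g x t) (hM : 1 ≤ M)
    (hm : ∀ x, ∀ t ∈ Icc 0 T, M⁻¹ ≤ m x t ∧ m x t ≤ M) (hR : 2 ≤ R) {t : ℝ} (ht : t ∈ Icc 0 T) :
    (∫ x in (-R)..R, ph R x ^ 2 * fx x t ^ 2) + M⁻¹ * ∫ s in (0 : ℝ)..t, ∫ x in (-R)..R, ph R x ^ 2 * fxx x s ^ 2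
      ≤ (∫ x in (-R)..R, ph R x ^ 2 * fx x 0 ^ 2)
        + (8 * M ^ 3 + 2 * M + 2) * (∫ s in (0 : ℝ)..t, ∫ x in (-R)..R, ph R x ^ 2 * g x s ^ 2)
        + (8 * M ^ 3 + 2 * M + 2) * ∫ s in (0 : ℝ)..t, ∫ x in (-R)..R, fx x s ^ 2 := by
  have hM0 : 0 < M := by linarith
  have hR0 : 0 < R := by linarith
  have e := energy_second (R := R) cf cfx cfxx cft (a := fun x _ => ph R x ^ 2) (ax := fun x _ => 2 * ph R x * dph R x)
    (at' := fun _ _ => 0) (by fun_prop) (by fun_prop) (by fun_prop) dx dxx dt (fun x _ => ph_sq_deriv R x)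
    (fun x t _ => hasDerivAt_const _ _) (fun _ => by simp [(ph_end hR0).1]) (fun _ => by simp [(ph_end hR0).2]) ht
  have c1 : Continuous fun p : ℝ × ℝ => 0 * fx p.1 p.2 ^ 2 - 2 * (2 * ph R p.1 * dph R p.1 * fx p.1 p.2
    + ph R p.1 ^ 2 * fxx p.1 p.2) * ft p.1 p.2 := by fun_prop
  have c2 : Continuous fun p : ℝ × ℝ => ph R p.1 ^ 2 * fxx p.1 p.2 ^ 2 := by fun_prop
  have c3 : Continuous fun p : ℝ × ℝ => ph R p.1 ^ 2 * g p.1 p.2 ^ 2 := by fun_prop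
  have c4 : Continuous fun p : ℝ × ℝ => fx p.1 p.2 ^ 2 := by fun_prop
  set k := 8 * M ^ 3 + 2 * M + 2 with hk
  have i : ∫ s in (0 : ℝ)..t, ∫ x in (-R)..R, (0 * fx x s ^ 2 - 2 * (2 * ph R x * dph R x * fx x s
      + ph R x ^ 2 * fxx x s) * ft x s) ≤ -M⁻¹ * (∫ s in (0 : ℝ)..t, ∫ x in (-R)..R, ph R x ^ 2 * fxx x s ^ 2)
      + k * (∫ s in (0 : ℝ)..t, ∫ x in (-R)..R, ph R x ^ 2 * g x s ^ 2)
      + k * ∫ s in (0 : ℝ)..t, ∫ x in (-R)..R, fx x s ^ 2 := by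
    refine int_le_three (cont_int (f := fun x s => 0 * fx x s ^ 2 - 2 * (2 * ph R x * dph R x * fx x s
      + ph R x ^ 2 * fxx x s) * ft x s) c1) (cont_int (f := fun x s => ph R x ^ 2 * fxx x s ^ 2) c2)
      (cont_int (f := fun x s => ph R x ^ 2 * g x s ^ 2) c3) (cont_int (f := fun x s => fx x s ^ 2) c4) ht.1 fun s hs => ?_
    refine int_le_three (slice_left (f := fun x s => 0 * fx x s ^ 2 - 2 * (2 * ph R x * dph R x * fx x s
      + ph R x ^ 2 * fxx x s) * ft x s) c1 s) (slice_left (f := fun x s => ph R x ^ 2 * fxx x s ^ 2) c2 s)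
      (slice_left (f := fun x s => ph R x ^ 2 * g x s ^ 2) c3 s) (slice_left (f := fun x s => fx x s ^ 2) c4 s)
      (by linarith) fun x hx => ?_
    obtain ⟨m1, m2⟩ := hm x s ⟨hs.1, hs.2.trans ht.2⟩
    obtain ⟨p0, p1⟩ := ph_mem hR0 hx
    have d1 : |dph R x| ≤ 1 := (dph_abs hR0 hx).trans (by rw [div_le_iff₀ hR0]; linarith)
    have d2 : dph R x ^ 2 ≤ 1 := (sq_le_one_iff_abs_le_one _).2 d1
    rw [heq]
    generalize ph R x = p at *
    generalize dph R x = d at *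
    generalize fx x s = a at *
    generalize fxx x s = b at *
    generalize g x s = g at *
    generalize m x s = m at *
    have hMi : M⁻¹ * M = 1 := inv_mul_cancel₀ hM0.ne'
    have hmi : 0 < M⁻¹ := inv_pos.2 hM0
    have m0 : 0 < m := hmi.trans_le m1
    have s1 : -(2 * (p * b) * (p * g)) ≤ M⁻¹ / 2 * (p * b) ^ 2 + 2 * M * (p * g) ^ 2 := by
      have : M⁻¹ / 2 * (p * b) ^ 2 + 2 * M * (p * g) ^ 2 + 2 * (p * b) * (p * g)
        = M⁻¹ / 2 * (p * b + 2 * M * (p * g)) ^ 2 := by field_simp; ring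
      have : 0 ≤ M⁻¹ / 2 * (p * b + 2 * M * (p * g)) ^ 2 := by positivity
      linarith
    have s2 : -(4 * (p * b) * (m * d * a)) ≤ M⁻¹ / 2 * (p * b) ^ 2 + 8 * M * (m * d * a) ^ 2 := by
      have : M⁻¹ / 2 * (p * b) ^ 2 + 8 * M * (m * d * a) ^ 2 + 4 * (p * b) * (m * d * a)
        = M⁻¹ / 2 * (p * b + 4 * M * (m * d * a)) ^ 2 := by field_simp; ring
      have : 0 ≤ M⁻¹ / 2 * (p * b + 4 * M * (m * d * a)) ^ 2 := by positivity
      linarith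
    have s3 : (m * d * a) ^ 2 ≤ M ^ 2 * a ^ 2 := by
      have : (m * d * a) ^ 2 = m ^ 2 * d ^ 2 * a ^ 2 := by ring
      rw [this]
      have : m ^ 2 * d ^ 2 ≤ M ^ 2 * 1 := by gcongr
      nlinarith [sq_nonneg a]
    have s4 : -(4 * (d * a) * (p * g)) ≤ 2 * (p * g) ^ 2 + 2 * a ^ 2 := by
      have : (d * a) ^ 2 ≤ a ^ 2 := by nlinarith [sq_nonneg a]
      nlinarith [sq_nonneg (d * a + p * g)]
    have s5 : M⁻¹ * (p * b) ^ 2 ≤ m * (p * b) ^ 2 := by gcongr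
    have s6 : 8 * M * (m * d * a) ^ 2 ≤ 8 * M * (M ^ 2 * a ^ 2) := by gcongr
    have s7 : 0 ≤ 8 * M ^ 3 * (p * g) ^ 2 + 2 * M * a ^ 2 := by positivity
    rw [hk]
    linarith
  linarith

namespace Sol

variable {α β T K δ : ℝ} (S : Sol α β T K δ)

/-- Squares of the first derivatives. -/
def gr (x t : ℝ) : ℝ := S.ux x t ^ 2 + (S.wx 0 x t ^ 2 + S.wx 1 x t ^ 2) + (S.bx 0 x t ^ 2 + S.bx 1 x t ^ 2)

/-- Squares of the second derivatives. -/
def gr2 (x t : ℝ) : ℝ := S.uxx x t ^ 2 + (S.wxx 0 x t ^ 2 + S.wxx 1 x t ^ 2) + (S.bxx 0 x t ^ 2 + S.bxx 1 x t ^ 2)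

/-- Lower order terms in the momentum equation. -/
def gu (x t : ℝ) : ℝ := mvd α (S.v x t) * S.vx x t * S.ux x t
    - S.θx x t / S.v x t + S.θ x t * S.vx x t / S.v x t ^ 2 - (S.b 0 x t * S.bx 0 x t + S.b 1 x t * S.bx 1 x t)

/-- Lower order terms in the equation for `w`. -/
def gw (i : Fin 2) (x t : ℝ) : ℝ := S.bx i x t - S.wx i x t * S.vx x t / S.v x t ^ 2

/-- Lower order terms in the equation for `b`. -/
def gb (i : Fin 2) (x t : ℝ) : ℝ :=
  (S.wx i x t - S.ux x t * S.b i x t - S.bx i x t * S.vx x t / S.v x t ^ 2) / S.v x t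

/-- Squares of the lower order terms. -/
def src (x t : ℝ) : ℝ := S.gu x t ^ 2 + (S.gw 0 x t ^ 2 + S.gw 1 x t ^ 2) + (S.gb 0 x t ^ 2 + S.gb 1 x t ^ 2)

section
variable {X : Type*} [TopologicalSpace X] {g h : X → ℝ}

@[fun_prop] theorem fgr (hg : Continuous g) (hh : Continuous h) : Continuous fun x => S.gr (g x) (h x) := by
  unfold gr; fun_prop
@[fun_prop] theorem fgr2 (hg : Continuous g) (hh : Continuous h) : Continuous fun x => S.gr2 (g x) (h x) := by
  unfold gr2; fun_prop
@[fun_prop] theorem fgu (hg : Continuous g) (hh : Continuous h) : Continuous fun x => S.gu (g x) (h x) := by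
  unfold gu; fun_prop (disch := simp)
@[fun_prop] theorem fgw (i : Fin 2) (hg : Continuous g) (hh : Continuous h) : Continuous fun x => S.gw i (g x) (h x) := by
  unfold gw; fun_prop (disch := simp)
@[fun_prop] theorem fgb (i : Fin 2) (hg : Continuous g) (hh : Continuous h) : Continuous fun x => S.gb i (g x) (h x) := by
  unfold gb; fun_prop (disch := simp)
@[fun_prop] theorem fsrc (hg : Continuous g) (hh : Continuous h) : Continuous fun x => S.src (g x) (h x) := by
  unfold src; fun_prop
end

theorem gr_nonneg (x t : ℝ) : 0 ≤ S.gr x t := by unfold gr; positivity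
theorem gr2_nonneg (x t : ℝ) : 0 ≤ S.gr2 x t := by unfold gr2; positivity

theorem int_five {a b : ℝ} {φ f₁ f₂ f₃ f₄ f₅ : ℝ → ℝ} (c : Continuous φ) (h₁ : Continuous f₁) (h₂ : Continuous f₂)
    (h₃ : Continuous f₃) (h₄ : Continuous f₄) (h₅ : Continuous f₅) :
    ∫ x in a..b, φ x * (f₁ x + (f₂ x + f₃ x) + (f₄ x + f₅ x)) = (∫ x in a..b, φ x * f₁ x)
      + ((∫ x in a..b, φ x * f₂ x) + ∫ x in a..b, φ x * f₃ x) + ((∫ x in a..b, φ x * f₄ x) + ∫ x in a..b, φ x * f₅ x) := by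
  simp only [mul_add]
  rw [int_add (by fun_prop) (by fun_prop), int_add (by fun_prop) (by fun_prop), int_add (by fun_prop) (by fun_prop),
    int_add (by fun_prop) (by fun_prop)]

theorem int_five' {a b c d : ℝ} {φ : ℝ → ℝ} {f₁ f₂ f₃ f₄ f₅ : ℝ → ℝ → ℝ} (cφ : Continuous φ)
    (h₁ : Continuous fun p : ℝ × ℝ => f₁ p.1 p.2) (h₂ : Continuous fun p : ℝ × ℝ => f₂ p.1 p.2)
    (h₃ : Continuous fun p : ℝ × ℝ => f₃ p.1 p.2) (h₄ : Continuous fun p : ℝ × ℝ => f₄ p.1 p.2)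
    (h₅ : Continuous fun p : ℝ × ℝ => f₅ p.1 p.2) :
    ∫ s in c..d, ∫ x in a..b, φ x * (f₁ x s + (f₂ x s + f₃ x s) + (f₄ x s + f₅ x s)) =
      (∫ s in c..d, ∫ x in a..b, φ x * f₁ x s)
      + ((∫ s in c..d, ∫ x in a..b, φ x * f₂ x s) + ∫ s in c..d, ∫ x in a..b, φ x * f₃ x s)
      + ((∫ s in c..d, ∫ x in a..b, φ x * f₄ x s) + ∫ s in c..d, ∫ x in a..b, φ x * f₅ x s) := by
  have k : ∀ {f : ℝ → ℝ → ℝ}, Continuous (fun p : ℝ × ℝ => f p.1 p.2) → Continuous fun s => ∫ x in a..b, φ x * f x s :=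
    fun {f} hf => cont_int (f := fun x s => φ x * f x s) (by fun_prop)
  have e : ∀ s, ∫ x in a..b, φ x * (f₁ x s + (f₂ x s + f₃ x s) + (f₄ x s + f₅ x s)) = _ := fun s =>
    int_five cφ (slice_left h₁ s) (slice_left h₂ s) (slice_left h₃ s) (slice_left h₄ s) (slice_left h₅ s)
  simp only [e]
  have k₁ := k h₁
  have k₂ := k h₂
  have k₃ := k h₃
  have k₄ := k h₄
  have k₅ := k h₅
  rw [int_add (by fun_prop) (by fun_prop), int_add k₁ (by fun_prop), int_add k₂ k₃, int_add k₄ k₅]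

set_option maxHeartbeats 1000000 in
/-- Energy inequality for the first derivatives of velocity and magnetic field. -/
theorem grad_energy (hα : 0 ≤ α) (hT : 0 < T) (hδ : 0 < δ) (hβ : 0 < β) :
    ∃ c k, 0 < c ∧ 0 < k ∧ ∀ S : Sol α β T K δ, ∀ R, 2 ≤ R → ∀ t ∈ Icc 0 T,
      (∫ x in (-R)..R, ph R x ^ 2 * S.gr x t) + c * ∫ s in (0 : ℝ)..t, ∫ x in (-R)..R, ph R x ^ 2 * S.gr2 x s ≤
        k * (1 + ∫ s in (0 : ℝ)..t, ∫ x in (-R)..R, ph R x ^ 2 * S.src x s) := by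
  obtain ⟨B, hB, H⟩ := bounds (K := K) hα hT hδ hβ
  have hB0 : 0 < B := by linarith
  set M := B ^ 2 + (B + α * B ^ (α + 1)) with hM
  have h1 : 0 ≤ α * B ^ (α + 1) := by positivity
  have hMB : B ^ 2 ≤ M := by linarith
  have hBB : B ≤ B ^ 2 := by nlinarith
  have hM1 : 1 ≤ M := by nlinarith
  set k := 8 * M ^ 3 + 2 * M + 2 with hk
  have k0 : 0 < k := by positivity
  refine ⟨M⁻¹, K ^ 2 + k * (B * B) + k, by positivity, by positivity, fun S R hR t ht => ?_⟩
  have hbd : ∀ x, ∀ t ∈ Icc 0 T, M⁻¹ ≤ (S.v x t)⁻¹ ∧ (S.v x t)⁻¹ ≤ M ∧ M⁻¹ ≤ mv α (S.v x t) ∧ mv α (S.v x t) ≤ M ∧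
      M⁻¹ ≤ (S.v x t)⁻¹ ^ 2 ∧ (S.v x t)⁻¹ ^ 2 ≤ M := by
    intro x t ht
    obtain ⟨v1, v2, -⟩ := (H S t ht).1 x
    have hv := S.v_pos x t
    have q1 : (S.v x t)⁻¹ ≤ B := inv_le_of_inv_le₀ hB0 v1
    have q2 : M⁻¹ ≤ (S.v x t)⁻¹ := inv_anti₀ hv (by linarith)
    have q3 := mv_ge hα hv
    have q4 := mv_le hα hB0 v1
    have q5 : M⁻¹ ≤ (S.v x t)⁻¹ ^ 2 := by
      rw [inv_pow]
      apply inv_anti₀ (by positivity)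
      refine le_trans ?_ hMB
      gcongr
    refine ⟨q2, by linarith, by linarith, by nlinarith, q5, ?_⟩
    refine le_trans ?_ hMB
    gcongr
  have eu := parabolic (m := fun x t => mv α (S.v x t)) (g := S.gu) S.cu S.cux S.cuxx S.cut (by fun_prop) S.du S.dux S.dut
    (fun x t => by rw [S.eq_u]; unfold gu; ring) hM1 (fun x t ht => ⟨(hbd x t ht).2.2.1, (hbd x t ht).2.2.2.1⟩) hR ht
  have ew : ∀ i, _ := fun i => parabolic (m := fun x t => (S.v x t)⁻¹) (g := S.gw i) (S.cw i) (S.cwx i) (S.cwxx i) (S.cwt i)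
    (by fun_prop) (S.dw i) (S.dwx i) (S.dwt i)
    (fun x t => by rw [S.eq_w]; unfold gw; ring) hM1 (fun x t ht => ⟨(hbd x t ht).1, (hbd x t ht).2.1⟩) hR ht
  have eb : ∀ i, _ := fun i => parabolic (m := fun x t => (S.v x t)⁻¹ ^ 2) (g := S.gb i) (S.cb i) (S.cbx i) (S.cbxx i) (S.cbt i)
    (by fun_prop) (S.db i) (S.dbx i) (S.dbt i)
    (fun x t => by
      have h := S.eq_b i x t
      have hv := S.v_ne x t
      have : S.bt i x t = (S.bxx i x t / S.v x t - S.bx i x t * S.vx x t / S.v x t ^ 2 + S.wx i x t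
        - S.ux x t * S.b i x t) / S.v x t := by
          rw [eq_div_iff hv]; linarith
      rw [this]; unfold gb; field_simp; ring) hM1
    (fun x t ht => ⟨(hbd x t ht).2.2.2.2.1, (hbd x t ht).2.2.2.2.2⟩) hR ht
  have ew0 := ew 0
  have ew1 := ew 1
  have eb0 := eb 0
  have eb1 := eb 1
  have cp : Continuous fun x => ph R x ^ 2 := by fun_prop
  have f1 : ∀ t, ∫ x in (-R)..R, ph R x ^ 2 * S.gr x t = _ := fun t => int_five cp (f₁ := fun x => S.ux x t ^ 2)
    (f₂ := fun x => S.wx 0 x t ^ 2) (f₃ := fun x => S.wx 1 x t ^ 2) (f₄ := fun x => S.bx 0 x t ^ 2)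
    (f₅ := fun x => S.bx 1 x t ^ 2) (by fun_prop) (by fun_prop) (by fun_prop) (by fun_prop) (by fun_prop)
  have f2 : ∫ s in (0 : ℝ)..t, ∫ x in (-R)..R, ph R x ^ 2 * S.gr2 x s = _ := int_five' cp (f₁ := fun x t => S.uxx x t ^ 2)
    (f₂ := fun x t => S.wxx 0 x t ^ 2) (f₃ := fun x t => S.wxx 1 x t ^ 2) (f₄ := fun x t => S.bxx 0 x t ^ 2)
    (f₅ := fun x t => S.bxx 1 x t ^ 2) (by fun_prop) (by fun_prop) (by fun_prop) (by fun_prop) (by fun_prop)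
  have f3 : ∫ s in (0 : ℝ)..t, ∫ x in (-R)..R, ph R x ^ 2 * S.src x s = _ := int_five' cp (f₁ := fun x t => S.gu x t ^ 2)
    (f₂ := fun x t => S.gw 0 x t ^ 2) (f₃ := fun x t => S.gw 1 x t ^ 2) (f₄ := fun x t => S.gb 0 x t ^ 2)
    (f₅ := fun x t => S.gb 1 x t ^ 2) (by fun_prop) (by fun_prop) (by fun_prop) (by fun_prop) (by fun_prop)
  have f4 := int_five' (a := -R) (b := R) (c := 0) (d := t) (φ := fun _ => 1) continuous_const (f₁ := fun x t => S.ux x t ^ 2)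
    (f₂ := fun x t => S.wx 0 x t ^ 2) (f₃ := fun x t => S.wx 1 x t ^ 2) (f₄ := fun x t => S.bx 0 x t ^ 2)
    (f₅ := fun x t => S.bx 1 x t ^ 2) (by fun_prop) (by fun_prop) (by fun_prop) (by fun_prop) (by fun_prop)
  simp only [one_mul] at f4
  have hRR : -R ≤ R := by linarith
  have f5 : ∫ s in (0 : ℝ)..t, ∫ x in (-R)..R, S.gr x s ≤ B * B := by
    have : ∫ s in (0 : ℝ)..t, ∫ x in (-R)..R, S.gr x s ≤ B * ∫ s in (0 : ℝ)..t, S.A R s := by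
      refine int_le_one (cont_int (f := fun x s => S.gr x s) (by fun_prop)) (by fun_prop) ht.1 fun s hs => ?_
      have hs' : s ∈ Icc 0 T := ⟨hs.1, hs.2.trans ht.2⟩
      have := int_le_one (f := fun x => S.gr x s) (g₁ := fun x => S.diss (pp β) x s + S.diss 0 x s) (c₁ := B)
        (a := -R) (b := R) (by fun_prop) (by fun_prop) hRR fun x _ => by
          have := S.grad_le_diss hα hB0 ((H S s hs').1 x).2.1
          have := mul_nonneg hB0.le (S.diss_nonneg hα (pp_pos hβ).le x s)
          unfold gr; linarith
      refine this.trans ?_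
      unfold A
      gcongr
      linarith
    refine this.trans ?_
    have := ((H S t ht).2 R (by linarith)).2
    gcongr
  have f6 : ∫ x in (-R)..R, ph R x ^ 2 * S.gr x 0 ≤ K ^ 2 := by
    refine (int_mono (by fun_prop) S.ini_cont hRR fun x hx => ?_).trans (S.ini_int hRR)
    obtain ⟨p0, p1⟩ := ph_mem (by linarith) hx
    have p2 : ph R x ^ 2 ≤ 1 := by nlinarith
    have : S.gr x 0 ≤ S.ini x := by
      unfold gr ini
      linarith [sq_nonneg (S.v x 0 - 1), sq_nonneg (S.θ x 0 - 1), sq_nonneg (S.b 0 x 0), sq_nonneg (S.b 1 x 0),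
        sq_nonneg (S.w 0 x 0), sq_nonneg (S.w 1 x 0), sq_nonneg (S.u x 0), sq_nonneg (S.θx x 0), sq_nonneg (S.vx x 0)]
    have := S.gr_nonneg x 0
    nlinarith
  have f7 : 0 ≤ ∫ s in (0 : ℝ)..t, ∫ x in (-R)..R, ph R x ^ 2 * S.src x s :=
    int_nonneg ht.1 fun s => int_nonneg hRR fun x => by unfold src; positivity
  have f8 : k * (∫ s in (0 : ℝ)..t, ∫ x in (-R)..R, S.gr x s) ≤ k * (B * B) := by gcongr
  have f9 : 0 ≤ (K ^ 2 + k * (B * B)) * ∫ s in (0 : ℝ)..t, ∫ x in (-R)..R, ph R x ^ 2 * S.src x s := by positivity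
  have f6' := f1 0
  have f1' := f1 t
  unfold gr at f5 f8
  simp only [f4] at f8
  rw [f1', f2, f3]
  rw [f6'] at f6
  rw [f3] at f9
  linarith

/-- Heat flux. -/
def hf (x t : ℝ) : ℝ := S.θ x t ^ β * S.θx x t / S.v x t

/-- Spatial derivative of the heat flux. -/
def hfx (x t : ℝ) : ℝ := S.θ x t ^ β * S.θxx x t / S.v x t + β * S.θ x t ^ (β - 1) * S.θx x t ^ 2 / S.v x t
      - S.θ x t ^ β * S.θx x t * S.vx x t / S.v x t ^ 2

section
variable {X : Type*} [TopologicalSpace X] {g h : X → ℝ}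
@[fun_prop] theorem fhf (hg : Continuous g) (hh : Continuous h) : Continuous fun x => S.hf (g x) (h x) := by
  unfold hf; fun_prop (disch := simp)
@[fun_prop] theorem fhfx (hg : Continuous g) (hh : Continuous h) : Continuous fun x => S.hfx (g x) (h x) := by
  unfold hfx; fun_prop (disch := simp)
end

theorem hf_deriv (x t : ℝ) : HasDerivAt (fun y => S.hf y t) (S.hfx x t) x := by
  unfold hf hfx
  refine ((((S.dθ x t).rpow_const (Or.inl (S.θ_ne x t))).fun_mul (S.dθx x t)).fun_div (S.dv x t) (S.v_ne x t)).congr_deriv ?_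
  have := S.v_ne x t
  field_simp
  ring

theorem θt_eq (x t : ℝ) : S.θt x t = S.hfx x t + (S.Q x t - S.θ x t * S.ux x t) / S.v x t := by
  have := S.eq_θ x t
  unfold hfx Q
  rw [sub_div]
  have e : S.θ x t * S.ux x t / S.v x t = S.θ x t / S.v x t * S.ux x t := by ring
  rw [e]
  linarith

theorem Q_le (hα : 0 ≤ α) {B x t : ℝ} (hB : 0 < B) (h1 : B⁻¹ ≤ S.v x t) (h2 : S.v x t ≤ B) :
    S.Q x t ≤ ((B + α * B ^ (α + 1)) * B + 1) * S.gr x t := by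
  have h3 := mv_le hα hB h1
  have h4 := mv_pos hα (S.v_pos x t)
  have h5 := S.v_pos x t
  have h6 : mv α (S.v x t) * S.v x t ≤ (B + α * B ^ (α + 1)) * B := by
    gcongr
  have h7 : 0 ≤ (B + α * B ^ (α + 1)) * B := by positivity
  set q := (B + α * B ^ (α + 1)) * B
  unfold Q gr
  have h8 := mul_le_mul_of_nonneg_right h6 (sq_nonneg (S.ux x t))
  have h9 : 0 ≤ q * (S.wx 0 x t ^ 2 + S.wx 1 x t ^ 2 + (S.bx 0 x t ^ 2 + S.bx 1 x t ^ 2)) := by positivity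
  nlinarith [sq_nonneg (S.ux x t)]

set_option maxHeartbeats 1000000 in
/-- Energy inequality for the temperature. -/
theorem temp_energy (hα : 0 ≤ α) (hT : 0 < T) (hδ : 0 < δ) (hβ : 0 < β) :
    ∃ c k, 0 < c ∧ 0 < k ∧ ∀ S : Sol α β T K δ, ∃ R₀, ∀ R, 2 ≤ R → R₀ ≤ R → ∀ t ∈ Icc 0 T,
      (∫ x in (-R)..R, ph R x ^ 2 * (S.θ x t - 1) ^ 2)
        + c * (∫ s in (0 : ℝ)..t, ∫ x in (-R)..R, ph R x ^ 2 * S.θx x s ^ 2) ≤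
        k + ∫ s in (0 : ℝ)..t, k * S.A R s * ((∫ x in (-R)..R, ph R x ^ 2 * (S.θ x s - 1) ^ 2)
          + ∫ x in (-R)..R, ph R x ^ 2 * S.gr x s) := by
  obtain ⟨B, hB, H⟩ := bounds (K := K) hα hT hδ hβ
  have hB0 : 0 < B := by linarith
  set q := (B + α * B ^ (α + 1)) * B + 1 with hq
  have q0 : 0 < q := by positivity
  set c := (B⁻¹) ^ β * B⁻¹ with hc
  have c0 : 0 < c := by positivity
  set k := K ^ 2 + 1 + B ^ 2 + 4 * B ^ 2 * q with hk
  refine ⟨c, k, c0, by positivity, fun S => ?_⟩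
  obtain ⟨R₀, hR₀, HR⟩ := avg_small T (f := fun x t => 4 * ((S.θ x t - 1) ^ 2 * (S.θ x t ^ β / S.v x t)))
    (by fun_prop (disch := simp)) (by
      have h1 := (((S.tθ.sub_const 1).pow 2).mul ((S.tθpow β).div S.tv one_ne_zero)).const_mul 4
      simpa using h1) (ε := 1 / T) (by positivity)
  refine ⟨R₀, fun R hR hRR₀ t ht => ?_⟩
  have hR0 : 0 < R := by linarith
  have hRR : -R ≤ R := by linarith
  have e := time_ftc (T := T) (f := fun x t => ph R x ^ 2 * (S.θ x t - 1) ^ 2)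
    (ft := fun x t => ph R x ^ 2 * (2 * (S.θ x t - 1) * S.θt x t)) (by fun_prop) (by fun_prop)
    (fun x t ht => ((((S.dθt x t ht).sub_const 1).fun_pow 2).const_mul (ph R x ^ 2)).congr_deriv (by simp))
    (-R) R ht
  have f0 : ∫ x in (-R)..R, ph R x ^ 2 * (S.θ x 0 - 1) ^ 2 ≤ K ^ 2 := by
    refine (int_mono (by fun_prop) S.ini_cont hRR fun x hx => ?_).trans (S.ini_int hRR)
    obtain ⟨p0, p1⟩ := ph_mem (by linarith) hx
    have p2 : ph R x ^ 2 ≤ 1 := by nlinarith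
    have : (S.θ x 0 - 1) ^ 2 ≤ S.ini x := by
      unfold ini
      linarith [sq_nonneg (S.v x 0 - 1), sq_nonneg (S.b 0 x 0), sq_nonneg (S.b 1 x 0),
        sq_nonneg (S.w 0 x 0), sq_nonneg (S.w 1 x 0), sq_nonneg (S.u x 0), sq_nonneg (S.θx x 0), sq_nonneg (S.vx x 0),
        sq_nonneg (S.ux x 0), sq_nonneg (S.wx 0 x 0), sq_nonneg (S.wx 1 x 0), sq_nonneg (S.bx 0 x 0), sq_nonneg (S.bx 1 x 0)]
    nlinarith [sq_nonneg (S.θ x 0 - 1)]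
  have hA0 : ∀ s, 1 ≤ S.A R s := fun s => S.A_ge hα hβ hR0.le s
  set X := fun s => ∫ x in (-R)..R, ph R x ^ 2 * (S.θ x s - 1) ^ 2 with hX
  set Z := fun s => ∫ x in (-R)..R, ph R x ^ 2 * S.gr x s with hZ
  have cX : Continuous X := cont_int (f := fun x s => ph R x ^ 2 * (S.θ x s - 1) ^ 2) (by fun_prop)
  have cZ : Continuous Z := cont_int (f := fun x s => ph R x ^ 2 * S.gr x s) (by fun_prop)
  have X0 : ∀ s, 0 ≤ X s := fun s => int_nonneg hRR fun x => by positivity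
  have Z0 : ∀ s, 0 ≤ Z s := fun s => int_nonneg hRR fun x => mul_nonneg (by positivity) (S.gr_nonneg x s)
  have main : ∫ s in (0 : ℝ)..t, ∫ x in (-R)..R, ph R x ^ 2 * (2 * (S.θ x s - 1) * S.θt x s) ≤
      -c * (∫ s in (0 : ℝ)..t, ∫ x in (-R)..R, ph R x ^ 2 * S.θx x s ^ 2)
      + 1 * (∫ s in (0 : ℝ)..t, 1 / T) + 1 * ∫ s in (0 : ℝ)..t, k * S.A R s * (X s + Z s) := by
    refine int_le_three (cont_int (f := fun x s => ph R x ^ 2 * (2 * (S.θ x s - 1) * S.θt x s)) (by fun_prop))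
      (cont_int (f := fun x s => ph R x ^ 2 * S.θx x s ^ 2) (by fun_prop)) continuous_const (by fun_prop) ht.1 fun s hs => ?_
    have hs' : s ∈ Icc 0 T := ⟨hs.1, hs.2.trans ht.2⟩
    have ib := ibp_zero (R := R) (a := fun x => ph R x ^ 2 * (2 * (S.θ x s - 1))) (F := fun x => S.hf x s)
      (Fx := fun x => S.hfx x s)
      (ax := fun x => 2 * ph R x * dph R x * (2 * (S.θ x s - 1)) + ph R x ^ 2 * (2 * S.θx x s))
      (fun x => (ph_sq_deriv R x).fun_mul (((S.dθ x s).sub_const 1).const_mul 2)) (fun x => S.hf_deriv x s)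
      (by fun_prop) (by fun_prop) (by simp [(ph_end hR0).1]) (by simp [(ph_end hR0).2])
    have ie : ∫ x in (-R)..R, ph R x ^ 2 * (2 * (S.θ x s - 1) * S.θt x s) =
        ∫ x in (-R)..R, (-((2 * ph R x * dph R x * (2 * (S.θ x s - 1)) + ph R x ^ 2 * (2 * S.θx x s)) * S.hf x s)
          + ph R x ^ 2 * (2 * (S.θ x s - 1)) * ((S.Q x s - S.θ x s * S.ux x s) / S.v x s)) := by
      rw [int_add (by fun_prop) (by fun_prop (disch := simp)), ← ib, ← int_add (by fun_prop) (by fun_prop (disch := simp))]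
      congr 1; ext x
      rw [S.θt_eq]; ring
    rw [ie]
    obtain ⟨Hv, HL⟩ := H S s hs'
    have Hx := (HL R (by linarith)).1
    have hav := HR R hRR₀ s hs'
    have hA := hA0 s
    have i2 := int_le_four
      (f := fun x => (-((2 * ph R x * dph R x * (2 * (S.θ x s - 1)) + ph R x ^ 2 * (2 * S.θx x s)) * S.hf x s)
          + ph R x ^ 2 * (2 * (S.θ x s - 1)) * ((S.Q x s - S.θ x s * S.ux x s) / S.v x s)))
      (g₁ := fun x => ph R x ^ 2 * S.θx x s ^ 2)
      (g₂ := fun x => 4 / R * |4 * ((S.θ x s - 1) ^ 2 * (S.θ x s ^ β / S.v x s))|)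
      (g₃ := fun x => ph R x ^ 2 * (S.θ x s - 1) ^ 2) (g₄ := fun x => ph R x ^ 2 * S.gr x s)
      (c₁ := -c) (c₂ := 1) (c₃ := k * S.A R s) (c₄ := k * S.A R s)
      (by fun_prop (disch := simp)) (by fun_prop) (by fun_prop (disch := simp)) (by fun_prop) (by fun_prop) hRR fun x hx => by
        obtain ⟨v1, v2, t1⟩ := Hv x
        have x2 := (Hx x hx).2.1
        have hv := S.v_pos x s
        have hθ := S.θ_pos x s
        have vinv : (S.v x s)⁻¹ ≤ B := inv_le_of_inv_le₀ hB0 v1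
        have hvi : 0 < (S.v x s)⁻¹ := inv_pos.2 hv
        have p0 := ph_mem hR0 hx
        have hQ := S.Q_le hα hB0 v1 v2
        have hQ0 := S.Q_nonneg hα x s
        have hg := S.gr_nonneg x s
        have ck : c ≤ S.θ x s ^ β / S.v x s := by
          rw [div_eq_mul_inv, hc]
          gcongr
        have dd : dph R x ^ 2 ≤ 4 / R := by
          have : dph R x ^ 2 ≤ (2 / R) ^ 2 := by
            rw [← sq_abs]; gcongr; exact dph_abs hR0 hx
          refine this.trans ?_
          rw [div_pow, div_le_div_iff₀ (by positivity) hR0]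
          nlinarith
        have hhf : S.hf x s = S.θ x s ^ β / S.v x s * S.θx x s := by unfold hf; ring
        have hκ0 : 0 < S.θ x s ^ β / S.v x s := by positivity
        rw [hhf, abs_of_nonneg (by positivity)]
        have s1 : -((2 * ph R x * dph R x * (2 * (S.θ x s - 1)) + ph R x ^ 2 * (2 * S.θx x s)) * (S.θ x s ^ β / S.v x s * S.θx x s))
          ≤ -c * (ph R x ^ 2 * S.θx x s ^ 2) + 1 * (4 / R * (4 * ((S.θ x s - 1) ^ 2 * (S.θ x s ^ β / S.v x s)))) := by
          set κ := S.θ x s ^ β / S.v x s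
          have a1 : c * (ph R x ^ 2 * S.θx x s ^ 2) ≤ κ * (ph R x ^ 2 * S.θx x s ^ 2) := by gcongr
          have a2 : dph R x ^ 2 * (4 * ((S.θ x s - 1) ^ 2 * κ)) ≤ 4 / R * (4 * ((S.θ x s - 1) ^ 2 * κ)) := by gcongr
          have a3 : 0 ≤ κ * (ph R x * S.θx x s + 2 * dph R x * (S.θ x s - 1)) ^ 2 := by positivity
          linarith
        have s2 : 2 * (S.θ x s - 1) * ((S.Q x s - S.θ x s * S.ux x s) / S.v x s) ≤
            k * S.A R s * (S.θ x s - 1) ^ 2 + k * S.A R s * S.gr x s := by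
          have b1 : |S.θ x s - 1| ≤ 2 * B * S.A R s := by
            have : B * 1 ≤ B * S.A R s := by gcongr
            rw [abs_le]; constructor <;> linarith
          have b2 : (S.θ x s - 1) * (S.Q x s * (S.v x s)⁻¹) ≤ 2 * B * S.A R s * (q * S.gr x s * B) := by
            refine le_trans (mul_le_mul_of_nonneg_right (le_abs_self _) (by positivity)) ?_
            gcongr
          have b3 : -(2 * (S.θ x s - 1) * S.ux x s) * (S.θ x s * (S.v x s)⁻¹) ≤
              ((S.θ x s - 1) ^ 2 + S.gr x s) * (B * S.A R s * B) := by
            have : -(2 * (S.θ x s - 1) * S.ux x s) ≤ (S.θ x s - 1) ^ 2 + S.gr x s := by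
              unfold gr
              nlinarith [sq_nonneg (S.θ x s - 1 + S.ux x s), sq_nonneg (S.wx 0 x s), sq_nonneg (S.wx 1 x s),
                sq_nonneg (S.bx 0 x s), sq_nonneg (S.bx 1 x s)]
            refine (mul_le_mul_of_nonneg_right this (by positivity)).trans ?_
            gcongr
          have b4 : 0 ≤ (K ^ 2 + 1) * S.A R s * ((S.θ x s - 1) ^ 2 + S.gr x s) := by positivity
          have b5 : 0 ≤ B ^ 2 * q * S.A R s * (S.θ x s - 1) ^ 2 := by positivity
          have b6 : 2 * (S.θ x s - 1) * ((S.Q x s - S.θ x s * S.ux x s) / S.v x s) =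
            2 * ((S.θ x s - 1) * (S.Q x s * (S.v x s)⁻¹)) + -(2 * (S.θ x s - 1) * S.ux x s) * (S.θ x s * (S.v x s)⁻¹) := by
            rw [div_eq_mul_inv]; ring
          rw [b6, hk]
          linarith
        have s3 := mul_le_mul_of_nonneg_left s2 (sq_nonneg (ph R x))
        linarith
    simp only [hX, hZ]
    linarith
  have i3 : ∫ s in (0 : ℝ)..t, 1 / T ≤ 1 := by
    rw [intervalIntegral.integral_const, smul_eq_mul, sub_zero, mul_one_div, div_le_one hT]; exact ht.2
  have k1 : K ^ 2 + 1 ≤ k := by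
    have : 0 ≤ B ^ 2 + 4 * B ^ 2 * q := by positivity
    linarith
  linarith

theorem sq_three (a b c : ℝ) : (a + b + c) ^ 2 ≤ 3 * (a ^ 2 + b ^ 2 + c ^ 2) := by
  nlinarith [sq_nonneg (a - b), sq_nonneg (b - c), sq_nonneg (a - c)]

theorem sq_four (a b c d : ℝ) : (a + b + c + d) ^ 2 ≤ 4 * (a ^ 2 + b ^ 2 + c ^ 2 + d ^ 2) := by
  nlinarith [sq_nonneg (a - b), sq_nonneg (b - c), sq_nonneg (a - c), sq_nonneg (a - d), sq_nonneg (b - d),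
    sq_nonneg (c - d)]

theorem gu_le (hα : 0 ≤ α) {B a x t : ℝ} (hB : 1 ≤ B) (h1 : B⁻¹ ≤ S.v x t)
    (hb : S.b 0 x t ^ 2 + S.b 1 x t ^ 2 ≤ B * a) :
    S.gu x t ^ 2 ≤ 4 * ((B ^ 2 + α * (α + 1) * B ^ (α + 2)) ^ 2 * (S.vx x t ^ 2 * S.ux x t ^ 2) + B ^ 2 * S.θx x t ^ 2
      + B ^ 4 * (S.θ x t ^ 2 * S.vx x t ^ 2) + B * a * (S.bx 0 x t ^ 2 + S.bx 1 x t ^ 2)) := by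
  have hB0 : 0 < B := by linarith
  have hv := S.v_pos x t
  have vinv : (S.v x t)⁻¹ ≤ B := inv_le_of_inv_le₀ hB0 h1
  have e : S.gu x t = mvd α (S.v x t) * (S.vx x t * S.ux x t) + -(S.v x t)⁻¹ * S.θx x t
    + (S.v x t)⁻¹ ^ 2 * (S.θ x t * S.vx x t) + -(S.b 0 x t * S.bx 0 x t + S.b 1 x t * S.bx 1 x t) := by
    unfold gu; ring
  rw [e]
  have hm := mvd_le hα hB0 h1
  have m2 : mvd α (S.v x t) ^ 2 ≤ (B ^ 2 + α * (α + 1) * B ^ (α + 2)) ^ 2 := by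
    rw [← sq_abs]; gcongr
  have r1 : (S.v x t)⁻¹ ^ 2 ≤ B ^ 2 := by gcongr
  have r2 : (S.v x t)⁻¹ ^ 4 ≤ B ^ 4 := by gcongr
  have cs : (S.b 0 x t * S.bx 0 x t + S.b 1 x t * S.bx 1 x t) ^ 2 ≤ B * a * (S.bx 0 x t ^ 2 + S.bx 1 x t ^ 2) := by
    refine le_trans ?_ (mul_le_mul_of_nonneg_right hb (by positivity))
    nlinarith [sq_nonneg (S.b 0 x t * S.bx 1 x t - S.b 1 x t * S.bx 0 x t)]
  refine (sq_four _ _ _ _).trans ?_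
  have u1 : (mvd α (S.v x t) * (S.vx x t * S.ux x t)) ^ 2 ≤
      (B ^ 2 + α * (α + 1) * B ^ (α + 2)) ^ 2 * (S.vx x t ^ 2 * S.ux x t ^ 2) := by
    rw [mul_pow, mul_pow]; gcongr
  have u2 : (-(S.v x t)⁻¹ * S.θx x t) ^ 2 ≤ B ^ 2 * S.θx x t ^ 2 := by
    rw [mul_pow, neg_sq]; gcongr
  have u3 : ((S.v x t)⁻¹ ^ 2 * (S.θ x t * S.vx x t)) ^ 2 ≤ B ^ 4 * (S.θ x t ^ 2 * S.vx x t ^ 2) := by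
    rw [mul_pow, mul_pow, ← pow_mul]; gcongr
  rw [neg_sq]
  linarith

theorem gw_le {B x t : ℝ} (hB : 1 ≤ B) (h1 : B⁻¹ ≤ S.v x t) (i : Fin 2) :
    S.gw i x t ^ 2 ≤ 3 * (S.bx i x t ^ 2 + B ^ 4 * (S.vx x t ^ 2 * S.wx i x t ^ 2)) := by
  have hB0 : 0 < B := by linarith
  have hv := S.v_pos x t
  have vinv : (S.v x t)⁻¹ ≤ B := inv_le_of_inv_le₀ hB0 h1
  have e : S.gw i x t = S.bx i x t + 0 + -((S.v x t)⁻¹ ^ 2 * (S.vx x t * S.wx i x t)) := by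
    unfold gw; ring
  have r2 : (S.v x t)⁻¹ ^ 4 ≤ B ^ 4 := by gcongr
  have u3 : ((S.v x t)⁻¹ ^ 2 * (S.vx x t * S.wx i x t)) ^ 2 ≤ B ^ 4 * (S.vx x t ^ 2 * S.wx i x t ^ 2) := by
    rw [mul_pow, mul_pow, ← pow_mul]; gcongr
  rw [e]
  refine (sq_three _ _ _).trans ?_
  rw [neg_sq]
  linarith

theorem gb_le {B a x t : ℝ} (hB : 1 ≤ B) (h1 : B⁻¹ ≤ S.v x t) (i : Fin 2) (hb : S.b i x t ^ 2 ≤ B * a) :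
    S.gb i x t ^ 2 ≤ 3 * B ^ 2 * (S.wx i x t ^ 2 + B * a * S.ux x t ^ 2
      + B ^ 4 * (S.vx x t ^ 2 * S.bx i x t ^ 2)) := by
  have hB0 : 0 < B := by linarith
  have hv := S.v_pos x t
  have vinv : (S.v x t)⁻¹ ≤ B := inv_le_of_inv_le₀ hB0 h1
  have e : S.gb i x t = (S.v x t)⁻¹ * (S.wx i x t + -(S.b i x t * S.ux x t)
      + -((S.v x t)⁻¹ ^ 2 * (S.vx x t * S.bx i x t))) := by
    unfold gb; ring
  have r1 : (S.v x t)⁻¹ ^ 2 ≤ B ^ 2 := by gcongr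
  have r2 : (S.v x t)⁻¹ ^ 4 ≤ B ^ 4 := by gcongr
  have u2 : (S.b i x t * S.ux x t) ^ 2 ≤ B * a * S.ux x t ^ 2 := by
    rw [mul_pow]; gcongr
  have u3 : ((S.v x t)⁻¹ ^ 2 * (S.vx x t * S.bx i x t)) ^ 2 ≤ B ^ 4 * (S.vx x t ^ 2 * S.bx i x t ^ 2) := by
    rw [mul_pow, mul_pow, ← pow_mul]; gcongr
  rw [e, mul_pow]
  have u := sq_three (S.wx i x t) (-(S.b i x t * S.ux x t)) (-((S.v x t)⁻¹ ^ 2 * (S.vx x t * S.bx i x t)))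
  rw [neg_sq, neg_sq] at u
  calc _ ≤ B ^ 2 * (3 * (S.wx i x t ^ 2 + B * a * S.ux x t ^ 2
      + B ^ 4 * (S.vx x t ^ 2 * S.bx i x t ^ 2))) := by
        gcongr
        linarith
    _ = _ := by ring

set_option maxHeartbeats 1000000 in
/-- Pointwise bound of the lower order terms. -/
theorem src_le (hα : 0 ≤ α) {B a x t : ℝ} (hB : 1 ≤ B) (ha : 1 ≤ a) (h1 : B⁻¹ ≤ S.v x t)
    (hb : S.b 0 x t ^ 2 + S.b 1 x t ^ 2 ≤ B * a) :
    S.src x t ≤ (4 * (B ^ 2 + α * (α + 1) * B ^ (α + 2)) ^ 2 + 20 * B ^ 6) *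
      (S.vx x t ^ 2 * S.gr x t + S.θx x t ^ 2 + S.θ x t ^ 2 * S.vx x t ^ 2 + a * S.gr x t) := by
  have hB0 : 0 < B := by linarith
  have h2 := S.gu_le hα hB h1 hb
  have h3 := S.gw_le hB h1 0
  have h4 := S.gw_le hB h1 1
  have h5 := S.gb_le (a := a) hB h1 0 (by linarith [sq_nonneg (S.b 1 x t)])
  have h6 := S.gb_le (a := a) hB h1 1 (by linarith [sq_nonneg (S.b 0 x t)])
  set D := (B ^ 2 + α * (α + 1) * B ^ (α + 2)) ^ 2
  have hD : 0 ≤ D := by positivity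
  set k := 4 * D + 20 * B ^ 6 with hk
  have p1 : B ≤ B ^ 6 := le_self_pow₀ hB (by norm_num)
  have p2 : B ^ 2 ≤ B ^ 6 := pow_le_pow_right₀ hB (by norm_num)
  have p3 : B ^ 3 ≤ B ^ 6 := pow_le_pow_right₀ hB (by norm_num)
  have p4 : B ^ 4 ≤ B ^ 6 := pow_le_pow_right₀ hB (by norm_num)
  have p0 : 1 ≤ B ^ 6 := one_le_pow₀ hB
  have q1 : 4 * D ≤ k := by linarith
  have q2 : 4 * B ^ 2 ≤ k := by linarith
  have q3 : 4 * B ^ 4 ≤ k := by linarith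
  have q4 : 4 * B + 3 ≤ k := by linarith
  have q5 : 3 * B ^ 6 ≤ k := by linarith
  have q6 : 6 * B ^ 3 ≤ k := by linarith
  have q7 : 3 * B ^ 2 ≤ k := by linarith
  have k0 : 0 ≤ k := by positivity
  have a0 : 0 ≤ a := by linarith
  unfold src gr
  set V := S.vx x t ^ 2 with hV
  have V0 : 0 ≤ V := sq_nonneg _
  have z1 := mul_le_mul_of_nonneg_right q1 (by positivity : 0 ≤ V * S.ux x t ^ 2)
  have z2 := mul_le_mul_of_nonneg_right q2 (sq_nonneg (S.θx x t))
  have z3 := mul_le_mul_of_nonneg_right q3 (by positivity : 0 ≤ S.θ x t ^ 2 * V)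
  have z4 : ∀ i, 4 * (B * a * S.bx i x t ^ 2) + 3 * S.bx i x t ^ 2 ≤ k * (a * S.bx i x t ^ 2) := fun i => by
    have h7 := mul_le_mul_of_nonneg_right q4 (by positivity : 0 ≤ a * S.bx i x t ^ 2)
    have h8 : S.bx i x t ^ 2 ≤ a * S.bx i x t ^ 2 := le_mul_of_one_le_left (sq_nonneg _) ha
    linarith
  have z5 : ∀ i, 3 * (B ^ 4 * (V * S.wx i x t ^ 2)) ≤ k * (V * S.wx i x t ^ 2) := fun i => by
    have := mul_le_mul_of_nonneg_right (by linarith : 3 * B ^ 4 ≤ k) (by positivity : 0 ≤ V * S.wx i x t ^ 2)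
    linarith
  have z6 : ∀ i, 3 * B ^ 2 * S.wx i x t ^ 2 ≤ k * (a * S.wx i x t ^ 2) := fun i => by
    have := mul_le_mul_of_nonneg_right q7 (by positivity : 0 ≤ a * S.wx i x t ^ 2)
    have : 3 * B ^ 2 * S.wx i x t ^ 2 ≤ 3 * B ^ 2 * (a * S.wx i x t ^ 2) := by
      gcongr; exact le_mul_of_one_le_left (sq_nonneg _) ha
    linarith
  have z7 : 6 * B ^ 3 * (a * S.ux x t ^ 2) ≤ k * (a * S.ux x t ^ 2) :=
    mul_le_mul_of_nonneg_right q6 (by positivity)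
  have z8 : ∀ i, 3 * B ^ 6 * (V * S.bx i x t ^ 2) ≤ k * (V * S.bx i x t ^ 2) := fun i =>
    mul_le_mul_of_nonneg_right q5 (by positivity)
  have y4 := add_le_add (z4 0) (z4 1)
  have y5 := add_le_add (z5 0) (z5 1)
  have y6 := add_le_add (z6 0) (z6 1)
  have y8 := add_le_add (z8 0) (z8 1)
  clear z4 z5 z6 z8 q1 q2 q3 q4 q5 q6 q7 p0 p1 p2 p3 p4 hk
  linarith only [y4, y5, y6, y8, z1, z2, z3, z7, h2, h3, h4, h5, h6]

theorem sup_gr {R ε : ℝ} (hR : 1 ≤ R) (hε : 0 < ε) {x : ℝ} (hx : x ∈ Icc (-R) R) (t : ℝ) :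
    ph R x ^ 2 * S.gr x t ≤ ε * (∫ y in (-R)..R, ph R y ^ 2 * S.gr2 y t) + (1 / ε + 4) * ∫ y in (-R)..R, S.gr y t := by
  have e1 := sup_weight (f := fun x => S.ux x t) (fx := fun x => S.uxx x t) (by fun_prop) (by fun_prop) (fun x => S.dux x t) hR hε hx
  have e2 := fun i => sup_weight (f := fun x => S.wx i x t) (fx := fun x => S.wxx i x t) (by fun_prop) (by fun_prop) (fun x => S.dwx i x t) hR hε hx
  have e3 := fun i => sup_weight (f := fun x => S.bx i x t) (fx := fun x => S.bxx i x t) (by fun_prop) (by fun_prop) (fun x => S.dbx i x t) hR hε hx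
  have cp : Continuous fun x => ph R x ^ 2 := by fun_prop
  have f1 : ∫ x in (-R)..R, ph R x ^ 2 * S.gr2 x t = _ := int_five cp (f₁ := fun x => S.uxx x t ^ 2)
    (f₂ := fun x => S.wxx 0 x t ^ 2) (f₃ := fun x => S.wxx 1 x t ^ 2) (f₄ := fun x => S.bxx 0 x t ^ 2)
    (f₅ := fun x => S.bxx 1 x t ^ 2) (by fun_prop) (by fun_prop) (by fun_prop) (by fun_prop) (by fun_prop)
  have f2 := int_five (a := -R) (b := R) (φ := fun _ => 1) continuous_const (f₁ := fun x => S.ux x t ^ 2)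
    (f₂ := fun x => S.wx 0 x t ^ 2) (f₃ := fun x => S.wx 1 x t ^ 2) (f₄ := fun x => S.bx 0 x t ^ 2)
    (f₅ := fun x => S.bx 1 x t ^ 2) (by fun_prop) (by fun_prop) (by fun_prop) (by fun_prop) (by fun_prop)
  simp only [one_mul] at f2
  have f3 : ∫ x in (-R)..R, S.gr x t = _ := f2
  rw [f1, f3]
  unfold gr
  linarith [e2 0, e2 1, e3 0, e3 1]

theorem gr_int (hα : 0 ≤ α) (hβ : 0 < β) {B L t : ℝ} (hB : 0 < B) (hL : 0 ≤ L) (h : ∀ x, S.v x t ≤ B) :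
    ∫ x in (-L)..L, S.gr x t ≤ B * S.A L t := by
  have := int_le_one (f := fun x => S.gr x t) (g₁ := fun x => S.diss (pp β) x t + S.diss 0 x t) (c₁ := B)
    (a := -L) (b := L) (by fun_prop) (by fun_prop) (by linarith) fun x _ => by
      have := S.grad_le_diss hα hB (h x)
      have := mul_nonneg hB.le (S.diss_nonneg hα (pp_pos hβ).le x t)
      unfold gr; linarith
  refine this.trans ?_
  unfold A
  gcongr
  linarith

theorem θ_int {B E L t : ℝ} (hB : 1 ≤ B) (hL : 0 ≤ L) (hA : 1 ≤ S.A L t)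
    (h : ∀ x ∈ Icc (-L) L, S.θ x t ≤ B * S.A L t) (hE : ∫ x in (-L)..L, lg (S.θ x t) ≤ E) :
    ∫ x in (-L)..L, (S.θ x t - 1) ^ 2 ≤ 4 * B * E * S.A L t := by
  have := int_le_one (f := fun x => (S.θ x t - 1) ^ 2) (g₁ := fun x => lg (S.θ x t)) (c₁ := 4 * B * S.A L t)
    (a := -L) (b := L) (by fun_prop) (by unfold lg; fun_prop (disch := simp)) (by linarith) fun x hx => by
      have h1 := sq_le_lg (S.θ_pos x t)
      have h2 : 0 ≤ S.θ x t - Real.log (S.θ x t) - 1 := by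
        linarith [Real.log_le_sub_one_of_pos (S.θ_pos x t)]
      have h3 := h x hx
      have h4 : 1 * 1 ≤ B * S.A L t := by gcongr
      unfold lg
      exact h1.trans (mul_le_mul_of_nonneg_right (by linarith) h2)
  calc _ ≤ _ := this
    _ ≤ 4 * B * S.A L t * E := by gcongr
    _ = _ := by ring

set_option maxHeartbeats 1000000 in
/-- Integral bound of the lower order terms. -/
theorem src_int (hα : 0 ≤ α) (hT : 0 < T) (hδ : 0 < δ) (hβ : 0 < β) :
    ∃ k, 0 < k ∧ ∀ ε, 0 < ε → ∃ k', 0 < k' ∧ ∀ S : Sol α β T K δ, ∀ R, 2 ≤ R → ∀ t ∈ Icc 0 T,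
      ∫ x in (-R)..R, ph R x ^ 2 * S.src x t ≤ ε * (∫ x in (-R)..R, ph R x ^ 2 * S.gr2 x t)
        + k * (∫ x in (-R)..R, ph R x ^ 2 * S.θx x t ^ 2)
        + k' * S.A R t * (1 + ∫ x in (-R)..R, ph R x ^ 2 * S.gr x t) := by
  obtain ⟨B, hB, H⟩ := bounds (K := K) hα hT hδ hβ
  obtain ⟨E, hE, HE⟩ := energy_int (β := β) (K := K) hα hT hδ
  obtain ⟨V, hV, HV⟩ := vx_int (K := K) hα hT hδ hβ
  have hB0 : 0 < B := by linarith
  set k := 4 * (B ^ 2 + α * (α + 1) * B ^ (α + 2)) ^ 2 + 20 * B ^ 6 with hk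
  have k0 : 0 < k := by positivity
  refine ⟨k + 2 * k * V, by positivity, fun ε hε => ?_⟩
  set η := ε / (k * V) with hη
  have η0 : 0 < η := by positivity
  refine ⟨k * V * ((1 / η + 4) * B) + k * V * (40 * B * E + 2) + k, by positivity, fun S R hR t ht => ?_⟩
  obtain ⟨Hv, HL⟩ := H S t ht
  have Hx := (HL R (by linarith)).1
  have hA := S.A_ge hα hβ (by linarith : 0 ≤ R) t
  have hRR : -R ≤ R := by linarith
  have hR0 : 0 < R := by linarith
  have g1 := S.gr_int hα hβ hB0 hR0.le fun x => (Hv x).2.1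
  have g2 := S.θ_int hB hR0.le hA (fun x hx => (Hx x hx).2.1) (HE S t ht (-R) R hRR).2.2.2.2.1
  have g3 := HV S t ht R (by linarith)
  have G20 : 0 ≤ ∫ x in (-R)..R, ph R x ^ 2 * S.gr2 x t :=
    int_nonneg hRR fun x => mul_nonneg (by positivity) (S.gr2_nonneg x t)
  have D0 : 0 ≤ ∫ x in (-R)..R, ph R x ^ 2 * S.θx x t ^ 2 := int_nonneg hRR fun x => by positivity
  have Z0 : 0 ≤ ∫ x in (-R)..R, ph R x ^ 2 * S.gr x t :=
    int_nonneg hRR fun x => mul_nonneg (by positivity) (S.gr_nonneg x t)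
  set s1 := η * (∫ y in (-R)..R, ph R y ^ 2 * S.gr2 y t) + (1 / η + 4) * (B * S.A R t) with hs1
  set s2 := 2 * (∫ y in (-R)..R, ph R y ^ 2 * S.θx y t ^ 2) + 10 * (4 * B * E * S.A R t) + 2 with hs2
  have main := int_le_four (f := fun x => ph R x ^ 2 * S.src x t) (g₁ := fun x => S.vx x t ^ 2)
    (g₂ := fun x => ph R x ^ 2 * S.θx x t ^ 2) (g₃ := fun x => S.vx x t ^ 2) (g₄ := fun x => ph R x ^ 2 * S.gr x t)
    (c₁ := k * s1) (c₂ := k) (c₃ := k * s2) (c₄ := k * S.A R t)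
    (by fun_prop) (by fun_prop) (by fun_prop) (by fun_prop) (by fun_prop) hRR fun x hx => by
      have hs := S.src_le hα hB hA (Hv x).1 (Hx x hx).2.2
      rw [← hk] at hs
      have a1 : ph R x ^ 2 * S.gr x t ≤ s1 := by
        refine (S.sup_gr (by linarith) η0 hx t).trans ?_
        rw [hs1]; gcongr
      have a2 : ph R x ^ 2 * S.θ x t ^ 2 ≤ s2 := by
        have u1 := sup_weight (f := fun x => S.θ x t - 1) (fx := fun x => S.θx x t) (by fun_prop) (by fun_prop)
          (fun x => (S.dθ x t).sub_const 1) (R := R) (by linarith) one_pos hx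
        have u2 : ph R x ^ 2 ≤ 1 := by
          have := ph_mem hR0 hx; nlinarith
        have u3 : S.θ x t ^ 2 ≤ 2 * (S.θ x t - 1) ^ 2 + 2 := by nlinarith [sq_nonneg (S.θ x t - 2)]
        have u4 := mul_le_mul_of_nonneg_left u3 (sq_nonneg (ph R x))
        rw [hs2]
        linarith
      have hp := mul_le_mul_of_nonneg_left hs (sq_nonneg (ph R x))
      have b1 := mul_le_mul_of_nonneg_left a1 (by positivity : 0 ≤ k * S.vx x t ^ 2)
      have b2 := mul_le_mul_of_nonneg_left a2 (by positivity : 0 ≤ k * S.vx x t ^ 2)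
      linarith
  have s10 : 0 ≤ s1 := by positivity
  have s20 : 0 ≤ s2 := by positivity
  have m1 : k * s1 * (∫ x in (-R)..R, S.vx x t ^ 2) ≤ k * s1 * V := by gcongr
  have m2 : k * s2 * (∫ x in (-R)..R, S.vx x t ^ 2) ≤ k * s2 * V := by gcongr
  have m3 : k * s1 * V = ε * (∫ x in (-R)..R, ph R x ^ 2 * S.gr2 x t) + k * V * ((1 / η + 4) * B) * S.A R t := by
    rw [hs1]
    have : k * V * η = ε := by rw [hη]; field_simp
    rw [← this]; ring
  have m4 : k * s2 * V ≤ 2 * k * V * (∫ x in (-R)..R, ph R x ^ 2 * S.θx x t ^ 2) + k * V * (40 * B * E + 2) * S.A R t := by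
    have : 2 * (k * V) ≤ 2 * (k * V) * S.A R t := by nlinarith [mul_pos k0 hV]
    rw [hs2]
    linarith
  have m5 : 0 ≤ k * S.A R t := by positivity
  have m6 : 0 ≤ (k * V * ((1 / η + 4) * B) + k * V * (40 * B * E + 2)) * S.A R t * ∫ x in (-R)..R, ph R x ^ 2 * S.gr x t := by
    positivity
  linarith

set_option maxHeartbeats 1000000 in
/-- Weighted first order estimate. -/
theorem first_order_weight (hα : 0 ≤ α) (hT : 0 < T) (hδ : 0 < δ) (hβ : 0 < β) :
    ∃ C, 0 < C ∧ ∀ S : Sol α β T K δ, ∃ R₀, ∀ R, 2 ≤ R → R₀ ≤ R → ∀ t ∈ Icc 0 T,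
      ∫ x in (-R)..R, ph R x ^ 2 * (S.θ x t - 1) ^ 2 ≤ C ∧
      ∫ x in (-R)..R, ph R x ^ 2 * S.gr x t ≤ C ∧
      ∫ s in (0 : ℝ)..t, ∫ x in (-R)..R, ph R x ^ 2 * S.θx x s ^ 2 ≤ C ∧
      ∫ s in (0 : ℝ)..t, ∫ x in (-R)..R, ph R x ^ 2 * S.gr2 x s ≤ C := by
  obtain ⟨B, hB, H⟩ := bounds (K := K) hα hT hδ hβ
  obtain ⟨c₁, k₁, hc₁, hk₁, H₁⟩ := grad_energy (K := K) hα hT hδ hβ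
  obtain ⟨c₂, k₂, hc₂, hk₂, H₂⟩ := temp_energy (K := K) hα hT hδ hβ
  obtain ⟨k₃, hk₃, H₃⟩ := src_int (K := K) hα hT hδ hβ
  obtain ⟨k₄, hk₄, H₄⟩ := H₃ (c₁ / (2 * k₁)) (by positivity)
  have hB0 : 0 < B := by linarith
  set N := (k₁ * k₃ + 1) / c₂ + 1 with hN
  have N1 : 1 ≤ N := by
    have : 0 < (k₁ * k₃ + 1) / c₂ := by positivity
    linarith
  set κ := N * k₂ + k₁ * k₄ with hκ
  have hκ0 : 0 < κ := by positivity
  set c₀ := N * k₂ + k₁ + k₁ * k₄ * B with hc₀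
  have hc₀0 : 0 < c₀ := by positivity
  set C := c₀ * Real.exp (κ * B) with hC
  have hC0 : 0 < C := by positivity
  refine ⟨C + 2 / c₁ * C, by positivity, fun S => ?_⟩
  obtain ⟨R₀, HR⟩ := H₂ S
  refine ⟨R₀, fun R hR hRR₀ t ht => ?_⟩
  have hR0 : 0 < R := by linarith
  have hRR : -R ≤ R := by linarith
  have hA : ∀ s, 1 ≤ S.A R s := fun s => S.A_ge hα hβ hR0.le s
  have hA0 : ∀ s, 0 ≤ S.A R s := fun s => zero_le_one.trans (hA s)
  set X := fun s => ∫ x in (-R)..R, ph R x ^ 2 * (S.θ x s - 1) ^ 2 with hX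
  set Z := fun s => ∫ x in (-R)..R, ph R x ^ 2 * S.gr x s with hZ
  set D := fun s => ∫ x in (-R)..R, ph R x ^ 2 * S.θx x s ^ 2 with hD
  set G := fun s => ∫ x in (-R)..R, ph R x ^ 2 * S.gr2 x s with hG
  have cX : Continuous X := cont_int (f := fun x s => ph R x ^ 2 * (S.θ x s - 1) ^ 2) (by fun_prop)
  have cZ : Continuous Z := cont_int (f := fun x s => ph R x ^ 2 * S.gr x s) (by fun_prop)
  have cD : Continuous D := cont_int (f := fun x s => ph R x ^ 2 * S.θx x s ^ 2) (by fun_prop)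
  have cG : Continuous G := cont_int (f := fun x s => ph R x ^ 2 * S.gr2 x s) (by fun_prop)
  have X0 : ∀ s, 0 ≤ X s := fun s => int_nonneg hRR fun x => by positivity
  have Z0 : ∀ s, 0 ≤ Z s := fun s => int_nonneg hRR fun x => mul_nonneg (by positivity) (S.gr_nonneg x s)
  have D0 : ∀ s, 0 ≤ D s := fun s => int_nonneg hRR fun x => by positivity
  have G0 : ∀ s, 0 ≤ G s := fun s => int_nonneg hRR fun x => mul_nonneg (by positivity) (S.gr2_nonneg x s)
  set Y := fun s => N * X s + Z s with hY
  have cY : Continuous Y := by fun_prop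
  have key : ∀ t ∈ Icc 0 T, Y t + (∫ s in (0 : ℝ)..t, D s) + c₁ / 2 * (∫ s in (0 : ℝ)..t, G s) ≤
      c₀ + ∫ s in (0 : ℝ)..t, κ * S.A R s * Y s := by
    intro t ht
    have e1 := H₁ S R hR t ht
    have e2 := HR R hR hRR₀ t ht
    have e3 : ∫ s in (0 : ℝ)..t, ∫ x in (-R)..R, ph R x ^ 2 * S.src x s ≤ c₁ / (2 * k₁) * (∫ s in (0 : ℝ)..t, G s)
        + k₃ * (∫ s in (0 : ℝ)..t, D s) + k₄ * (∫ s in (0 : ℝ)..t, S.A R s) + k₄ * ∫ s in (0 : ℝ)..t, S.A R s * Z s := by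
      refine int_le_four (cont_int (f := fun x s => ph R x ^ 2 * S.src x s) (by fun_prop)) cG cD (by fun_prop) (by fun_prop)
        ht.1 fun s hs => ?_
      have := H₄ S R hR s ⟨hs.1, hs.2.trans ht.2⟩
      simp only [hG, hD, hZ]
      linarith
    have e4 := ((H S t ht).2 R (by linarith)).2
    have e5 : N * k₂ * (∫ s in (0 : ℝ)..t, S.A R s * (X s + Z s)) + k₁ * k₄ * (∫ s in (0 : ℝ)..t, S.A R s * Z s) ≤
        ∫ s in (0 : ℝ)..t, κ * S.A R s * Y s := by
      rw [← intervalIntegral.integral_const_mul, ← intervalIntegral.integral_const_mul, ← int_add (by fun_prop) (by fun_prop)]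
      refine int_mono (by fun_prop) (by fun_prop) ht.1 fun s _ => ?_
      have hA := hA0 s
      have q1 : X s ≤ N * X s := le_mul_of_one_le_left (X0 s) N1
      have q2 : N * k₂ * (S.A R s * (X s + Z s)) ≤ N * k₂ * (S.A R s * Y s) := by
        have : X s + Z s ≤ Y s := by simp only [hY]; linarith
        gcongr
      have q3 : k₁ * k₄ * (S.A R s * Z s) ≤ k₁ * k₄ * (S.A R s * Y s) := by
        have : Z s ≤ Y s := by
          have := X0 s
          have : 0 ≤ N * X s := by positivity
          simp only [hY]; linarith
        gcongr
      rw [hκ]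
      linarith
    have e6 : ∫ s in (0 : ℝ)..t, k₂ * S.A R s * (X s + Z s) = k₂ * ∫ s in (0 : ℝ)..t, S.A R s * (X s + Z s) := by
      rw [← intervalIntegral.integral_const_mul]; congr 1; ext s; ring
    have e2' : X t + c₂ * (∫ s in (0 : ℝ)..t, D s) ≤ k₂ + k₂ * ∫ s in (0 : ℝ)..t, S.A R s * (X s + Z s) := by
      rw [← e6]; exact e2
    have e7 := mul_le_mul_of_nonneg_left e2' (by linarith : 0 ≤ N)
    have ID : 0 ≤ ∫ s in (0 : ℝ)..t, D s := int_nonneg ht.1 D0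
    have e8 : (k₁ * k₃ + 1) * (∫ s in (0 : ℝ)..t, D s) ≤ N * c₂ * ∫ s in (0 : ℝ)..t, D s := by
      have : N * c₂ = k₁ * k₃ + 1 + c₂ := by rw [hN]; field_simp
      rw [this]
      exact mul_le_mul_of_nonneg_right (by linarith) ID
    have e9 := mul_le_mul_of_nonneg_left e3 hk₁.le
    have e10 : k₁ * (c₁ / (2 * k₁) * (∫ s in (0 : ℝ)..t, G s)) = c₁ / 2 * ∫ s in (0 : ℝ)..t, G s := by
      field_simp
    have e11 : k₁ * k₄ * (∫ s in (0 : ℝ)..t, S.A R s) ≤ k₁ * k₄ * B := by gcongr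
    have e1' : Z t + c₁ * (∫ s in (0 : ℝ)..t, G s) ≤
        k₁ * (1 + ∫ s in (0 : ℝ)..t, ∫ x in (-R)..R, ph R x ^ 2 * S.src x s) := e1
    simp only [hY] at e5 ⊢
    rw [hc₀]
    linarith
  have ID : 0 ≤ ∫ s in (0 : ℝ)..t, D s := int_nonneg ht.1 D0
  have IG : 0 ≤ ∫ s in (0 : ℝ)..t, G s := int_nonneg ht.1 G0
  have Y0 : 0 ≤ N * X t := mul_nonneg (by linarith) (X0 t)
  have q1 : X t ≤ N * X t := le_mul_of_one_le_left (X0 t) N1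
  have g1 := gronwall cY (a := fun s => κ * S.A R s) (by fun_prop) (fun s => mul_nonneg hκ0.le (hA0 s)) (fun t ht => by
    have := key t ht
    have ID : 0 ≤ ∫ s in (0 : ℝ)..t, D s := int_nonneg ht.1 D0
    have IG : 0 ≤ c₁ / 2 * ∫ s in (0 : ℝ)..t, G s := mul_nonneg (by positivity) (int_nonneg ht.1 G0)
    have hYt : Y t ≤ c₀ + ∫ s in (0 : ℝ)..t, κ * S.A R s * Y s := by linarith
    exact hYt) ht
  have g2 : Y t + (∫ s in (0 : ℝ)..t, D s) + c₁ / 2 * (∫ s in (0 : ℝ)..t, G s) ≤ C := by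
    refine (key t ht).trans (g1.trans ?_)
    rw [intervalIntegral.integral_const_mul]
    have := ((H S t ht).2 R (by linarith)).2
    rw [hC]
    gcongr
  have g3 : 0 ≤ c₁ / 2 * (∫ s in (0 : ℝ)..t, G s) := by positivity
  have g4 : 0 ≤ 2 / c₁ * C := by positivity
  have g5 : (∫ s in (0 : ℝ)..t, G s) ≤ 2 / c₁ * C := by
    have : c₁ / 2 * (∫ s in (0 : ℝ)..t, G s) ≤ C := by
      have := Z0 t
      simp only [hY] at g2
      linarith
    calc _ = 2 / c₁ * (c₁ / 2 * (∫ s in (0 : ℝ)..t, G s)) := by field_simp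
      _ ≤ _ := by gcongr
  have z := Z0 t
  simp only [hY] at g2
  refine ⟨?_, ?_, ?_, ?_⟩
  · change X t ≤ _; linarith
  · change Z t ≤ _; linarith
  · change (∫ s in (0 : ℝ)..t, D s) ≤ _; linarith
  · change (∫ s in (0 : ℝ)..t, G s) ≤ _; linarith

/-- First order estimate. -/
theorem first_order (hα : 0 ≤ α) (hT : 0 < T) (hδ : 0 < δ) (hβ : 0 < β) :
    ∃ C, 0 < C ∧ ∀ S : Sol α β T K δ, ∀ t ∈ Icc 0 T, ∀ L, 1 ≤ L →
      ∫ x in (-L)..L, (S.θ x t - 1) ^ 2 ≤ C ∧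
      ∫ x in (-L)..L, S.gr x t ≤ C ∧
      ∫ s in (0 : ℝ)..t, ∫ x in (-L)..L, S.θx x s ^ 2 ≤ C ∧
      ∫ s in (0 : ℝ)..t, ∫ x in (-L)..L, S.gr2 x s ≤ C := by
  obtain ⟨C, hC, H⟩ := first_order_weight (K := K) hα hT hδ hβ
  refine ⟨2 * C, by positivity, fun S t ht L hL => ?_⟩
  obtain ⟨R₀, HR⟩ := H S
  obtain ⟨h1, h2, h3, h4⟩ := HR (max (2 * L) R₀) (by linarith [le_max_left (2 * L) R₀]) (le_max_right _ _) t ht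
  have hR := le_max_left (2 * L) R₀
  set R := max (2 * L) R₀
  have hL0 : 0 < L := by linarith
  refine ⟨?_, ?_, ?_, ?_⟩
  · exact (int_le_weight (by fun_prop) (fun x => sq_nonneg _) hL0 hR).trans (by linarith)
  · exact (int_le_weight (by fun_prop) (fun x => S.gr_nonneg x t) hL0 hR).trans (by linarith)
  · exact (int_le_weight2 (f := fun x s => S.θx x s ^ 2) (by fun_prop) (fun x t => sq_nonneg _) hL0 ht.1 hR).trans (by linarith)
  · exact (int_le_weight2 (f := fun x s => S.gr2 x s) (by fun_prop) (fun x t => S.gr2_nonneg x t) hL0 ht.1 hR).trans (by linarith)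

theorem sup_gr_int {R x : ℝ} (hR : 1 ≤ R) (hx : x ∈ Icc (-R) R) (t : ℝ) :
    S.gr x t ≤ 2 * (∫ y in (-R)..R, S.gr y t) + ∫ y in (-R)..R, S.gr2 y t := by
  obtain ⟨a, a1, a2, a3⟩ := exists_unit hR hx
  have key : ∀ {f fx : ℝ → ℝ}, Continuous f → Continuous fx → (∀ x, HasDerivAt f (fx x) x) →
      f x ^ 2 ≤ 2 * (∫ y in (-R)..R, f y ^ 2) + ∫ y in (-R)..R, fx y ^ 2 := by
    intro f fx cf cfx hd
    have h1 := sup_unit cf cfx hd a3 rfl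
    have h2 := int_subset (f := fun y => f y ^ 2) (by fun_prop) (fun x => sq_nonneg _) a1 (by linarith : a ≤ a + 1) a2
    have h3 := int_subset (f := fun y => fx y ^ 2) (by fun_prop) (fun x => sq_nonneg _) a1 (by linarith : a ≤ a + 1) a2
    linarith
  have e1 := key (f := fun x => S.ux x t) (fx := fun x => S.uxx x t) (by fun_prop) (by fun_prop) (fun x => S.dux x t)
  have e2 := fun i => key (f := fun x => S.wx i x t) (fx := fun x => S.wxx i x t) (by fun_prop) (by fun_prop) (fun x => S.dwx i x t)
  have e3 := fun i => key (f := fun x => S.bx i x t) (fx := fun x => S.bxx i x t) (by fun_prop) (by fun_prop) (fun x => S.dbx i x t)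
  have f1 := int_five (a := -R) (b := R) (φ := fun _ => 1) continuous_const (f₁ := fun x => S.uxx x t ^ 2)
    (f₂ := fun x => S.wxx 0 x t ^ 2) (f₃ := fun x => S.wxx 1 x t ^ 2) (f₄ := fun x => S.bxx 0 x t ^ 2)
    (f₅ := fun x => S.bxx 1 x t ^ 2) (by fun_prop) (by fun_prop) (by fun_prop) (by fun_prop) (by fun_prop)
  have f2 := int_five (a := -R) (b := R) (φ := fun _ => 1) continuous_const (f₁ := fun x => S.ux x t ^ 2)
    (f₂ := fun x => S.wx 0 x t ^ 2) (f₃ := fun x => S.wx 1 x t ^ 2) (f₄ := fun x => S.bx 0 x t ^ 2)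
    (f₅ := fun x => S.bx 1 x t ^ 2) (by fun_prop) (by fun_prop) (by fun_prop) (by fun_prop) (by fun_prop)
  simp only [one_mul] at f1 f2
  have f3 : ∫ x in (-R)..R, S.gr x t = _ := f2
  have f4 : ∫ x in (-R)..R, S.gr2 x t = _ := f1
  rw [f3, f4]
  unfold gr
  linarith [e2 0, e2 1, e3 0, e3 1]

/-- Power of the temperature which linearises the heat flux. -/
def Th (x t : ℝ) : ℝ := S.θ x t ^ (β + 1) / (β + 1)

/-- Spatial derivative of `Th`. -/
def Thx (x t : ℝ) : ℝ := S.θ x t ^ β * S.θx x t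

/-- Second spatial derivative of `Th`. -/
def Thxx (x t : ℝ) : ℝ := S.θ x t ^ β * S.θxx x t + β * S.θ x t ^ (β - 1) * S.θx x t ^ 2

section
variable {X : Type*} [TopologicalSpace X] {g h : X → ℝ}
@[fun_prop] theorem fTh (hg : Continuous g) (hh : Continuous h) : Continuous fun x => S.Th (g x) (h x) := by
  unfold Th; fun_prop (disch := simp)
@[fun_prop] theorem fThx (hg : Continuous g) (hh : Continuous h) : Continuous fun x => S.Thx (g x) (h x) := by
  unfold Thx; fun_prop (disch := simp)
@[fun_prop] theorem fThxx (hg : Continuous g) (hh : Continuous h) : Continuous fun x => S.Thxx (g x) (h x) := by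
  unfold Thxx; fun_prop (disch := simp)
end

theorem Th_deriv (hβ : 0 < β) (x t : ℝ) : HasDerivAt (fun y => S.Th y t) (S.Thx x t) x := by
  unfold Th Thx
  refine (((S.dθ x t).rpow_const (p := β + 1) (Or.inl (S.θ_ne x t))).div_const (β + 1)).congr_deriv ?_
  have : β + 1 ≠ 0 := by linarith
  rw [add_sub_cancel_right]
  field_simp

theorem Thx_deriv (x t : ℝ) : HasDerivAt (fun y => S.Thx y t) (S.Thxx x t) x := by
  unfold Thx Thxx
  refine (((S.dθ x t).rpow_const (Or.inl (S.θ_ne x t))).fun_mul (S.dθx x t)).congr_deriv ?_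
  ring

theorem Th_deriv_t (hβ : 0 < β) (x : ℝ) {t : ℝ} (ht : t ∈ Ioo 0 T) :
    HasDerivAt (S.Th x) (S.θ x t ^ β * S.θt x t) t := by
  have := ((S.dθt x t ht).rpow_const (p := β + 1) (Or.inl (S.θ_ne x t))).div_const (β + 1)
  refine this.congr_deriv ?_
  have : β + 1 ≠ 0 := by linarith
  rw [add_sub_cancel_right]
  field_simp

/-- Weighted energy of the heat flux. -/
def J (R t : ℝ) : ℝ := ∫ x in (-R)..R, ph R x ^ 2 / S.v x t * S.Thx x t ^ 2

theorem J_cont (R : ℝ) : Continuous (S.J R) :=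
  cont_int (f := fun x t => ph R x ^ 2 / S.v x t * S.Thx x t ^ 2) (by fun_prop (disch := simp))

theorem J_nonneg {R : ℝ} (hR : 0 ≤ R) (t : ℝ) : 0 ≤ S.J R t :=
  int_nonneg (by linarith) fun x => by have := S.v_pos x t; positivity

set_option maxHeartbeats 1000000 in
theorem Th_sup (hα : 0 ≤ α) (hT : 0 < T) (hδ : 0 < δ) (hβ : 0 < β) :
    ∃ k, 0 < k ∧ ∀ S : Sol α β T K δ, ∀ R, 2 ≤ R → ∀ t ∈ Icc 0 T, ∀ x ∈ Icc (-R) R,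
      ph R x ^ 2 * S.Th x t ^ 2 ≤ k * (1 + S.J R t) := by
  obtain ⟨B, hB, H⟩ := bounds (K := K) hα hT hδ hβ
  obtain ⟨C, hC, HC⟩ := first_order (K := K) hα hT hδ hβ
  have hB0 : 0 < B := by linarith
  set M := (2 + C) ^ (β + 1) / (β + 1) with hM
  have hM0 : 0 < M := by positivity
  refine ⟨2 * M ^ 2 + 4 * B, by positivity, fun S R hR t ht x hx => ?_⟩
  obtain ⟨a, a1, a2, a3, a4⟩ := ph_inward hR hx
  obtain ⟨y, hy, hy2⟩ := exists_le_int (f := fun x => (S.θ x t - 1) ^ 2) (by fun_prop) a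
  have hv : ∀ x, 0 < S.v x t := fun x => S.v_pos x t
  have hJ := S.J_nonneg (by linarith : 0 ≤ R) t
  have h1 := sup_unit_weight (f := fun x => S.Th x t) (fx := fun x => S.Thx x t) (k := fun x => S.v x t) (by fun_prop)
    (by fun_prop) hv (fun x => S.Th_deriv hβ x t) a3 hy
  have h2 : (S.θ y t - 1) ^ 2 ≤ C :=
    hy2.trans ((int_subset (by fun_prop) (fun x => sq_nonneg _) a1 (by linarith) a2).trans (HC S t ht R (by linarith)).1)
  have h3 : S.θ y t ≤ 2 + C := by nlinarith [sq_nonneg (S.θ y t - 2)]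
  have h4 : S.Th y t ≤ M := by
    have := (S.θ_pos y t).le
    unfold Th; rw [hM]; gcongr
  have h40 : 0 ≤ S.Th y t := by
    have := (S.θ_pos y t).le
    unfold Th; positivity
  have h5 : ∫ z in a..(a + 1), S.v z t ≤ B := by
    have := int_mono (f := fun z => S.v z t) (g := fun _ => B) (a := a) (b := a + 1) (by fun_prop) (by fun_prop) (by linarith)
      fun x _ => ((H S t ht).1 x).2.1
    simpa using this
  have h6 : ph R x ^ 2 * (∫ z in a..(a + 1), S.Thx z t ^ 2 / S.v z t) ≤ 2 * S.J R t := by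
    rw [← intervalIntegral.integral_const_mul]
    have := int_le_one (f := fun z => ph R x ^ 2 * (S.Thx z t ^ 2 / S.v z t)) (c₁ := 2)
      (g₁ := fun z => ph R z ^ 2 / S.v z t * S.Thx z t ^ 2) (a := a) (b := a + 1)
      (by fun_prop (disch := simp)) (by fun_prop (disch := simp)) (by linarith) fun z hz => by
        have := mul_le_mul_of_nonneg_right (a4 z hz) (by have := hv z; positivity : 0 ≤ S.Thx z t ^ 2 / S.v z t)
        refine this.trans (le_of_eq ?_)
        ring
    refine this.trans ?_
    unfold J
    gcongr
    exact int_subset (by fun_prop (disch := simp)) (fun x => by have := hv x; positivity) a1 (by linarith) a2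
  have p0 := ph_mem (by linarith : 0 < R) hx
  have p2 : ph R x ^ 2 ≤ 1 := by nlinarith
  have h7 : 0 ≤ ∫ z in a..(a + 1), S.Thx z t ^ 2 / S.v z t :=
    int_nonneg (by linarith) fun z => by have := hv z; positivity
  have h8 : 0 ≤ ∫ z in a..(a + 1), S.v z t := int_nonneg (by linarith) fun z => (hv z).le
  calc ph R x ^ 2 * S.Th x t ^ 2 ≤ ph R x ^ 2 * (2 * S.Th y t ^ 2
        + 2 * ((∫ z in a..(a + 1), S.Thx z t ^ 2 / S.v z t) * ∫ z in a..(a + 1), S.v z t)) := by gcongr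
    _ = 2 * (ph R x ^ 2 * S.Th y t ^ 2) + 2 * ((ph R x ^ 2 * ∫ z in a..(a + 1), S.Thx z t ^ 2 / S.v z t)
        * ∫ z in a..(a + 1), S.v z t) := by ring
    _ ≤ 2 * (1 * M ^ 2) + 2 * (2 * S.J R t * B) := by gcongr
    _ ≤ _ := by
      have : 0 ≤ M ^ 2 * S.J R t := by positivity
      linarith

/-- Weighted energy identity for the heat flux. -/
theorem J_identity (hβ : 0 < β) {R t : ℝ} (hR : 0 < R) (ht : t ∈ Icc 0 T) :
    S.J R t = S.J R 0 + ∫ s in (0 : ℝ)..t, ∫ x in (-R)..R,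
      (-(ph R x ^ 2 * S.ux x s / S.v x s ^ 2 * S.Thx x s ^ 2)
        - 2 * (S.θ x s ^ β * S.θt x s) * (ph R x ^ 2 * (S.θt x s - (S.Q x s - S.θ x s * S.ux x s) / S.v x s)
          + 2 * ph R x * dph R x * S.Thx x s / S.v x s)) := by
  have e := energy_second (R := R) (f := S.Th) (fx := S.Thx) (fxx := S.Thxx) (ft := fun x t => S.θ x t ^ β * S.θt x t)
    (a := fun x t => ph R x ^ 2 / S.v x t)
    (ax := fun x t => 2 * ph R x * dph R x / S.v x t - ph R x ^ 2 * S.vx x t / S.v x t ^ 2)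
    (at' := fun x t => -(ph R x ^ 2 * S.ux x t / S.v x t ^ 2))
    (by fun_prop) (by fun_prop) (by fun_prop) (by fun_prop (disch := simp)) (by fun_prop (disch := simp))
    (by fun_prop (disch := simp)) (by fun_prop (disch := simp)) (S.Th_deriv hβ) S.Thx_deriv
    (fun x t ht => S.Th_deriv_t hβ x ht)
    (fun x t => ((ph_sq_deriv R x).fun_div (S.dv x t) (S.v_ne x t)).congr_deriv (by have := S.v_ne x t; field_simp))
    (fun x t ht => ((hasDerivAt_const t (ph R x ^ 2)).fun_div (S.dvt x t ht) (S.v_ne x t)).congr_deriv (by ring))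
    (fun _ => by simp [(ph_end hR).1]) (fun _ => by simp [(ph_end hR).2]) ht
  unfold J
  rw [e]
  congr 2
  ext s
  congr 1
  ext x
  rw [S.θt_eq]
  unfold Thxx hfx Thx
  have := S.v_ne x s
  field_simp
  ring

end Sol

theorem flux_pointwise {B i P θ ux Q θt H f f' q g γ : ℝ} (hB : 1 ≤ B) (i0 : 0 ≤ i) (iB : i ≤ B) (hP : 0 ≤ P)
    (hu : ux ^ 2 ≤ γ) (hγ : γ ≤ g) (hQ0 : 0 ≤ Q) (hQ : Q ≤ q * γ) (hPf : P * f' ^ 2 * H ^ 2 ≤ θ) {θ' : ℝ} :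
    -(f ^ 2 * ux * i ^ 2 * H ^ 2) - 2 * (P * θt) * (f ^ 2 * (θt - (Q - θ' * ux) * i) + 2 * f * f' * H * i) ≤
      B * (1 + g) * (f ^ 2 * i * H ^ 2) - P * f ^ 2 * θt ^ 2
        + 4 * B ^ 2 * ((f ^ 2 * P) * (q ^ 2 * g) + f ^ 2 * (P * θ' ^ 2)) * γ + 8 * B ^ 2 * θ := by
  have γ0 : 0 ≤ γ := (sq_nonneg _).trans hu
  have g0 : 0 ≤ g := γ0.trans hγ
  have i2 : i ^ 2 ≤ B ^ 2 := by gcongr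
  have h1 : -(f ^ 2 * ux * i ^ 2 * H ^ 2) ≤ B * (1 + g) * (f ^ 2 * i * H ^ 2) := by
    have a1 : -ux ≤ 1 + g := by nlinarith [sq_nonneg (ux + 1)]
    have a2 : -ux * i ≤ (1 + g) * B := by
      calc -ux * i ≤ (1 + g) * i := by gcongr
        _ ≤ (1 + g) * B := by gcongr
    have a3 : 0 ≤ f ^ 2 * i * H ^ 2 := by positivity
    have := mul_le_mul_of_nonneg_right a2 a3
    linarith
  have h2 : 2 * (P * θt) * (f ^ 2 * ((Q - θ' * ux) * i)) ≤ 1 / 2 * (P * f ^ 2 * θt ^ 2)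
      + 2 * (P * f ^ 2) * ((Q - θ' * ux) ^ 2 * i ^ 2) := by
    have := mul_nonneg (mul_nonneg hP (sq_nonneg f)) (sq_nonneg (θt - 2 * ((Q - θ' * ux) * i)))
    linarith
  have h3 : (Q - θ' * ux) ^ 2 * i ^ 2 ≤ (2 * (q ^ 2 * g * γ + θ' ^ 2 * γ)) * B ^ 2 := by
    refine mul_le_mul ?_ i2 (by positivity) (by positivity)
    have b1 : Q ^ 2 ≤ (q * γ) ^ 2 := by gcongr
    have b2 : θ' ^ 2 * ux ^ 2 ≤ θ' ^ 2 * γ := by gcongr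
    have b3 : q ^ 2 * γ * γ ≤ q ^ 2 * g * γ := by gcongr
    linarith [sq_nonneg (Q + θ' * ux)]
  have h3' := mul_le_mul_of_nonneg_left h3 (by positivity : 0 ≤ 2 * (P * f ^ 2))
  have h4 : -(2 * (P * θt) * (2 * f * f' * H * i)) ≤ 1 / 2 * (P * f ^ 2 * θt ^ 2) + 8 * (P * f' ^ 2 * H ^ 2) * i ^ 2 := by
    have := mul_nonneg hP (sq_nonneg (f * θt + 4 * (f' * H * i)))
    linarith
  have h5 : (P * f' ^ 2 * H ^ 2) * i ^ 2 ≤ θ * B ^ 2 := by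
    have : 0 ≤ P * f' ^ 2 * H ^ 2 := by positivity
    exact mul_le_mul hPf i2 (by positivity) (this.trans hPf)
  linarith

theorem rpow_le_one_add {z p q : ℝ} (hz : 0 < z) (hp : 0 ≤ p) (hpq : p ≤ q) : z ^ p ≤ 1 + z ^ q := by
  have h0 : 0 ≤ z ^ q := by positivity
  rcases le_total z 1 with h | h
  · linarith [Real.rpow_le_one hz.le h hp]
  · linarith [Real.rpow_le_rpow_of_exponent_le h hpq]

namespace Sol

variable {α β T K δ : ℝ} (S : Sol α β T K δ)

theorem Th_sq (hβ : 0 < β) (x t : ℝ) : S.θ x t ^ (2 * β + 2) = (β + 1) ^ 2 * S.Th x t ^ 2 := by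
  have h : β + 1 ≠ 0 := by linarith
  have := (S.θ_pos x t).le
  unfold Th
  rw [show 2 * β + 2 = (β + 1) * (2 : ℕ) by push_cast; ring, Real.rpow_mul this, Real.rpow_natCast]
  field_simp

theorem θ_init_le (x : ℝ) : S.θ x 0 ≤ 2 + 3 * K ^ 2 := by
  have h := sup_unit (f := fun x => S.θ x 0 - 1) (fx := fun x => S.θx x 0) (by fun_prop) (by fun_prop)
    (fun x => (S.dθ x 0).sub_const 1) (left_mem_Icc.2 (by linarith : x ≤ x + 1)) rfl
  have h0 := S.ini_int (by linarith : x ≤ x + 1)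
  have h1 := (int_mono (f := fun x => (S.θ x 0 - 1) ^ 2) (by fun_prop) S.ini_cont (by linarith : x ≤ x + 1)
    fun x _ => by unfold ini; linarith [sq_nonneg (S.v x 0 - 1), sq_nonneg (S.u x 0), sq_nonneg (S.b 0 x 0), sq_nonneg (S.b 1 x 0), sq_nonneg (S.w 0 x 0), sq_nonneg (S.w 1 x 0), sq_nonneg (S.vx x 0), sq_nonneg (S.ux x 0), sq_nonneg (S.θx x 0), sq_nonneg (S.bx 0 x 0), sq_nonneg (S.bx 1 x 0), sq_nonneg (S.wx 0 x 0), sq_nonneg (S.wx 1 x 0)]).trans h0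
  have h2 := (int_mono (f := fun x => S.θx x 0 ^ 2) (by fun_prop) S.ini_cont (by linarith : x ≤ x + 1)
    fun x _ => by unfold ini; linarith [sq_nonneg (S.v x 0 - 1), sq_nonneg (S.u x 0), sq_nonneg (S.b 0 x 0), sq_nonneg (S.b 1 x 0), sq_nonneg (S.w 0 x 0), sq_nonneg (S.w 1 x 0), sq_nonneg (S.vx x 0), sq_nonneg (S.ux x 0), sq_nonneg (S.θ x 0 - 1), sq_nonneg (S.bx 0 x 0), sq_nonneg (S.bx 1 x 0), sq_nonneg (S.wx 0 x 0), sq_nonneg (S.wx 1 x 0)]).trans h0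
  nlinarith [sq_nonneg (S.θ x 0 - 2)]

theorem J_init (hβ : 0 < β) {B R : ℝ} (hR : 0 < R) (hv : ∀ x, B⁻¹ ≤ S.v x 0) (hB : 0 < B) :
    S.J R 0 ≤ B * ((2 + 3 * K ^ 2) ^ β) ^ 2 * K ^ 2 := by
  have h0 := S.ini_int (by linarith : -R ≤ R)
  refine (int_le_one (by fun_prop (disch := simp)) S.ini_cont (c₁ := B * ((2 + 3 * K ^ 2) ^ β) ^ 2) (by linarith) fun x hx => ?_).trans
    (mul_le_mul_of_nonneg_left h0 (by positivity))
  have p0 := ph_mem hR hx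
  have p1 : ph R x ^ 2 ≤ 1 := by nlinarith
  have i1 : (S.v x 0)⁻¹ ≤ B := inv_le_of_inv_le₀ hB (hv x)
  have i0 : 0 < (S.v x 0)⁻¹ := inv_pos.2 (S.v_pos x 0)
  have t0 := (S.θ_pos x 0).le
  have t1 : S.θ x 0 ^ β ≤ (2 + 3 * K ^ 2) ^ β := Real.rpow_le_rpow t0 (S.θ_init_le x) hβ.le
  have t2 : 0 ≤ S.θ x 0 ^ β := by positivity
  have h1 : S.θx x 0 ^ 2 ≤ S.ini x := by
    unfold ini; linarith [sq_nonneg (S.v x 0 - 1), sq_nonneg (S.u x 0), sq_nonneg (S.b 0 x 0), sq_nonneg (S.b 1 x 0), sq_nonneg (S.w 0 x 0), sq_nonneg (S.w 1 x 0), sq_nonneg (S.vx x 0), sq_nonneg (S.ux x 0), sq_nonneg (S.θ x 0 - 1), sq_nonneg (S.bx 0 x 0), sq_nonneg (S.bx 1 x 0), sq_nonneg (S.wx 0 x 0), sq_nonneg (S.wx 1 x 0)]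
  unfold Thx
  calc ph R x ^ 2 / S.v x 0 * (S.θ x 0 ^ β * S.θx x 0) ^ 2
      = ph R x ^ 2 * (S.v x 0)⁻¹ * (S.θ x 0 ^ β) ^ 2 * S.θx x 0 ^ 2 := by ring
    _ ≤ 1 * B * ((2 + 3 * K ^ 2) ^ β) ^ 2 * S.ini x := by gcongr
    _ = _ := by ring

set_option maxHeartbeats 1000000 in
theorem flux_energy (hα : 0 ≤ α) (hT : 0 < T) (hδ : 0 < δ) (hβ : 0 < β) :
    ∃ C, 0 < C ∧ ∀ S : Sol α β T K δ, ∃ R₀, ∀ R, 2 ≤ R → R₀ ≤ R → ∀ t ∈ Icc 0 T,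
      S.J R t ≤ C ∧ ∫ s in (0 : ℝ)..t, ∫ x in (-R)..R, ph R x ^ 2 * (S.θ x s ^ β * S.θt x s ^ 2) ≤ C := by
  obtain ⟨B, hB, H⟩ := bounds (K := K) hα hT hδ hβ
  obtain ⟨C, hC, HC⟩ := first_order (K := K) hα hT hδ hβ
  obtain ⟨k, hk, HT⟩ := Th_sup (K := K) hα hT hδ hβ
  have hB0 : 0 < B := by linarith
  set q := (B + α * B ^ (α + 1)) * B + 1 with hq
  have hq0 : 0 < q := by positivity
  set k' := 1 + (β + 1) ^ 2 * k with hk'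
  have hk'0 : 1 ≤ k' := by have : 0 ≤ (β + 1) ^ 2 * k := by positivity
                           linarith
  set k2 := B * (1 + 2 * C) + 4 * B ^ 2 * k' * (q ^ 2 * (1 + 2 * C) + 1) * C + B with hk2
  have hk20 : 0 < k2 := by positivity
  set c := 1 + B * ((2 + 3 * K ^ 2) ^ β) ^ 2 * K ^ 2 + 8 * B ^ 2 * C with hc
  have hc0 : 1 ≤ c := by
    have : 0 ≤ B * ((2 + 3 * K ^ 2) ^ β) ^ 2 * K ^ 2 + 8 * B ^ 2 * C := by positivity
    linarith
  refine ⟨c * Real.exp (k2 * (T * (1 + 2 * C) + C)), by positivity, fun S => ?_⟩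
  obtain ⟨M, hM0, hM⟩ := bdd_of_tendsto T (f := fun x t => S.θ x t ^ (3 * β)) (by fun_prop (disch := simp)) (S.tθpow (3 * β))
  refine ⟨4 * M, fun R hR2 hR t ht => ?_⟩
  have hR0 : 0 < R := by linarith
  set G : ℝ → ℝ := fun s => ∫ x in (-R)..R, S.gr2 x s with hG
  have cG : Continuous G := cont_int (f := fun x s => S.gr2 x s) (by fun_prop)
  have G0 : ∀ s, 0 ≤ G s := fun s => int_nonneg (by linarith) fun x => S.gr2_nonneg x s
  set D : ℝ → ℝ := fun s => ∫ x in (-R)..R, ph R x ^ 2 * (S.θ x s ^ β * S.θt x s ^ 2) with hD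
  have cD : Continuous D := cont_int (f := fun x s => ph R x ^ 2 * (S.θ x s ^ β * S.θt x s ^ 2)) (by fun_prop (disch := simp))
  have D0 : ∀ s, 0 ≤ D s := fun s => int_nonneg (by linarith) fun x => by have := S.θ_pos x s; positivity
  set N : ℝ → ℝ := fun s => ∫ x in (-R)..R, S.θx x s ^ 2 with hN
  have cN : Continuous N := cont_int (f := fun x s => S.θx x s ^ 2) (by fun_prop)
  have cJ := S.J_cont R
  have J0 := S.J_nonneg hR0.le
  have pw : ∀ s ∈ Icc 0 T, ∫ x in (-R)..R,
      (-(ph R x ^ 2 * S.ux x s / S.v x s ^ 2 * S.Thx x s ^ 2)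
        - 2 * (S.θ x s ^ β * S.θt x s) * (ph R x ^ 2 * (S.θt x s - (S.Q x s - S.θ x s * S.ux x s) / S.v x s)
          + 2 * ph R x * dph R x * S.Thx x s / S.v x s))
      ≤ k2 * ((1 + 2 * C + G s) * (1 + S.J R s)) + (-1) * D s + 8 * B ^ 2 * N s := by
    intro s hs
    obtain ⟨-, hgr, -, -⟩ := HC S s hs R (by linarith)
    have g1 : ∀ x ∈ Icc (-R) R, S.gr x s ≤ 2 * C + G s := fun x hx => by
      have := S.sup_gr_int (by linarith) hx s
      change _ ≤ _ + G s at this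
      linarith
    have hg0 : 0 ≤ 2 * C + G s := by have := G0 s; linarith
    have J1 := J0 s
    set g := 2 * C + G s with hg
    have key := int_le_four (f := fun x => -(ph R x ^ 2 * S.ux x s / S.v x s ^ 2 * S.Thx x s ^ 2)
        - 2 * (S.θ x s ^ β * S.θt x s) * (ph R x ^ 2 * (S.θt x s - (S.Q x s - S.θ x s * S.ux x s) / S.v x s)
          + 2 * ph R x * dph R x * S.Thx x s / S.v x s))
      (g₁ := fun x => ph R x ^ 2 / S.v x s * S.Thx x s ^ 2)
      (g₂ := fun x => ph R x ^ 2 * (S.θ x s ^ β * S.θt x s ^ 2))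
      (g₃ := fun x => S.gr x s) (g₄ := fun x => S.θx x s ^ 2) (a := -R) (b := R)
      (c₁ := B * (1 + g)) (c₂ := -1) (c₃ := 4 * B ^ 2 * (k' * (1 + S.J R s) * (q ^ 2 * g + 1))) (c₄ := 8 * B ^ 2)
      (by fun_prop (disch := simp)) (by fun_prop (disch := simp)) (by fun_prop (disch := simp)) (by fun_prop)
      (by fun_prop) (by linarith) fun x hx => by
        obtain ⟨v1, v2, -⟩ := (H S s hs).1 x
        have i1 : (S.v x s)⁻¹ ≤ B := inv_le_of_inv_le₀ hB0 v1
        have i0 : 0 < (S.v x s)⁻¹ := inv_pos.2 (S.v_pos x s)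
        have θ0 := S.θ_pos x s
        have hP : 0 ≤ S.θ x s ^ β := by positivity
        have hu : S.ux x s ^ 2 ≤ S.gr x s := by unfold gr; linarith [sq_nonneg (S.wx 0 x s), sq_nonneg (S.wx 1 x s), sq_nonneg (S.bx 0 x s), sq_nonneg (S.bx 1 x s)]
        have hPf : S.θ x s ^ β * dph R x ^ 2 * S.Thx x s ^ 2 ≤ S.θx x s ^ 2 := by
          have e : S.θ x s ^ (3 * β) = (S.θ x s ^ β) ^ 3 := by
            rw [mul_comm, show (3 : ℝ) = ((3 : ℕ) : ℝ) by norm_num, Real.rpow_mul θ0.le, Real.rpow_natCast]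
          have hm : S.θ x s ^ (3 * β) ≤ M := (le_abs_self _).trans (hM x s hs)
          have hd : dph R x ^ 2 ≤ (2 / R) ^ 2 := by
            rw [← sq_abs]; gcongr; exact dph_abs hR0 hx
          have h1 : S.θ x s ^ (3 * β) * dph R x ^ 2 ≤ 1 := by
            calc S.θ x s ^ (3 * β) * dph R x ^ 2 ≤ M * (2 / R) ^ 2 := by gcongr
              _ = 4 * M / R ^ 2 := by ring
              _ ≤ 1 := by rw [div_le_one (by positivity)]; nlinarith
          have := mul_le_mul_of_nonneg_right h1 (sq_nonneg (S.θx x s))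
          rw [e] at this
          unfold Thx
          linarith
        have h := flux_pointwise (B := B) (i := (S.v x s)⁻¹) (P := S.θ x s ^ β) (θ := S.θx x s ^ 2) (ux := S.ux x s)
          (Q := S.Q x s) (θt := S.θt x s) (H := S.Thx x s) (f := ph R x) (f' := dph R x) (q := q) (g := g)
          (γ := S.gr x s) (θ' := S.θ x s) hB i0.le i1 hP hu (g1 x hx) (S.Q_nonneg hα x s) (S.Q_le hα hB0 v1 v2) hPf
        have p0 := ph_mem hR0 hx
        have p1 : ph R x ^ 2 ≤ 1 := by nlinarith
        have hTs := HT S R hR2 s hs x hx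
        have bd : ∀ p : ℝ, 0 ≤ p → p ≤ 2 * β + 2 → ph R x ^ 2 * S.θ x s ^ p ≤ k' * (1 + S.J R s) := by
          intro p hp0 hp
          have r := mul_le_mul_of_nonneg_left (rpow_le_one_add θ0 hp0 hp) (sq_nonneg (ph R x))
          rw [S.Th_sq hβ] at r
          have r2 := mul_le_mul_of_nonneg_left hTs (by positivity : 0 ≤ (β + 1) ^ 2)
          rw [hk']
          linarith
        have b1 := bd β hβ.le (by linarith)
        have b2 : ph R x ^ 2 * (S.θ x s ^ β * S.θ x s ^ 2) ≤ k' * (1 + S.J R s) := by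
          have := bd (β + 2) (by linarith) (by linarith)
          rwa [Real.rpow_add θ0, Real.rpow_two] at this
        have b3 : ph R x ^ 2 * S.θ x s ^ β * (q ^ 2 * g) + ph R x ^ 2 * (S.θ x s ^ β * S.θ x s ^ 2) ≤
            k' * (1 + S.J R s) * (q ^ 2 * g + 1) := by
          have := mul_le_mul_of_nonneg_right b1 (by positivity : 0 ≤ q ^ 2 * g)
          linarith
        have b4 := mul_le_mul_of_nonneg_left b3 (by have := S.gr_nonneg x s; positivity : 0 ≤ 4 * B ^ 2 * S.gr x s)
        refine le_trans (le_of_eq ?_) (h.trans ?_)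
        · simp only [div_eq_mul_inv]; ring
        · simp only [div_eq_mul_inv]; linarith
    change _ ≤ _ * S.J R s + _ * D s + _ * (∫ x in (-R)..R, S.gr x s) + _ * N s at key
    refine key.trans ?_
    have e1 := mul_le_mul_of_nonneg_left hgr (by positivity : 0 ≤ 4 * B ^ 2 * (k' * (1 + S.J R s) * (q ^ 2 * g + 1)))
    have e2 : B * (1 + g) * S.J R s ≤ (B + B * (1 + 2 * C)) * ((1 + 2 * C + G s) * (1 + S.J R s)) := by
      have : 1 + 2 * C + G s = 1 + g := by rw [hg]; ring
      rw [this]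
      have z1 : 0 ≤ (B * (1 + 2 * C)) * ((1 + g) * (1 + S.J R s)) := by positivity
      have z2 : 0 ≤ B * (1 + g) := by positivity
      linarith
    have e3 : q ^ 2 * g + 1 ≤ (q ^ 2 * (1 + 2 * C) + 1) * (1 + 2 * C + G s) := by
      have : 1 + 2 * C + G s = 1 + g := by rw [hg]; ring
      rw [this]
      have z1 : 0 ≤ q ^ 2 * (2 * C) * (1 + g) := by positivity
      have z2 : 0 ≤ q ^ 2 := by positivity
      linarith
    have e4 := mul_le_mul_of_nonneg_left e3 (by positivity : 0 ≤ 4 * B ^ 2 * (k' * (1 + S.J R s)) * C)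
    rw [hk2]
    linarith
  have id := fun τ (hτ : τ ∈ Icc 0 T) => S.J_identity hβ hR0 hτ
  have up : ∀ τ ∈ Icc 0 T, 1 + S.J R τ + ∫ s in (0 : ℝ)..τ, D s ≤
      c + ∫ s in (0 : ℝ)..τ, (k2 * (1 + 2 * C + G s)) * (1 + S.J R s) := by
    intro τ hτ
    have h1 := int_le_three (f := fun s => ∫ x in (-R)..R,
      (-(ph R x ^ 2 * S.ux x s / S.v x s ^ 2 * S.Thx x s ^ 2)
        - 2 * (S.θ x s ^ β * S.θt x s) * (ph R x ^ 2 * (S.θt x s - (S.Q x s - S.θ x s * S.ux x s) / S.v x s)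
          + 2 * ph R x * dph R x * S.Thx x s / S.v x s)))
      (g₁ := fun s => (k2 * (1 + 2 * C + G s)) * (1 + S.J R s)) (g₂ := D) (g₃ := N) (c₁ := 1) (c₂ := -1) (c₃ := 8 * B ^ 2)
      (a := 0) (b := τ) (cont_int (f := fun x s => (-(ph R x ^ 2 * S.ux x s / S.v x s ^ 2 * S.Thx x s ^ 2)
        - 2 * (S.θ x s ^ β * S.θt x s) * (ph R x ^ 2 * (S.θt x s - (S.Q x s - S.θ x s * S.ux x s) / S.v x s)
          + 2 * ph R x * dph R x * S.Thx x s / S.v x s))) (by fun_prop (disch := simp)))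
      (by fun_prop) cD cN hτ.1 fun s hs => by
        refine (pw s ⟨hs.1, hs.2.trans hτ.2⟩).trans (le_of_eq ?_)
        ring
    have h2 := id τ hτ
    have h3 := (HC S τ hτ R (by linarith)).2.2.1
    change ∫ s in (0 : ℝ)..τ, N s ≤ C at h3
    have h4 := S.J_init hβ hR0 (fun x => ((H S 0 (left_mem_Icc.2 hT.le)).1 x).1) hB0
    have h5 := mul_le_mul_of_nonneg_left h3 (by positivity : 0 ≤ 8 * B ^ 2)
    rw [h2, hc]
    linarith
  have gw := gronwall (T := T) (c := c) (y := fun s => 1 + S.J R s) (a := fun s => k2 * (1 + 2 * C + G s)) (by fun_prop) (by fun_prop)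
    (fun s => by have := G0 s; positivity) (fun τ hτ => by
      have h1 := up τ hτ
      have h2 : 0 ≤ ∫ s in (0 : ℝ)..τ, D s := int_nonneg hτ.1 D0
      linarith) ht
  have ia : ∫ s in (0 : ℝ)..t, k2 * (1 + 2 * C + G s) ≤ k2 * (T * (1 + 2 * C) + C) := by
    rw [intervalIntegral.integral_const_mul, int_add (by fun_prop) cG, intervalIntegral.integral_const]
    have h3 := (HC S t ht R (by linarith)).2.2.2
    change ∫ s in (0 : ℝ)..t, G s ≤ C at h3
    have h4 : t * (1 + 2 * C) ≤ T * (1 + 2 * C) := mul_le_mul_of_nonneg_right ht.2 (by positivity)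
    rw [sub_zero, smul_eq_mul]
    exact mul_le_mul_of_nonneg_left (by linarith) hk20.le
  have ie : c * Real.exp (∫ s in (0 : ℝ)..t, k2 * (1 + 2 * C + G s)) ≤ c * Real.exp (k2 * (T * (1 + 2 * C) + C)) := by
    gcongr
  have h1 := up t ht
  have h2 : 0 ≤ ∫ s in (0 : ℝ)..t, D s := int_nonneg ht.1 D0
  have h3 := J0 t
  have h4 := h1.trans (gw.trans ie)
  constructor
  · linarith
  · change ∫ s in (0 : ℝ)..t, D s ≤ _
    linarith

set_option maxHeartbeats 1000000 in
theorem second_order (hα : 0 ≤ α) (hT : 0 < T) (hδ : 0 < δ) (hβ : 0 < β) :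
    ∃ C, 0 < C ∧ ∀ S : Sol α β T K δ, ∀ t ∈ Icc 0 T, (∀ x, S.θ x t ≤ C) ∧ ∀ L, 1 ≤ L →
      ∫ x in (-L)..L, S.θx x t ^ 2 ≤ C ∧ ∫ s in (0 : ℝ)..t, ∫ x in (-L)..L, S.θt x s ^ 2 ≤ C := by
  obtain ⟨B, hB, H⟩ := bounds (K := K) hα hT hδ hβ
  obtain ⟨k, hk, HT⟩ := Th_sup (K := K) hα hT hδ hβ
  obtain ⟨C, hC, HF⟩ := flux_energy (K := K) hα hT hδ hβ
  have hB0 : 0 < B := by linarith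
  have hBp : 0 < B ^ β := by positivity
  refine ⟨(1 + (β + 1) ^ 2 * (2 * (k * (1 + C)))) + 2 * (B * (B ^ β) ^ 2 * C) + 2 * (B ^ β * C), by positivity, fun S t ht => ⟨fun x => ?_, fun L hL => ?_⟩⟩
  · obtain ⟨R₀, HR⟩ := HF S
    set R := max (max (2 * |x|) 2) R₀
    have r0 : R₀ ≤ R := le_max_right _ _
    have r1 : 2 * |x| ≤ R := (le_max_left _ _).trans (le_max_left _ _)
    have r2 : 2 ≤ R := (le_max_right _ _).trans (le_max_left _ _)
    have hJ := (HR R r2 r0 t ht).1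
    have h1 := HT S R r2 t ht x (abs_le.1 (by linarith [abs_nonneg x] : |x| ≤ R))
    have h2 := ph_half (by linarith) r1
    have h3 := rpow_le_one_add (S.θ_pos x t) zero_le_one (by linarith : 1 ≤ 2 * β + 2)
    rw [S.Th_sq hβ, Real.rpow_one] at h3
    have h4 : S.Th x t ^ 2 ≤ 2 * (k * (1 + C)) := by
      have := mul_le_mul_of_nonneg_right h2 (sq_nonneg (S.Th x t))
      have := mul_le_mul_of_nonneg_left hJ hk.le
      nlinarith [sq_nonneg (S.Th x t)]
    have h5 := mul_le_mul_of_nonneg_left h4 (sq_nonneg (β + 1))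
    have : 0 ≤ 2 * (B * (B ^ β) ^ 2 * C) + 2 * (B ^ β * C) := by positivity
    linarith
  · obtain ⟨R₀, HR⟩ := HF S
    set R := max (2 * L) R₀
    have r0 : R₀ ≤ R := le_max_right _ _
    have r1 : 2 * L ≤ R := le_max_left _ _
    have hL0 : 0 < L := by linarith
    obtain ⟨hJ, hD⟩ := HR R (by linarith) r0 t ht
    have P1 : ∀ x, ∀ s ∈ Icc 0 T, 1 ≤ B ^ β * S.θ x s ^ β := fun x s hs => by
      have h := ((H S s hs).1 x).2.2
      rw [← Real.mul_rpow hB0.le (S.θ_pos x s).le]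
      refine Real.one_le_rpow ?_ hβ.le
      calc (1 : ℝ) = B * B⁻¹ := by field_simp
        _ ≤ _ := by gcongr
    have z1 : 0 ≤ (β + 1) ^ 2 * (2 * (k * (1 + C))) := by positivity
    have z2 : 0 ≤ B * (B ^ β) ^ 2 * C := by positivity
    have z3 : 0 ≤ B ^ β * C := by positivity
    constructor
    · have a1 := int_le_weight (f := fun x => S.θx x t ^ 2) (by fun_prop) (fun x => sq_nonneg _) hL0 r1
      have a2 := int_le_one (f := fun x => ph R x ^ 2 * S.θx x t ^ 2) (g₁ := fun x => ph R x ^ 2 / S.v x t * S.Thx x t ^ 2)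
        (c₁ := B * (B ^ β) ^ 2) (a := -R) (b := R) (by fun_prop) (by fun_prop (disch := simp)) (by linarith) fun x _ => by
          have h1 := P1 x t ht
          have h2 : 1 ≤ B * (S.v x t)⁻¹ := by
            rw [← div_eq_mul_inv, one_le_div (S.v_pos x t)]; exact ((H S t ht).1 x).2.1
          have h3 : 1 ≤ (B ^ β * S.θ x t ^ β) ^ 2 := one_le_pow₀ h1
          have h4 : 1 ≤ B * (S.v x t)⁻¹ * (B ^ β * S.θ x t ^ β) ^ 2 := one_le_mul_of_one_le_of_one_le h2 h3
          have := mul_le_mul_of_nonneg_right h4 (by positivity : 0 ≤ ph R x ^ 2 * S.θx x t ^ 2)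
          unfold Thx
          rw [div_eq_mul_inv]
          linarith
      have a3 := mul_le_mul_of_nonneg_left hJ (by positivity : 0 ≤ B * (B ^ β) ^ 2)
      change _ ≤ _ * S.J R t at a2
      linarith
    · have a1 := int_le_weight2 (f := fun x s => S.θt x s ^ 2) (by fun_prop) (fun x s => sq_nonneg _) hL0 ht.1 r1
      have a2 := int_le_one (f := fun s => ∫ x in (-R)..R, ph R x ^ 2 * S.θt x s ^ 2)
        (g₁ := fun s => ∫ x in (-R)..R, ph R x ^ 2 * (S.θ x s ^ β * S.θt x s ^ 2)) (c₁ := B ^ β) (a := 0) (b := t)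
        (cont_int (f := fun x s => ph R x ^ 2 * S.θt x s ^ 2) (by fun_prop))
        (cont_int (f := fun x s => ph R x ^ 2 * (S.θ x s ^ β * S.θt x s ^ 2)) (by fun_prop (disch := simp))) ht.1 fun s hs =>
          int_le_one (by fun_prop) (by fun_prop (disch := simp)) (by linarith) fun x _ => by
            have h1 := P1 x s ⟨hs.1, hs.2.trans ht.2⟩
            have := mul_le_mul_of_nonneg_right h1 (by positivity : 0 ≤ ph R x ^ 2 * S.θt x s ^ 2)
            linarith
      have a3 := mul_le_mul_of_nonneg_left hD hBp.le
      linarith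

theorem θxx_eq (x t : ℝ) : S.θxx x t = (S.θ x t ^ β)⁻¹ * S.v x t * S.θt x t
    + (S.θ x t ^ β)⁻¹ * (S.θ x t * S.ux x t - S.Q x t)
    + -(β * (S.θ x t)⁻¹ * S.θx x t ^ 2) + (S.v x t)⁻¹ * S.θx x t * S.vx x t := by
  have h := S.θt_eq x t
  have hv := S.v_ne x t
  have ht := S.θ_ne x t
  have hp : S.θ x t ^ β ≠ 0 := (Real.rpow_pos_of_pos (S.θ_pos x t) β).ne'
  have e : S.θ x t ^ (β - 1) = S.θ x t ^ β * (S.θ x t)⁻¹ := by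
    rw [Real.rpow_sub (S.θ_pos x t), Real.rpow_one, div_eq_mul_inv]
  rw [h]
  unfold hfx
  rw [e]
  field_simp
  ring

theorem θxx_sq_le (hα : 0 ≤ α) (hβ : 0 < β) {B E g x t : ℝ} (hB : 0 < B) (h1 : B⁻¹ ≤ S.v x t) (h2 : S.v x t ≤ B)
    (h3 : B⁻¹ ≤ S.θ x t) (h4 : S.θ x t ≤ E) (hg : S.gr x t ≤ g) :
    S.θxx x t ^ 2 ≤ 4 * ((B ^ β) ^ 2 * B ^ 2 * S.θt x t ^ 2
      + (B ^ β) ^ 2 * (2 * (E ^ 2 + ((B + α * B ^ (α + 1)) * B + 1) ^ 2 * g) * S.gr x t)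
      + β ^ 2 * B ^ 2 * S.θx x t ^ 2 * S.θx x t ^ 2 + B ^ 2 * S.θx x t ^ 2 * S.vx x t ^ 2) := by
  have t0 := S.θ_pos x t
  have v0 := S.v_pos x t
  have γ0 := S.gr_nonneg x t
  have i1 : (S.v x t)⁻¹ ≤ B := inv_le_of_inv_le₀ hB h1
  have i2 : (S.θ x t)⁻¹ ≤ B := inv_le_of_inv_le₀ hB h3
  have i3 : (S.θ x t ^ β)⁻¹ ≤ B ^ β := by
    rw [← Real.inv_rpow t0.le]; exact Real.rpow_le_rpow (by positivity) i2 hβ.le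
  set q := (B + α * B ^ (α + 1)) * B + 1 with hq
  have hq0 : 0 < q := by positivity
  have hQ : S.Q x t ≤ q * S.gr x t := S.Q_le hα hB h1 h2
  have hQ0 := S.Q_nonneg hα x t
  have hu : S.ux x t ^ 2 ≤ S.gr x t := by
    unfold gr; linarith [sq_nonneg (S.wx 0 x t), sq_nonneg (S.wx 1 x t), sq_nonneg (S.bx 0 x t), sq_nonneg (S.bx 1 x t)]
  have b1 : (S.θ x t * S.ux x t - S.Q x t) ^ 2 ≤ 2 * (E ^ 2 + q ^ 2 * g) * S.gr x t := by
    have c1 : S.θ x t ^ 2 * S.ux x t ^ 2 ≤ E ^ 2 * S.gr x t := by gcongr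
    have c2 : S.Q x t ^ 2 ≤ (q * S.gr x t) ^ 2 := by gcongr
    have c3 : q ^ 2 * S.gr x t * S.gr x t ≤ q ^ 2 * S.gr x t * g := by gcongr
    linarith [sq_nonneg (S.θ x t * S.ux x t + S.Q x t)]
  rw [S.θxx_eq]
  refine (sq_four _ _ _ _).trans ?_
  have d1 : ((S.θ x t ^ β)⁻¹ * S.v x t * S.θt x t) ^ 2 ≤ (B ^ β) ^ 2 * B ^ 2 * S.θt x t ^ 2 := by
    rw [mul_pow, mul_pow]; gcongr
  have d2 : ((S.θ x t ^ β)⁻¹ * (S.θ x t * S.ux x t - S.Q x t)) ^ 2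
      ≤ (B ^ β) ^ 2 * (2 * (E ^ 2 + q ^ 2 * g) * S.gr x t) := by
    rw [mul_pow]
    exact mul_le_mul (by gcongr) b1 (sq_nonneg _) (by positivity)
  have d3 : (-(β * (S.θ x t)⁻¹ * S.θx x t ^ 2)) ^ 2 ≤ β ^ 2 * B ^ 2 * S.θx x t ^ 2 * S.θx x t ^ 2 := by
    calc (-(β * (S.θ x t)⁻¹ * S.θx x t ^ 2)) ^ 2 = β ^ 2 * (S.θ x t)⁻¹ ^ 2 * S.θx x t ^ 2 * S.θx x t ^ 2 := by ring
      _ ≤ _ := by gcongr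
  have d4 : ((S.v x t)⁻¹ * S.θx x t * S.vx x t) ^ 2 ≤ B ^ 2 * S.θx x t ^ 2 * S.vx x t ^ 2 := by
    rw [mul_pow, mul_pow]; gcongr
  linarith

set_option maxHeartbeats 1000000 in
theorem θxx_int (hα : 0 ≤ α) (hT : 0 < T) (hδ : 0 < δ) (hβ : 0 < β) :
    ∃ C, 0 < C ∧ ∀ S : Sol α β T K δ, ∀ t ∈ Icc 0 T, ∀ L, 1 ≤ L →
      ∫ s in (0 : ℝ)..t, ∫ x in (-L)..L, S.θxx x s ^ 2 ≤ C := by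
  obtain ⟨B, hB, H⟩ := bounds (K := K) hα hT hδ hβ
  obtain ⟨C, hC, HC⟩ := first_order (K := K) hα hT hδ hβ
  obtain ⟨E, hE, HE⟩ := second_order (K := K) hα hT hδ hβ
  obtain ⟨V, hV, HV⟩ := vx_int (K := K) hα hT hδ hβ
  have hB0 : 0 < B := by linarith
  set q := (B + α * B ^ (α + 1)) * B + 1 with hq
  set m := (B ^ β) ^ 2 with hm
  have hm0 : 0 < m := by positivity
  set c₄ := 4 * (β ^ 2 * B ^ 2 * E + B ^ 2 * V) with hc₄
  have c₄0 : 0 < c₄ := by positivity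
  set F := 1 / (1 / (2 * c₄)) + 4 with hF
  have F0 : 0 < F := by positivity
  set a₁ := 2 * (c₄ * F * E + 8 * m * C * (E ^ 2 + q ^ 2 * (2 * C))) with ha₁
  set a₂ := 8 * m * B ^ 2 with ha₂
  set a₃ := 16 * m * C * q ^ 2 with ha₃
  have a₁0 : 0 < a₁ := by positivity
  have a₂0 : 0 < a₂ := by positivity
  have a₃0 : 0 ≤ a₃ := by positivity
  refine ⟨2 * (a₁ * T + a₂ * E + a₃ * C), by positivity, fun S t ht L hL => ?_⟩
  set R := 2 * L with hR
  have hR1 : 1 ≤ R := by linarith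
  have w := int_le_weight2 (f := fun x s => S.θxx x s ^ 2) (by fun_prop) (fun x s => sq_nonneg _)
    (by linarith : 0 < L) ht.1 (le_refl (2 * L))
  rw [← hR] at w
  set G : ℝ → ℝ := fun s => ∫ x in (-R)..R, S.gr2 x s with hG
  have cG : Continuous G := cont_int (f := fun x s => S.gr2 x s) (by fun_prop)
  set D : ℝ → ℝ := fun s => ∫ x in (-R)..R, S.θt x s ^ 2 with hD
  have cD : Continuous D := cont_int (f := fun x s => S.θt x s ^ 2) (by fun_prop)
  have pw : ∀ s ∈ Icc 0 T, ∫ x in (-R)..R, ph R x ^ 2 * S.θxx x s ^ 2 ≤ a₁ * 1 + a₂ * D s + a₃ * G s := by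
    intro s hs
    obtain ⟨-, hgr, -, -⟩ := HC S s hs R hR1
    obtain ⟨hE1, hE2⟩ := HE S s hs
    have hEx := (hE2 R hR1).1
    have hVx := HV S s hs R hR1
    have G0 : 0 ≤ G s := int_nonneg (by linarith) fun x => S.gr2_nonneg x s
    set X := ∫ x in (-R)..R, ph R x ^ 2 * S.θxx x s ^ 2 with hX
    have X0 : 0 ≤ X := int_nonneg (by linarith) fun x => by positivity
    set Y := 1 / (2 * c₄) * X + F * E with hY
    have Y0 : 0 ≤ Y := by positivity
    have sup : ∀ x ∈ Icc (-R) R, ph R x ^ 2 * S.θx x s ^ 2 ≤ Y := fun x hx => by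
      have := sup_weight (f := fun x => S.θx x s) (fx := fun x => S.θxx x s) (by fun_prop) (by fun_prop)
        (fun x => S.dθx x s) hR1 (by positivity : 0 < 1 / (2 * c₄)) hx
      have h2 := mul_le_mul_of_nonneg_left hEx F0.le
      change _ ≤ 1 / (2 * c₄) * X + F * _ at this
      linarith
    set g := 2 * C + G s with hg
    have hg0 : 0 ≤ g := by positivity
    have key := int_le_four (f := fun x => ph R x ^ 2 * S.θxx x s ^ 2) (g₁ := fun x => S.θt x s ^ 2)
      (g₂ := fun x => S.gr x s) (g₃ := fun x => S.θx x s ^ 2) (g₄ := fun x => S.vx x s ^ 2) (a := -R) (b := R)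
      (c₁ := 4 * m * B ^ 2) (c₂ := 8 * m * (E ^ 2 + q ^ 2 * g)) (c₃ := 4 * (β ^ 2 * B ^ 2 * Y)) (c₄ := 4 * (B ^ 2 * Y))
      (by fun_prop) (by fun_prop) (by fun_prop) (by fun_prop) (by fun_prop) (by linarith) fun x hx => by
        obtain ⟨v1, v2, t1⟩ := (H S s hs).1 x
        have g1 : S.gr x s ≤ g := by
          have := S.sup_gr_int hR1 hx s
          change _ ≤ _ + G s at this
          linarith
        have h := S.θxx_sq_le hα hβ hB0 v1 v2 t1 (hE1 x) g1
        rw [← hq, ← hm] at h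
        have p0 := ph_mem (by linarith : 0 < R) hx
        have p1 : ph R x ^ 2 ≤ 1 := by nlinarith
        have γ0 := S.gr_nonneg x s
        have h' := mul_le_mul_of_nonneg_left h (sq_nonneg (ph R x))
        have k1 := mul_le_mul_of_nonneg_right p1 (by positivity : 0 ≤ 4 * m * B ^ 2 * S.θt x s ^ 2)
        have k2 := mul_le_mul_of_nonneg_right p1 (by positivity : 0 ≤ 8 * m * (E ^ 2 + q ^ 2 * g) * S.gr x s)
        have k3 := mul_le_mul_of_nonneg_right (sup x hx) (by positivity : 0 ≤ 4 * (β ^ 2 * B ^ 2) * S.θx x s ^ 2)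
        have k4 := mul_le_mul_of_nonneg_right (sup x hx) (by positivity : 0 ≤ 4 * B ^ 2 * S.vx x s ^ 2)
        linarith
    change X ≤ _ * D s + _ * (∫ x in (-R)..R, S.gr x s) + _ + _ at key
    have e1 := mul_le_mul_of_nonneg_left hgr (by positivity : 0 ≤ 8 * m * (E ^ 2 + q ^ 2 * g))
    have e2 := mul_le_mul_of_nonneg_left hEx (by positivity : 0 ≤ 4 * (β ^ 2 * B ^ 2 * Y))
    have e3 := mul_le_mul_of_nonneg_left hVx (by positivity : 0 ≤ 4 * (B ^ 2 * Y))
    have e4 : c₄ * Y = 1 / 2 * X + c₄ * F * E := by rw [hY]; field_simp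
    rw [ha₁, ha₂, ha₃]
    have e5 : X ≤ 4 * m * B ^ 2 * D s + 8 * m * (E ^ 2 + q ^ 2 * g) * C + c₄ * Y := by rw [hc₄]; linarith
    rw [e4, hg] at e5
    linarith
  have h1 := int_le_three (f := fun s => ∫ x in (-R)..R, ph R x ^ 2 * S.θxx x s ^ 2) (g₁ := fun _ => 1) (g₂ := D) (g₃ := G)
    (c₁ := a₁) (c₂ := a₂) (c₃ := a₃) (a := 0) (b := t)
    (cont_int (f := fun x s => ph R x ^ 2 * S.θxx x s ^ 2) (by fun_prop)) (by fun_prop) cD cG ht.1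
    fun s hs => pw s ⟨hs.1, hs.2.trans ht.2⟩
  have h2 : ∫ s in (0 : ℝ)..t, D s ≤ E := ((HE S t ht).2 R hR1).2
  have h3 : ∫ s in (0 : ℝ)..t, G s ≤ C := (HC S t ht R hR1).2.2.2
  have h4 := mul_le_mul_of_nonneg_left h2 a₂0.le
  have h5 := mul_le_mul_of_nonneg_left h3 a₃0
  have h6 := mul_le_mul_of_nonneg_left ht.2 a₁0.le
  rw [intervalIntegral.integral_const, sub_zero, smul_eq_mul, mul_one] at h1
  linarith

end Sol

/-- Projection of the time variable onto `[0, T]`. -/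
def clamp (T t : ℝ) : ℝ := max 0 (min T t)

theorem clamp_mem {T : ℝ} (hT : 0 ≤ T) (t : ℝ) : clamp T t ∈ Icc 0 T :=
  ⟨le_max_left _ _, max_le hT (min_le_left _ _)⟩

theorem clamp_eq {T t : ℝ} (ht : t ∈ Icc 0 T) : clamp T t = t := by
  unfold clamp; rw [min_eq_right ht.2, max_eq_right ht.1]

@[fun_prop] theorem clamp_cont (T : ℝ) : Continuous (clamp T) := by unfold clamp; fun_prop

/-- Coordinates on `ℝ × ℝ`. -/
def prj (i : Fin 2) : ℝ × ℝ →L[ℝ] ℝ := ![ContinuousLinearMap.fst ℝ ℝ ℝ, ContinuousLinearMap.snd ℝ ℝ ℝ] i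

@[simp] theorem prj_zero (p : ℝ × ℝ) : prj 0 p = p.1 := rfl
@[simp] theorem prj_one (p : ℝ × ℝ) : prj 1 p = p.2 := rfl

theorem sq2_eq (p : ℝ × ℝ) : sq2 p = prj 0 p ^ 2 + prj 1 p ^ 2 := rfl

theorem prj_abs_le (i : Fin 2) (p : ℝ × ℝ) : |prj i p| ≤ Real.sqrt (sq2 p) := by
  apply Real.abs_le_sqrt
  rw [sq2_eq]
  fin_cases i <;> simp <;> positivity

theorem prj_deriv {f : ℝ → ℝ × ℝ} {f' : ℝ × ℝ} {x : ℝ} (i : Fin 2) (h : HasDerivAt f f' x) :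
    HasDerivAt (fun y => prj i (f y)) (prj i f') x := (prj i).hasFDerivAt.comp_hasDerivAt x h

theorem cont_clamp {E : Type*} [TopologicalSpace E] {T : ℝ} (hT : 0 ≤ T) {f : ℝ → ℝ → E}
    (h : ContinuousOn (fun p : ℝ × ℝ => f p.1 p.2) (univ ×ˢ Icc 0 T)) :
    Continuous fun p : ℝ × ℝ => f p.1 (clamp T p.2) :=
  h.comp_continuous (f := fun p : ℝ × ℝ => (p.1, clamp T p.2)) (by fun_prop) fun p => ⟨trivial, clamp_mem hT p.2⟩

theorem deriv_clamp {E : Type*} [NormedAddCommGroup E] [NormedSpace ℝ E] {T : ℝ} {f : ℝ → ℝ → E} {x t : ℝ}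
    (h : DifferentiableWithinAt ℝ (fun s => f x s) (Icc 0 T) t) (ht : t ∈ Ioo 0 T) :
    HasDerivAt (fun s => f x (clamp T s)) (pdt T f x (clamp T t)) t := by
  rw [clamp_eq (Ioo_subset_Icc_self ht)]
  refine (h.hasDerivWithinAt.hasDerivAt (Icc_mem_nhds ht.1 ht.2)).congr_of_eventuallyEq ?_
  filter_upwards [Icc_mem_nhds ht.1 ht.2] with s hs
  rw [clamp_eq hs]

theorem visc_div {α z : ℝ} (hz : 0 < z) : visc α z / z = mv α z := by
  unfold visc mv
  rw [Real.rpow_sub_one hz.ne']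
  ring

section
variable {α β T K δ : ℝ} {v u θ : ℝ → ℝ → ℝ} {w b : ℝ → ℝ → ℝ × ℝ}

theorem mom_eq (h : IsClassicalSolution α β T v u θ w b) {x t : ℝ} (ht : t ∈ Icc 0 T) :
    pdt T u x t = mv α (v x t) * pdx (pdx u) x t + mvd α (v x t) * pdx v x t * pdx u x t
    - pdx θ x t / v x t + θ x t * pdx v x t / v x t ^ 2
    - (prj 0 (b x t) * prj 0 (pdx b x t) + prj 1 (b x t) * prj 1 (pdx b x t)) := by
  have e := h.eq_mom x t ht
  obtain ⟨d1, d2, d3, d4, d5⟩ := h.diff_x x t ht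
  have d6 := (h.diff_xx x t ht).1
  have hv := h.v_pos x t ht
  have hb := fun i => prj_deriv i d5.hasDerivAt
  have e1 : pdx (fun y s => θ y s / v y s + sq2 (b y s) / 2) x t =
      pdx θ x t / v x t - θ x t * pdx v x t / v x t ^ 2
        + (prj 0 (b x t) * prj 0 (pdx b x t) + prj 1 (b x t) * prj 1 (pdx b x t)) := by
    refine HasDerivAt.deriv (((d3.hasDerivAt.fun_div d1.hasDerivAt hv.ne').fun_add
      ((((hb 0).fun_pow 2).fun_add ((hb 1).fun_pow 2)).div_const 2)).congr_deriv ?_)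
    simp only [pdx]
    field_simp
    ring
  have e2 : pdx (fun y s => visc α (v y s) * pdx u y s / v y s) x t
      = mv α (v x t) * pdx (pdx u) x t + mvd α (v x t) * pdx v x t * pdx u x t := by
    have e3 : (fun y => visc α (v y t) * pdx u y t / v y t) = fun y => mv α (v y t) * pdx u y t := by
      ext y
      rw [← visc_div (h.v_pos y t ht)]
      ring
    change deriv (fun y => visc α (v y t) * pdx u y t / v y t) x = _
    rw [e3]
    refine HasDerivAt.deriv (((Sol.dmv (v := fun y => v y t) (vx := fun y => pdx v y t) hv d1.hasDerivAt).fun_mul d6.hasDerivAt).congr_deriv ?_)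
    simp only [pdx]
    ring
  rw [e1, e2] at e
  linarith

theorem transport_deriv {f : ℝ → ℝ → ℝ × ℝ} {x t : ℝ} (i : Fin 2) (hv : v x t ≠ 0)
    (d1 : DifferentiableAt ℝ (fun y => v y t) x) (d2 : DifferentiableAt ℝ (fun y => f y t) x) :
    prj i (pdx (fun y s => (v y s)⁻¹ • f y s) x t)
      = prj i (pdx f x t) / v x t - prj i (f x t) * pdx v x t / v x t ^ 2 := by
  have : HasDerivAt (fun y => (v y t)⁻¹ • f y t) _ x := (d1.hasDerivAt.fun_inv hv).smul d2.hasDerivAt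
  unfold pdx
  rw [this.deriv]
  simp only [map_add, map_smul, smul_eq_mul]
  ring

theorem w_eq (h : IsClassicalSolution α β T v u θ w b) {x t : ℝ} (ht : t ∈ Icc 0 T) (i : Fin 2) :
    prj i (pdt T w x t) = prj i (pdx b x t) + prj i (pdx (pdx w) x t) / v x t
      - prj i (pdx w x t) * pdx v x t / v x t ^ 2 := by
  have e := congrArg (prj i) (h.eq_w x t ht)
  rw [transport_deriv i (h.v_pos x t ht).ne' (h.diff_x x t ht).1 (h.diff_xx x t ht).2.2.1, map_sub] at e
  linarith

theorem b_eq (hT : 0 < T) (h : IsClassicalSolution α β T v u θ w b) {x t : ℝ} (ht : t ∈ Icc 0 T) (i : Fin 2) :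
    v x t * prj i (pdt T b x t) + pdx u x t * prj i (b x t) - prj i (pdx w x t)
      = prj i (pdx (pdx b) x t) / v x t - prj i (pdx b x t) * pdx v x t / v x t ^ 2 := by
  have e := congrArg (prj i) (h.eq_b x t ht)
  obtain ⟨t1, -, -, -, t5⟩ := h.diff_t x t ht
  have e2 : pdt T (fun y s => v y s • b y s) x t = v x t • pdt T b x t + pdx u x t • b x t := by
    rw [← h.eq_mass x t ht]
    exact (t1.hasDerivWithinAt.smul t5.hasDerivWithinAt).derivWithin (uniqueDiffOn_Icc hT t ht)
  rw [transport_deriv i (h.v_pos x t ht).ne' (h.diff_x x t ht).1 (h.diff_xx x t ht).2.2.2, map_sub, e2] at e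
  simpa using e

theorem temp_eq (h : IsClassicalSolution α β T v u θ w b) {x t : ℝ} (ht : t ∈ Icc 0 T) :
    pdt T θ x t + θ x t / v x t * pdx u x t
    = θ x t ^ β * pdx (pdx θ) x t / v x t + β * θ x t ^ (β - 1) * pdx θ x t ^ 2 / v x t
      - θ x t ^ β * pdx θ x t * pdx v x t / v x t ^ 2
      + (mv α (v x t) * v x t * pdx u x t ^ 2 + (prj 0 (pdx w x t) ^ 2 + prj 1 (pdx w x t) ^ 2)
        + (prj 0 (pdx b x t) ^ 2 + prj 1 (pdx b x t) ^ 2)) / v x t := by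
  have hv := h.v_pos x t ht
  have hθ := h.θ_pos x t ht
  obtain ⟨d1, d2, d3, d4, d5⟩ := h.diff_x x t ht
  have d6 := (h.diff_xx x t ht).2.1
  have e1 : pdx (fun y s => θ y s ^ β * pdx θ y s / v y s) x t = θ x t ^ β * pdx (pdx θ) x t / v x t
      + β * θ x t ^ (β - 1) * pdx θ x t ^ 2 / v x t - θ x t ^ β * pdx θ x t * pdx v x t / v x t ^ 2 := by
    refine HasDerivAt.deriv ((((d3.hasDerivAt.rpow_const (Or.inl hθ.ne')).fun_mul d6.hasDerivAt).fun_div d1.hasDerivAt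
      hv.ne').congr_deriv ?_)
    simp only [pdx]
    field_simp
    ring
  rw [h.eq_temp x t ht, e1, ← visc_div hv, div_mul_cancel₀ _ hv.ne']
  rfl

theorem init_le (hT : 0 < T) (h : IsClassicalSolution α β T v u θ w b) (ha : Admissible K δ v u θ w b) {L : ℝ} (hL : 0 ≤ L) :
    ∫ x in (-L)..L, ((v x 0 - 1) ^ 2 + u x 0 ^ 2 + (θ x 0 - 1) ^ 2 + sq2 (b x 0) + sq2 (w x 0)
      + pdx v x 0 ^ 2 + pdx u x 0 ^ 2 + pdx θ x 0 ^ 2 + sq2 (pdx b x 0) + sq2 (pdx w x 0)) ≤ K ^ 2 := by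
  obtain ⟨i1, i2, i3, i4, i5, i6, i7, i8, i9, i10⟩ := h.sq_int 0 (left_mem_Icc.2 hT.le)
  refine le_trans ?_ ha.1
  rw [intervalIntegral.integral_of_le (by linarith)]
  refine setIntegral_le_integral
    (((((((((i1.add i2).add i3).add i4).add i5).add i6).add i7).add i8).add i9).add i10) (Eventually.of_forall fun x => ?_)
  simp only [sq2, Pi.zero_apply]
  positivity

theorem exists_sol (hT : 0 < T) (h : IsClassicalSolution α β T v u θ w b) (ha : Admissible K δ v u θ w b) :
    ∃ S : Sol α β T K δ, ∀ x, ∀ t ∈ Icc 0 T,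
      S.θx x t = pdx θ x t ∧ S.θxx x t = pdx (pdx θ) x t ∧ S.θt x t = pdt T θ x t := by
  have m := clamp_mem hT.le
  have c0 : clamp T 0 = 0 := clamp_eq (left_mem_Icc.2 hT.le)
  have c1 := h.cont
  have c2 := h.cont_dx
  have c3 := h.cont_dxx
  have c4 := h.cont_dt
  refine ⟨{
    v := fun x t => v x (clamp T t)
    vx := fun x t => pdx v x (clamp T t)
    u := fun x t => u x (clamp T t)
    ux := fun x t => pdx u x (clamp T t)
    uxx := fun x t => pdx (pdx u) x (clamp T t)
    ut := fun x t => pdt T u x (clamp T t)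
    θ := fun x t => θ x (clamp T t)
    θx := fun x t => pdx θ x (clamp T t)
    θxx := fun x t => pdx (pdx θ) x (clamp T t)
    θt := fun x t => pdt T θ x (clamp T t)
    w := fun i x t => prj i (w x (clamp T t))
    wx := fun i x t => prj i (pdx w x (clamp T t))
    wxx := fun i x t => prj i (pdx (pdx w) x (clamp T t))
    wt := fun i x t => prj i (pdt T w x (clamp T t))
    b := fun i x t => prj i (b x (clamp T t))
    bx := fun i x t => prj i (pdx b x (clamp T t))
    bxx := fun i x t => prj i (pdx (pdx b) x (clamp T t))
    bt := fun i x t => prj i (pdt T b x (clamp T t))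
    cv := cont_clamp hT.le c1.fst
    cvx := cont_clamp hT.le c2.fst
    cu := cont_clamp hT.le c1.snd.fst
    cux := cont_clamp hT.le c2.snd.fst
    cuxx := cont_clamp hT.le c3.fst
    cut := cont_clamp hT.le c4.snd.fst
    cθ := cont_clamp hT.le c1.snd.snd.fst
    cθx := cont_clamp hT.le c2.snd.snd.fst
    cθxx := cont_clamp hT.le c3.snd.fst
    cθt := cont_clamp hT.le c4.snd.snd.fst
    cw := fun i => (prj i).continuous.comp (cont_clamp hT.le c1.snd.snd.snd.fst)
    cwx := fun i => (prj i).continuous.comp (cont_clamp hT.le c2.snd.snd.snd.fst)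
    cwxx := fun i => (prj i).continuous.comp (cont_clamp hT.le c3.snd.snd.fst)
    cwt := fun i => (prj i).continuous.comp (cont_clamp hT.le c4.snd.snd.snd.fst)
    cb := fun i => (prj i).continuous.comp (cont_clamp hT.le c1.snd.snd.snd.snd)
    cbx := fun i => (prj i).continuous.comp (cont_clamp hT.le c2.snd.snd.snd.snd)
    cbxx := fun i => (prj i).continuous.comp (cont_clamp hT.le c3.snd.snd.snd)
    cbt := fun i => (prj i).continuous.comp (cont_clamp hT.le c4.snd.snd.snd.snd)
    dv := fun x t => (h.diff_x x _ (m t)).1.hasDerivAt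
    du := fun x t => (h.diff_x x _ (m t)).2.1.hasDerivAt
    dux := fun x t => (h.diff_xx x _ (m t)).1.hasDerivAt
    dθ := fun x t => (h.diff_x x _ (m t)).2.2.1.hasDerivAt
    dθx := fun x t => (h.diff_xx x _ (m t)).2.1.hasDerivAt
    dw := fun i x t => prj_deriv i (h.diff_x x _ (m t)).2.2.2.1.hasDerivAt
    dwx := fun i x t => prj_deriv i (h.diff_xx x _ (m t)).2.2.1.hasDerivAt
    db := fun i x t => prj_deriv i (h.diff_x x _ (m t)).2.2.2.2.hasDerivAt
    dbx := fun i x t => prj_deriv i (h.diff_xx x _ (m t)).2.2.2.hasDerivAt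
    dvt := fun x t ht => by
      rw [← h.eq_mass x _ (m t)]
      exact deriv_clamp (h.diff_t x t (Ioo_subset_Icc_self ht)).1 ht
    dut := fun x t ht => deriv_clamp (h.diff_t x t (Ioo_subset_Icc_self ht)).2.1 ht
    dθt := fun x t ht => deriv_clamp (h.diff_t x t (Ioo_subset_Icc_self ht)).2.2.1 ht
    dwt := fun i x t ht => prj_deriv i (deriv_clamp (h.diff_t x t (Ioo_subset_Icc_self ht)).2.2.2.1 ht)
    dbt := fun i x t ht => prj_deriv i (deriv_clamp (h.diff_t x t (Ioo_subset_Icc_self ht)).2.2.2.2 ht)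
    v_pos := fun x t => h.v_pos x _ (m t)
    θ_pos := fun x t => h.θ_pos x _ (m t)
    eq_u := fun x t => mom_eq h (m t)
    eq_w := fun i x t => w_eq h (m t) i
    eq_b := fun i x t => b_eq hT h (m t) i
    eq_θ := fun x t => temp_eq h (m t)
    far := fun ε hε => by
      obtain ⟨M, hM⟩ := h.farfield ε hε
      refine ⟨M, fun x t hx => ?_⟩
      obtain ⟨f1, f2, f3, f4, f5⟩ := hM x _ (m t) hx
      exact ⟨f1, f2, f3, fun i => (prj_abs_le i _).trans_lt f4, fun i => (prj_abs_le i _).trans_lt f5⟩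
    init := fun L hL => by
      rw [c0]
      exact init_le hT h ha hL
    v_init := fun x => by rw [c0]; exact ha.2.1 x
    θ_init := fun x => by rw [c0]; exact ha.2.2 x }, fun x t ht => ?_⟩
  simp only [clamp_eq ht, and_self]

end

theorem integral_le_of_forall {f : ℝ → ℝ} {C : ℝ} (hC : 0 ≤ C)
    (h : ∀ L, 1 ≤ L → ∫ x in (-L)..L, f x ≤ C) : ∫ x, f x ≤ C := by
  by_cases hf : Integrable f
  · refine le_of_tendsto (intervalIntegral_tendsto_integral hf tendsto_neg_atTop_atBot tendsto_id) ?_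
    filter_upwards [eventually_ge_atTop 1] with L hL using h L hL
  · rwa [integral_undef hf]

theorem iterated_integral_le {T C : ℝ} (hT : 0 ≤ T) (hC : 0 ≤ C) {F : ℝ → ℝ → ℝ}
    (cF : Continuous fun p : ℝ × ℝ => F p.1 p.2) (F0 : ∀ x s, 0 ≤ F x s)
    (h : ∀ L, 1 ≤ L → ∫ s in (0 : ℝ)..T, ∫ x in (-L)..L, F x s ≤ C) :
    ∫ s in (0 : ℝ)..T, ∫ x, F x s ≤ C := by
  rw [intervalIntegral.integral_of_le hT]
  by_cases hi : Integrable (fun s => ∫ x, F x s) (volume.restrict (Ioc 0 T))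
  swap
  · rwa [integral_undef hi]
  rw [integral_eq_lintegral_of_nonneg_ae (Eventually.of_forall fun s => integral_nonneg fun x => F0 x s)
    hi.aestronglyMeasurable]
  refine ENNReal.toReal_le_of_le_ofReal hC ?_
  set l : ℕ → ℝ := fun n => n + 1 with hl
  have l1 : ∀ n, 1 ≤ l n := fun n => by simp [hl]
  have lt : Tendsto l atTop atTop := tendsto_atTop_add_const_right _ _ tendsto_natCast_atTop_atTop
  have cg : ∀ n, Continuous fun s => ∫ x in (-l n)..l n, F x s := fun n => cont_int cF
  calc ∫⁻ s in Ioc 0 T, ENNReal.ofReal (∫ x, F x s)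
      ≤ ∫⁻ s in Ioc 0 T, liminf (fun n => ENNReal.ofReal (∫ x in (-l n)..l n, F x s)) atTop := by
        refine lintegral_mono fun s => ?_
        by_cases hs : Integrable fun x => F x s
        · exact (((ENNReal.continuous_ofReal.tendsto _).comp ((intervalIntegral_tendsto_integral hs
            tendsto_neg_atTop_atBot tendsto_id).comp lt)).liminf_eq).ge
        · rw [integral_undef hs]; simp
    _ ≤ liminf (fun n => ∫⁻ s in Ioc 0 T, ENNReal.ofReal (∫ x in (-l n)..l n, F x s)) atTop :=
        lintegral_liminf_le fun n => (cg n).measurable.ennreal_ofReal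
    _ ≤ ENNReal.ofReal C := by
        refine liminf_le_of_frequently_le' (Frequently.of_forall fun n => ?_)
        rw [← ofReal_integral_eq_lintegral_ofReal ((cg n).integrableOn_Ioc)
          (Eventually.of_forall fun s => int_nonneg (by linarith [l1 n]) fun x => F0 x s)]
        refine ENNReal.ofReal_le_ofReal ?_
        rw [← intervalIntegral.integral_of_le hT]
        exact h _ (l1 n)

end MHD

/-- Lemma 2.8 of the paper: second-order energy estimate for `θ`. -/
theorem theta_higher_order_bound (α β T K δ : ℝ) (hα : 0 ≤ α) (hβ : 0 < β) (hT : 0 < T)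
    (hK : 0 < K) (hδ₀ : 0 < δ) (hδ₁ : δ ≤ 1) :
    ∃ C : ℝ, 0 < C ∧
      ∀ (v u θ : ℝ → ℝ → ℝ) (w b : ℝ → ℝ → ℝ × ℝ),
        IsClassicalSolution α β T v u θ w b → Admissible K δ v u θ w b →
        ∀ t ∈ Icc (0:ℝ) T,
          (∫ x : ℝ, (pdx θ x t) ^ 2)
            + (∫ s in (0:ℝ)..T, ∫ x : ℝ,
                ((pdt T θ x s) ^ 2 + (pdx (pdx θ) x s) ^ 2)) ≤ C := by
  obtain ⟨E, hE, HE⟩ := MHD.Sol.second_order (K := K) hα hT hδ₀ hβ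
  obtain ⟨C, hC, HC⟩ := MHD.Sol.θxx_int (K := K) hα hT hδ₀ hβ
  refine ⟨E + (E + C), by positivity, fun v u θ w b h ha t ht => ?_⟩
  obtain ⟨S, hS⟩ := MHD.exists_sol hT h ha
  refine add_le_add ?_ ?_
  · simp only [← (hS _ t ht).1]
    exact MHD.integral_le_of_forall hE.le fun L hL => ((HE S t ht).2 L hL).1
  · have e : ∫ s in (0 : ℝ)..T, ∫ x, (pdt T θ x s ^ 2 + pdx (pdx θ) x s ^ 2)
        = ∫ s in (0 : ℝ)..T, ∫ x, (S.θt x s ^ 2 + S.θxx x s ^ 2) := by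
      refine intervalIntegral.integral_congr fun s hs => ?_
      rw [uIcc_of_le hT.le] at hs
      simp only [(hS _ s hs).2.1, (hS _ s hs).2.2]
    rw [e]
    refine MHD.iterated_integral_le (F := fun x s => S.θt x s ^ 2 + S.θxx x s ^ 2) hT.le (by positivity) (by fun_prop)
      (fun x s => by positivity) fun L hL => ?_
    have hTT : T ∈ Icc 0 T := right_mem_Icc.2 hT.le
    have h1 := ((HE S T hTT).2 L hL).2
    have h2 := HC S T hTT L hL
    have h3 : ∀ s, ∫ x in (-L)..L, (S.θt x s ^ 2 + S.θxx x s ^ 2)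
        = (∫ x in (-L)..L, S.θt x s ^ 2) + ∫ x in (-L)..L, S.θxx x s ^ 2 := fun s =>
      MHD.int_add (by fun_prop) (by fun_prop)
    simp only [h3]
    rw [MHD.int_add (MHD.cont_int (f := fun x s => S.θt x s ^ 2) (by fun_prop))
      (MHD.cont_int (f := fun x s => S.θxx x s ^ 2) (by fun_prop))]
    exact add_le_add h1 h2
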